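/- arXiv:2004.01784 — 3 statements merged into one kernel-verified Lean document; each statement's English description precedes it below -/
import Mathlib

section
/- Let χ : ℝ^{2d} → ℝ^{2d} be a tame canonical transformation and let T : 𝓢(ℝ^d) → 𝓢'(ℝ^d) be a continuous linear operator such that for every s ≥ 0 there exists C_s > 0 with |V_g( T π(z)g )(w)| ≤ C_s ⟨w − χ(z)⟩^{−s} for all z, w ∈ ℝ^{2d}. Then for every 1 ≤ p ≤ ∞ there is a constant C > 0 such that ‖Tφ‖_{M^p} ≤ C ‖φ‖_{M^p} for all φ ∈ 𝓢(ℝ^d); in particular T extends to a bounded operator on M^p(ℝ^d) for every 1 ≤ p ≤ ∞, and on L²(ℝ^d) = M²(ℝ^d). -/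
open MeasureTheory Real Filter
open scoped RealInnerProductSpace ENNReal

noncomputable section

/-- The Gaussian window `g(t) = e^{-π|t|²}` on `ℝ^d`. -/
def gaussWindow {d : ℕ} (t : EuclideanSpace ℝ (Fin d)) : ℂ :=
  (Real.exp (-π * ‖t‖ ^ 2) : ℝ)

/-- The short-time Fourier transform with Gaussian window:
`V_g f(x,ξ) = ∫ e^{-2πi ξ·t} f(t) g(t-x) dt`. -/
def STFT {d : ℕ} (f : EuclideanSpace ℝ (Fin d) → ℂ)
    (x ξ : EuclideanSpace ℝ (Fin d)) : ℂ :=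
  ∫ (t : EuclideanSpace ℝ (Fin d)),
    Complex.exp (-(((2 * π * ⟪ξ, t⟫ : ℝ) : ℂ) * Complex.I)) * f t * gaussWindow (t - x)

/-- The squared Euclidean norm on phase space `ℝ^{2d} = ℝ^d × ℝ^d`. -/
def sqNorm2 {d : ℕ} (z : EuclideanSpace ℝ (Fin d) × EuclideanSpace ℝ (Fin d)) : ℝ :=
  ‖z.1‖ ^ 2 + ‖z.2‖ ^ 2

/-- A **tame canonical transformation**: a smooth diffeomorphism of phase space
`ℝ^{2d} = ℝ^d × ℝ^d` whose Jacobian at each point preserves the standard symplectic form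
`ω((x,ξ),(y,η)) = ξ·y - x·η`, and all of whose derivatives of order `≥ 1` are bounded. -/
def IsTameCanonical {d : ℕ}
    (χ : EuclideanSpace ℝ (Fin d) × EuclideanSpace ℝ (Fin d) →
      EuclideanSpace ℝ (Fin d) × EuclideanSpace ℝ (Fin d)) : Prop :=
  ContDiff ℝ (⊤ : ℕ∞) χ ∧ Function.Bijective χ ∧
    ContDiff ℝ (⊤ : ℕ∞) (Function.invFun χ) ∧
    (∀ z u v, ⟪(fderiv ℝ χ z u).2, (fderiv ℝ χ z v).1⟫ -
        ⟪(fderiv ℝ χ z u).1, (fderiv ℝ χ z v).2⟫ = ⟪u.2, v.1⟫ - ⟪u.1, v.2⟫) ∧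
    ∀ n : ℕ, 1 ≤ n → ∃ C : ℝ, ∀ z, ‖iteratedFDeriv ℝ n χ z‖ ≤ C

section

open scoped SchwartzMap ContDiff BoundedContinuousFunction

namespace SchwartzMap

set_option maxSynthPendingDepth 3

section WeakIntegral

variable {E : Type*} [NormedAddCommGroup E] [NormedSpace ℝ E]
  {F : Type*} [NormedAddCommGroup F] [NormedSpace ℝ F] [NormedSpace ℂ F] [SMulCommClass ℝ ℂ F]

/-- The bounded continuous function `‖·‖ ^ k • D^l f`. -/
def weightedDeriv (k l : ℕ) (f : 𝓢(E, F)) : E →ᵇ E [×l]→L[ℝ] F :=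
  BoundedContinuousFunction.ofNormedAddCommGroup
    (fun x ↦ ‖x‖ ^ k • iteratedFDeriv ℝ l f x)
    ((continuous_norm.pow k).smul ((f.smooth ⊤).continuous_iteratedFDeriv
      (by exact_mod_cast le_top)))
    (SchwartzMap.seminorm ℂ k l f)
    (fun x ↦ by simpa [norm_smul] using f.le_seminorm ℂ k l x)

theorem weightedDeriv_apply (k l : ℕ) (f : 𝓢(E, F)) (x : E) :
    weightedDeriv k l f x = ‖x‖ ^ k • iteratedFDeriv ℝ l f x := rfl

theorem norm_weightedDeriv (k l : ℕ) (f : 𝓢(E, F)) :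
    ‖weightedDeriv k l f‖ = SchwartzMap.seminorm ℂ k l f := by
  refine le_antisymm (BoundedContinuousFunction.norm_ofNormedAddCommGroup_le _
    (apply_nonneg _ _) fun x ↦ by simpa [norm_smul] using f.le_seminorm ℂ k l x) ?_
  refine f.seminorm_le_bound ℂ k l (norm_nonneg (weightedDeriv k l f)) fun x ↦ ?_
  simpa [weightedDeriv_apply, norm_smul] using (weightedDeriv k l f).norm_coe_le_norm x

/-- The map `f ↦ ‖·‖ ^ k • D^l f` into bounded continuous functions; its norm is the Schwartz
seminorm of index `(k, l)`. -/
def weightedDerivCLM (k l : ℕ) : 𝓢(E, F) →L[ℂ] (E →ᵇ E [×l]→L[ℝ] F) :=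
  mkCLMtoNormedSpace (σ := RingHom.id ℂ) (weightedDeriv k l)
    (fun f g ↦ by
      ext1 x
      have := iteratedFDeriv_add_apply (i := l) ((f.smooth l).contDiffAt (x := x))
        ((g.smooth l).contDiffAt (x := x))
      simp only [weightedDeriv_apply, BoundedContinuousFunction.add_apply,
        show (⇑(f + g)) = ⇑f + ⇑g from rfl, this, smul_add])
    (fun a f ↦ by
      ext1 x
      have := iteratedFDeriv_const_smul_apply (a := a) (i := l) ((f.smooth l).contDiffAt (x := x))
      simp only [weightedDeriv_apply, BoundedContinuousFunction.smul_apply, RingHom.id_apply,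
        show (⇑(a • f)) = a • ⇑f from rfl, this, smul_comm a])
    ⟨{(k, l)}, 1, zero_le_one, fun f ↦ by
      rw [Finset.sup_singleton, one_mul]
      exact (norm_weightedDeriv k l f).le⟩

theorem weightedDerivCLM_apply (k l : ℕ) (f : 𝓢(E, F)) :
    weightedDerivCLM k l f = weightedDeriv k l f := rfl

theorem continuous_iteratedFDeriv_apply (l : ℕ) (x : E) :
    Continuous fun f : 𝓢(E, F) ↦ iteratedFDeriv ℝ l f x := by
  have h : Continuous fun f : 𝓢(E, F) ↦ weightedDerivCLM 0 l f x :=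
    (continuous_eval_const x).comp (weightedDerivCLM 0 l).continuous
  simpa [weightedDerivCLM_apply, weightedDeriv_apply] using h

variable {Z : Type*} [TopologicalSpace Z] [SecondCountableTopology Z] [MeasurableSpace Z]
  [OpensMeasurableSpace Z] {μ : Measure Z}

theorem integrable_iteratedFDeriv_apply {f : Z → 𝓢(E, F)} (hf : Continuous f)
    (hint : ∀ k l, Integrable (fun z ↦ SchwartzMap.seminorm ℂ k l (f z)) μ) (l : ℕ) (t : E) :
    Integrable (fun z ↦ iteratedFDeriv ℝ l (f z) t) μ :=
  (hint 0 l).mono' ((continuous_iteratedFDeriv_apply l t).comp hf).aestronglyMeasurable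
    (.of_forall fun z ↦ by simpa using (f z).le_seminorm ℂ 0 l t)

theorem iteratedFDeriv_eq_integral [CompleteSpace F] {f : Z → 𝓢(E, F)} (hf : Continuous f)
    (hint : ∀ k l, Integrable (fun z ↦ SchwartzMap.seminorm ℂ k l (f z)) μ) {φ : E → F}
    (hφ : ∀ t, φ t = ∫ z, f z t ∂μ) (l : ℕ) (t : E) :
    iteratedFDeriv ℝ l φ t = ∫ z, iteratedFDeriv ℝ l (f z) t ∂μ := by
  induction l generalizing t with
  | zero =>
    simp only [iteratedFDeriv_zero_eq_comp, Function.comp_apply, hφ t]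
    exact ((continuousMultilinearCurryFin0 ℝ E F).symm.toContinuousLinearEquiv.integral_comp_comm
      _).symm
  | succ l ih =>
    have hint' : Integrable (fun z ↦ fderiv ℝ (iteratedFDeriv ℝ l (f z)) t) μ := by
      simp only [fderiv_iteratedFDeriv, Function.comp_apply]
      exact (ContinuousLinearMap.integrable_comp
        (continuousMultilinearCurryLeftEquiv ℝ (fun _ : Fin (l + 1) ↦ E)
          F).toContinuousLinearEquiv.toContinuousLinearMap
        (integrable_iteratedFDeriv_apply hf hint (l + 1) t))
    have key : HasFDerivAt (fun t ↦ ∫ z, iteratedFDeriv ℝ l (f z) t ∂μ)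
        (∫ z, fderiv ℝ (iteratedFDeriv ℝ l (f z)) t ∂μ) t := by
      refine hasFDerivAt_integral_of_dominated_of_fderiv_le (s := Set.univ)
        (F := fun t z ↦ iteratedFDeriv ℝ l (f z) t)
        (F' := fun t z ↦ fderiv ℝ (iteratedFDeriv ℝ l (f z)) t)
        (bound := fun z ↦ SchwartzMap.seminorm ℂ 0 (l + 1) (f z)) Filter.univ_mem
        (.of_forall fun t ↦ (integrable_iteratedFDeriv_apply hf hint l t).aestronglyMeasurable)
        (integrable_iteratedFDeriv_apply hf hint l t) ?_ ?_ (hint 0 (l + 1)) ?_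
      · exact hint'.aestronglyMeasurable
      · refine .of_forall fun z t _ ↦ ?_
        rw [norm_fderiv_iteratedFDeriv]
        simpa using (f z).le_seminorm ℂ 0 (l + 1) t
      · refine .of_forall fun z t _ ↦ DifferentiableAt.hasFDerivAt ?_
        exact ((f z).smooth (l + 1)).differentiable_iteratedFDeriv
          (by exact_mod_cast Nat.lt_succ_self l) t
    rw [iteratedFDeriv_succ_eq_comp_left, Function.comp_apply, funext ih, key.fderiv]
    simp only [iteratedFDeriv_succ_eq_comp_left, Function.comp_apply]
    exact (ContinuousLinearMap.integral_comp_comm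
      (continuousMultilinearCurryLeftEquiv ℝ (fun _ : Fin (l + 1) ↦ E)
        F).symm.toContinuousLinearEquiv.toContinuousLinearMap hint').symm

/-- A Schwartz function which is pointwise an absolutely convergent integral of Schwartz functions
is also their weak integral: continuous functionals may be applied under the integral sign. -/
theorem clm_apply_eq_integral [CompleteSpace F] {f : Z → 𝓢(E, F)} (hf : Continuous f)
    (hint : ∀ k l, Integrable (fun z ↦ SchwartzMap.seminorm ℂ k l (f z)) μ) {φ : 𝓢(E, F)}
    (hφ : ∀ t, φ t = ∫ z, f z t ∂μ) (L : 𝓢(E, F) →L[ℂ] ℂ) :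
    L φ = ∫ z, L (f z) ∂μ := by
  obtain ⟨s, C, -, hC⟩ := Seminorm.bound_of_continuous (schwartz_withSeminorms ℂ E F)
    ((normSeminorm ℂ ℂ).comp L.toLinearMap) (by exact L.continuous.norm)
  let s' := insert (0, 0) s
  let J : 𝓢(E, F) →L[ℂ] (∀ i : s', E →ᵇ E [×i.1.2]→L[ℝ] F) :=
    ContinuousLinearMap.pi fun i ↦ weightedDerivCLM i.1.1 i.1.2
  have hJ (i : s') (g) : SchwartzMap.seminorm ℂ i.1.1 i.1.2 g ≤ ‖J g‖ := by
    rw [← norm_weightedDeriv]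
    exact norm_le_pi_norm (J g) i
  have hJinj : Function.Injective J := by
    refine (injective_iff_map_eq_zero J).2 fun g hg ↦ ?_
    have h0 := hJ ⟨(0, 0), Finset.mem_insert_self _ _⟩ g
    ext t
    simpa [hg] using (g.norm_le_seminorm ℂ t).trans h0
  have hLJ (g) : ‖L g‖ ≤ C * ‖J g‖ := by
    refine (hC g).trans ?_
    rw [_root_.smul_apply, NNReal.smul_def, smul_eq_mul]
    gcongr
    refine Seminorm.finset_sup_apply_le (norm_nonneg _) fun i hi ↦ ?_
    exact hJ ⟨i, Finset.mem_insert_of_mem hi⟩ g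
  let R : Submodule ℂ (∀ i : s', E →ᵇ E [×i.1.2]→L[ℝ] F) := LinearMap.range J.toLinearMap
  let e : 𝓢(E, F) ≃ₗ[ℂ] R := LinearEquiv.ofInjective J.toLinearMap hJinj
  let L₀ : StrongDual ℂ (R) :=
    (L.toLinearMap ∘ₗ e.symm.toLinearMap).mkContinuous C fun y ↦ by
      have h : J (e.symm y) = y := congrArg Subtype.val (e.apply_symm_apply y)
      have h' := hLJ (e.symm y)
      rw [h] at h'
      exact h'
  obtain ⟨L₁, hL₁, -⟩ := exists_extension_norm_eq _ L₀
  have hL (g) : L₁ (J g) = L g := by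
    have h1 := hL₁ (e g)
    have h2 : L₀ (e g) = L g := congrArg L (e.symm_apply_apply g)
    rw [← h2, ← h1]
    rfl
  have hJint : Integrable (fun z ↦ J (f z)) μ := by
    refine Integrable.mono' (g := fun z ↦ ∑ i : s', SchwartzMap.seminorm ℂ i.1.1 i.1.2 (f z))
      (integrable_finsetSum _ fun i _ ↦ hint _ _)
      ?_ (.of_forall fun z ↦ ?_)
    · exact (J.continuous.comp hf).aestronglyMeasurable
    · refine (pi_norm_le_iff_of_nonneg (Finset.sum_nonneg fun i _ ↦ apply_nonneg _ _)).2 fun i ↦ ?_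
      refine (norm_weightedDeriv i.1.1 i.1.2 (f z)).le.trans ?_
      exact Finset.single_le_sum (f := fun i : s' ↦ SchwartzMap.seminorm ℂ i.1.1 i.1.2 (f z))
        (fun i _ ↦ apply_nonneg _ _) (Finset.mem_univ i)
  have hI : J φ = ∫ z, J (f z) ∂μ := by
    ext1 i
    ext1 x
    have h1 := ((BoundedContinuousFunction.evalCLM ℝ x).comp
      (ContinuousLinearMap.proj (R := ℝ) (φ := fun i : s' ↦ E →ᵇ E [×i.1.2]→L[ℝ] F)
        i)).integral_comp_comm hJint
    refine Eq.trans ?_ h1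
    change ‖x‖ ^ i.1.1 • iteratedFDeriv ℝ i.1.2 φ x =
      ∫ z, ‖x‖ ^ i.1.1 • iteratedFDeriv ℝ i.1.2 (f z) x ∂μ
    rw [integral_smul, iteratedFDeriv_eq_integral hf hint hφ]
  rw [← hL, hI, ← L₁.integral_comp_comm hJint]
  simp only [hL]

end WeakIntegral

end SchwartzMap

section PolynomialBounds

theorem Complex.hasTemperateGrowth_exp_ofReal_mul_I :
    Function.HasTemperateGrowth fun r : ℝ ↦ Complex.exp (r * Complex.I) := by
  have hd (r : ℝ) : HasDerivAt (fun r : ℝ ↦ Complex.exp (r * Complex.I))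
      (Complex.exp (r * Complex.I) * Complex.I) r := by
    simpa using ((Complex.ofRealCLM.hasDerivAt (x := r)).mul_const Complex.I).cexp
  have hi (n : ℕ) : iteratedDeriv n (fun r : ℝ ↦ Complex.exp (r * Complex.I)) =
      fun r : ℝ ↦ Complex.exp (r * Complex.I) * Complex.I ^ n := by
    induction n with
    | zero => simp
    | succ n ih =>
      ext r
      rw [iteratedDeriv_succ, ih, ((hd r).mul_const _).deriv, pow_succ']
      ring
  refine ⟨?_, fun n ↦ ⟨0, 1, fun r ↦ ?_⟩⟩
  · exact ((Complex.ofRealCLM.contDiff).mul contDiff_const).cexp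
  · rw [norm_iteratedFDeriv_eq_norm_iteratedDeriv, hi]
    simp [Complex.norm_exp_ofReal_mul_I]

/-- Leibniz bound for the iterated derivatives of a product. -/
theorem norm_iteratedFDeriv_mul_le_of_le {W : Type*} [NormedAddCommGroup W] [NormedSpace ℝ W]
    {f g : W → ℂ} (hf : ContDiff ℝ ∞ f) (hg : ContDiff ℝ ∞ g) {n : ℕ} {y : W} {a b : ℝ}
    (ha : ∀ i ≤ n, ‖iteratedFDeriv ℝ i f y‖ ≤ a) (hb : ∀ i ≤ n, ‖iteratedFDeriv ℝ i g y‖ ≤ b) :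
    ‖iteratedFDeriv ℝ n (fun y ↦ f y * g y) y‖ ≤ 2 ^ n * (a * b) := by
  have ha0 : 0 ≤ a := (norm_nonneg _).trans (ha 0 (Nat.zero_le _))
  calc _ ≤ ∑ i ∈ Finset.range (n + 1), (n.choose i : ℝ) * ‖iteratedFDeriv ℝ i f y‖ *
        ‖iteratedFDeriv ℝ (n - i) g y‖ :=
        norm_iteratedFDeriv_mul_le hf hg y (by exact_mod_cast le_top)
    _ ≤ ∑ i ∈ Finset.range (n + 1), (n.choose i : ℝ) * (a * b) := by
        refine Finset.sum_le_sum fun i hi ↦ ?_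
        rw [mul_assoc]
        gcongr
        · exact ha i (Nat.lt_succ_iff.1 (Finset.mem_range.1 hi))
        · exact hb _ (Nat.sub_le _ _)
    _ = 2 ^ n * (a * b) := by
        rw [← Finset.sum_mul]
        congr 1
        exact_mod_cast Nat.sum_range_choose n

namespace SchwartzMap

variable {V D : Type*} [NormedAddCommGroup V] [NormedSpace ℝ V]
  [NormedAddCommGroup D] [NormedSpace ℝ D]

/-- All derivatives of a Schwartz function up to a given order decay at a given rate. -/
theorem exists_decay_bound (G : 𝓢(V, ℂ)) (m n : ℕ) :
    ∃ C, 0 ≤ C ∧ ∀ i ≤ n, ∀ t, (1 + ‖t‖) ^ m * ‖iteratedFDeriv ℝ i G t‖ ≤ C := by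
  refine ⟨_, ?_, fun i hi t ↦ one_add_le_sup_seminorm_apply (𝕜 := ℂ) (m := (m, n)) le_rfl hi G t⟩
  positivity

/-- A smooth function of two variables, all of whose derivatives decay rapidly in the second
variable with constants growing at most polynomially in the first one. -/
def IsSchwartzFamily (Ψ : D × V → ℂ) : Prop :=
  ContDiff ℝ ∞ Ψ ∧ ∀ k n : ℕ, ∃ (N : ℕ) (C : ℝ), 0 ≤ C ∧ ∀ z t,
    (1 + ‖t‖) ^ k * ‖iteratedFDeriv ℝ n Ψ (z, t)‖ ≤ C * (1 + ‖z‖) ^ N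

theorem isSchwartzFamily_mul_comp_sub {e : D × V → ℂ} (he : e.HasTemperateGrowth) (G : 𝓢(V, ℂ))
    (L : D →L[ℝ] V) : IsSchwartzFamily fun y ↦ e y * G (y.2 - L y.1) := by
  let A : D × V →L[ℝ] V := ContinuousLinearMap.snd ℝ D V - L.comp (ContinuousLinearMap.fst ℝ D V)
  have hGA : ContDiff ℝ ∞ (G ∘ A) := (G.smooth ⊤).comp A.contDiff
  refine ⟨he.1.mul hGA, fun k n ↦ ?_⟩
  obtain ⟨N, C₁, hC₁, h₁⟩ := he.norm_iteratedFDeriv_le_uniform n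
  obtain ⟨C₂, hC₂, h₂⟩ := G.exists_decay_bound (N + k) n
  refine ⟨N + k, (2 ^ n * C₁ * C₂ * (1 + ‖A‖) ^ n) * (1 + ‖L‖) ^ (N + k), by positivity,
    fun z t ↦ ?_⟩
  have hA : A (z, t) = t - L z := rfl
  set s := A (z, t) with hs
  have hy : 1 + ‖(z, t)‖ ≤ (1 + ‖L‖) * (1 + ‖z‖) * (1 + ‖s‖) := by
    have h3 : ‖t‖ ≤ ‖s‖ + ‖L‖ * ‖z‖ := by
      have : t = s + L z := by rw [hA]; abel
      calc ‖t‖ = ‖s + L z‖ := by rw [← this]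
        _ ≤ ‖s‖ + ‖L z‖ := norm_add_le _ _
        _ ≤ _ := by gcongr; exact L.le_opNorm z
    have h4 : ‖(z, t)‖ ≤ ‖z‖ + ‖s‖ + ‖L‖ * ‖z‖ := by
      rw [Prod.norm_mk]
      refine max_le ?_ ?_ <;> nlinarith [norm_nonneg s, norm_nonneg z, norm_nonneg L]
    have : 0 ≤ ‖L‖ * ‖z‖ * ‖s‖ := by positivity
    nlinarith [norm_nonneg s, norm_nonneg z, norm_nonneg L,
      mul_nonneg (norm_nonneg L) (norm_nonneg s), mul_nonneg (norm_nonneg z) (norm_nonneg s)]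
  have ht : 1 + ‖t‖ ≤ 1 + ‖(z, t)‖ := by gcongr; exact norm_snd_le (z, t)
  have hb : ∀ i ≤ n, ‖iteratedFDeriv ℝ i (G ∘ A) (z, t)‖ ≤
      C₂ * (1 + ‖A‖) ^ n / (1 + ‖s‖) ^ (N + k) := fun i hi ↦ by
    rw [A.iteratedFDeriv_comp_right (G.smooth ⊤) _ (by exact_mod_cast le_top),
      le_div_iff₀ (by positivity)]
    have h5 := ContinuousMultilinearMap.norm_compContinuousLinearMap_le
      (iteratedFDeriv ℝ i G (A (z, t))) (fun _ ↦ A)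
    rw [Finset.prod_const, Finset.card_univ, Fintype.card_fin] at h5
    have h6 : ‖A‖ ^ i ≤ (1 + ‖A‖) ^ n :=
      (pow_le_pow_left₀ (norm_nonneg _) (by linarith) i).trans
        (pow_le_pow_right₀ (by linarith [norm_nonneg A]) hi)
    calc _ ≤ (‖iteratedFDeriv ℝ i G s‖ * ‖A‖ ^ i) * (1 + ‖s‖) ^ (N + k) := by gcongr
      _ = ((1 + ‖s‖) ^ (N + k) * ‖iteratedFDeriv ℝ i G s‖) * ‖A‖ ^ i := by ring
      _ ≤ _ := by
        gcongr
        exact h₂ i hi s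
  calc _ ≤ (1 + ‖(z, t)‖) ^ k * (2 ^ n * (C₁ * (1 + ‖(z, t)‖) ^ N *
        (C₂ * (1 + ‖A‖) ^ n / (1 + ‖s‖) ^ (N + k)))) := by
        gcongr
        exact norm_iteratedFDeriv_mul_le_of_le he.1 hGA (fun i hi ↦ h₁ i hi _) hb
    _ = (2 ^ n * C₁ * C₂ * (1 + ‖A‖) ^ n) * ((1 + ‖(z, t)‖) ^ (N + k) / (1 + ‖s‖) ^ (N + k)) := by
        rw [pow_add (1 + ‖(z, t)‖)]; ring
    _ ≤ (2 ^ n * C₁ * C₂ * (1 + ‖A‖) ^ n) * ((1 + ‖L‖) * (1 + ‖z‖)) ^ (N + k) := by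
        gcongr
        rw [div_le_iff₀ (by positivity), ← mul_pow]
        gcongr
    _ = _ := by rw [mul_pow]; ring

namespace IsSchwartzFamily

variable {Ψ : D × V → ℂ} {f : D → 𝓢(V, ℂ)}

theorem iteratedFDeriv_slice (hΨ : ContDiff ℝ ∞ Ψ) (hf : ∀ z t, f z t = Ψ (z, t)) (n : ℕ)
    (z : D) (t : V) : iteratedFDeriv ℝ n (f z) t = (iteratedFDeriv ℝ n Ψ
      (z, t)).compContinuousLinearMap fun _ ↦ ContinuousLinearMap.inr ℝ D V := by
  have h1 : ⇑(f z) = (fun y ↦ Ψ ((z, 0) + y)) ∘ ContinuousLinearMap.inr ℝ D V := by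
    ext t; simp [hf]
  have h2 : ContDiff ℝ ∞ fun y ↦ Ψ ((z, 0) + y) := hΨ.comp (contDiff_const.add contDiff_id)
  rw [h1, (ContinuousLinearMap.inr ℝ D V).iteratedFDeriv_comp_right h2 _
    (by exact_mod_cast le_top), iteratedFDeriv_comp_add_left]
  simp

theorem norm_compContinuousLinearMap_inr_le {n : ℕ} (M : (D × V) [×n]→L[ℝ] ℂ) :
    ‖M.compContinuousLinearMap fun _ ↦ ContinuousLinearMap.inr ℝ D V‖ ≤ ‖M‖ := by
  refine (M.norm_compContinuousLinearMap_le _).trans (mul_le_of_le_one_right (norm_nonneg _) ?_)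
  exact Finset.prod_le_one (fun _ _ ↦ norm_nonneg _)
    fun _ _ ↦ ContinuousLinearMap.norm_inr_le_one ℝ D V

theorem exists_seminorm_le (hΨ : IsSchwartzFamily Ψ) (hf : ∀ z t, f z t = Ψ (z, t)) (k n : ℕ) :
    ∃ (N : ℕ) (C : ℝ), 0 ≤ C ∧ ∀ z, SchwartzMap.seminorm ℂ k n (f z) ≤ C * (1 + ‖z‖) ^ N := by
  obtain ⟨N, C, hC, h⟩ := hΨ.2 k n
  refine ⟨N, C, hC, fun z ↦ seminorm_le_bound ℂ k n _ (by positivity) fun t ↦ ?_⟩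
  refine le_trans ?_ (h z t)
  rw [iteratedFDeriv_slice hΨ.1 hf]
  gcongr
  · linarith
  · exact norm_compContinuousLinearMap_inr_le _

theorem continuous (hΨ : IsSchwartzFamily Ψ) (hf : ∀ z t, f z t = Ψ (z, t)) : Continuous f := by
  refine continuous_iff_continuousAt.2 fun z₀ ↦ ?_
  refine ((schwartz_withSeminorms ℂ V ℂ).tendsto_nhds _ _).2 fun ⟨k, n⟩ ε hε ↦ ?_
  obtain ⟨N, C, hC, h⟩ := hΨ.2 k (n + 1)
  set B := C * (2 + ‖z₀‖) ^ N with hB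
  have key : ∀ z ∈ Metric.ball z₀ 1, SchwartzMap.seminorm ℂ k n (f z - f z₀) ≤ B * ‖z - z₀‖ := by
    intro z hz
    refine seminorm_le_bound ℂ k n _ (by positivity) fun t ↦ ?_
    have hsub : iteratedFDeriv ℝ n (⇑(f z - f z₀)) t =
        iteratedFDeriv ℝ n (f z) t - iteratedFDeriv ℝ n (f z₀) t := by
      have := iteratedFDeriv_sub_apply (i := n) (((f z).smooth n).contDiffAt (x := t))
        (((f z₀).smooth n).contDiffAt (x := t))
      exact this
    have hdiff : Differentiable ℝ fun z ↦ iteratedFDeriv ℝ n Ψ (z, t) :=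
      (hΨ.1.differentiable_iteratedFDeriv (by exact_mod_cast WithTop.coe_lt_top n)).comp
        (differentiable_id.prodMk (differentiable_const t))
    have hmv := (convex_ball z₀ 1).norm_image_sub_le_of_norm_fderiv_le
      (f := fun z ↦ iteratedFDeriv ℝ n Ψ (z, t)) (𝕜 := ℝ) (C := B / (1 + ‖t‖) ^ k)
      (fun z _ ↦ hdiff z) (fun z hz ↦ ?_) (Metric.mem_ball_self one_pos) hz
    · rw [hsub, iteratedFDeriv_slice hΨ.1 hf, iteratedFDeriv_slice hΨ.1 hf]
      have h1 : ‖(iteratedFDeriv ℝ n Ψ (z, t) - iteratedFDeriv ℝ n Ψ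
          (z₀, t)).compContinuousLinearMap fun _ ↦ ContinuousLinearMap.inr ℝ D V‖ ≤ _ :=
        (norm_compContinuousLinearMap_inr_le _).trans hmv
      calc _ ≤ (1 + ‖t‖) ^ k * (B / (1 + ‖t‖) ^ k * ‖z - z₀‖) := by
            gcongr
            · linarith
            · exact h1
        _ = B * ‖z - z₀‖ := by field_simp
    · have hcomp : fderiv ℝ (fun z ↦ iteratedFDeriv ℝ n Ψ (z, t)) z =
          (fderiv ℝ (iteratedFDeriv ℝ n Ψ) (z, t)).comp (ContinuousLinearMap.inl ℝ D V) :=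
        HasFDerivAt.fderiv (((hΨ.1.differentiable_iteratedFDeriv
          (by exact_mod_cast WithTop.coe_lt_top n)) (z, t)).hasFDerivAt.comp z
          (hasFDerivAt_prodMk_left z t))
      rw [hcomp, le_div_iff₀ (by positivity)]
      have hz' : 1 + ‖z‖ ≤ 2 + ‖z₀‖ := by
        rw [Metric.mem_ball, dist_eq_norm] at hz
        linarith [norm_le_norm_add_norm_sub' z z₀]
      calc _ ≤ ‖iteratedFDeriv ℝ (n + 1) Ψ (z, t)‖ * 1 * (1 + ‖t‖) ^ k := by
            gcongr
            refine (ContinuousLinearMap.opNorm_comp_le _ _).trans ?_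
            rw [norm_fderiv_iteratedFDeriv]
            gcongr
            exact ContinuousLinearMap.norm_inl_le_one ℝ D V
        _ = (1 + ‖t‖) ^ k * ‖iteratedFDeriv ℝ (n + 1) Ψ (z, t)‖ := by ring
        _ ≤ C * (1 + ‖z‖) ^ N := h z t
        _ ≤ B := by rw [hB]; gcongr
  have hlim : Filter.Tendsto (fun z ↦ B * ‖z - z₀‖) (nhds z₀) (nhds 0) := by
    have : Continuous fun z ↦ B * ‖z - z₀‖ := by fun_prop
    simpa using this.tendsto z₀
  filter_upwards [hlim.eventually_lt_const hε, Metric.ball_mem_nhds z₀ one_pos] with z h1 h2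
  exact (key z h2).trans_lt h1

end IsSchwartzFamily

end SchwartzMap

end PolynomialBounds

instance MeasureTheory.Measure.isAddHaarMeasure_volume_prod {V W : Type*} [NormedAddCommGroup V]
    [InnerProductSpace ℝ V] [FiniteDimensional ℝ V] [MeasurableSpace V] [BorelSpace V]
    [NormedAddCommGroup W] [InnerProductSpace ℝ W] [FiniteDimensional ℝ W] [MeasurableSpace W]
    [BorelSpace W] : (volume : Measure (V × W)).IsAddHaarMeasure :=
  inferInstanceAs ((volume : Measure V).prod volume).IsAddHaarMeasure

namespace SchwartzMap

section GaborInversion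

variable {V : Type*} [NormedAddCommGroup V] [InnerProductSpace ℝ V]

theorem isSchwartzFamily_modulation_translation (c : ℝ) (G : 𝓢(V, ℂ)) :
    IsSchwartzFamily fun y : (V × V) × V ↦
      Complex.exp (((c * ⟪y.1.2, y.2⟫ : ℝ) : ℂ) * Complex.I) * G (y.2 - y.1.1) := by
  have h1 : Function.HasTemperateGrowth fun y : (V × V) × V ↦ y.1.2 :=
    ((ContinuousLinearMap.snd ℝ V V).comp (ContinuousLinearMap.fst ℝ (V × V) V)).hasTemperateGrowth
  have h2 : Function.HasTemperateGrowth fun y : (V × V) × V ↦ y.2 :=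
    (ContinuousLinearMap.snd ℝ (V × V) V).hasTemperateGrowth
  have h3 : Function.HasTemperateGrowth fun y : (V × V) × V ↦ c * ⟪y.1.2, y.2⟫ :=
    (c • innerSL ℝ).bilinear_hasTemperateGrowth h1 h2
  exact isSchwartzFamily_mul_comp_sub (Complex.hasTemperateGrowth_exp_ofReal_mul_I.comp h3) G
    (ContinuousLinearMap.fst ℝ V V)

variable (φ G : 𝓢(V, ℂ))

/-- The localization `t ↦ φ t * G (t - x)` of `φ` near `x`. -/
def localize (x : V) : 𝓢(V, ℂ) := smulLeftCLM ℂ φ (compSubConstCLM ℂ x G)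

theorem localize_apply (x t : V) : localize φ G x t = φ t * G (t - x) := by
  simp [localize, smulLeftCLM_apply_apply φ.hasTemperateGrowth]

theorem exists_seminorm_localize_le (M k n : ℕ) : ∃ C, 0 ≤ C ∧ ∀ x,
    SchwartzMap.seminorm ℂ k n (localize φ G x) ≤ C / (1 + ‖x‖) ^ M := by
  obtain ⟨C₁, hC₁, h₁⟩ := φ.exists_decay_bound (k + M) n
  obtain ⟨C₂, hC₂, h₂⟩ := G.exists_decay_bound M n
  refine ⟨2 ^ n * (C₁ * C₂), by positivity, fun x ↦ seminorm_le_bound ℂ k n _ (by positivity)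
    fun t ↦ ?_⟩
  have hx : 1 + ‖x‖ ≤ (1 + ‖t‖) * (1 + ‖t - x‖) := by
    have h3 : ‖x‖ ≤ ‖t‖ + ‖t - x‖ := by simpa using norm_sub_le t (t - x)
    nlinarith [norm_nonneg t, norm_nonneg (t - x), mul_nonneg (norm_nonneg t) (norm_nonneg (t - x))]
  have hfun : ⇑(localize φ G x) = fun t ↦ φ t * G (t - x) := funext (localize_apply φ G x)
  have hG : ContDiff ℝ ∞ fun t ↦ G (t - x) := (G.smooth ⊤).comp (contDiff_id.sub contDiff_const)
  have hle := norm_iteratedFDeriv_mul_le_of_le (n := n) (y := t) (φ.smooth ⊤) hG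
    (a := C₁ / (1 + ‖t‖) ^ (k + M)) (b := C₂ / (1 + ‖t - x‖) ^ M)
    (fun i hi ↦ by
      rw [le_div_iff₀' (by positivity)]
      exact h₁ i hi t)
    (fun i hi ↦ by
      rw [le_div_iff₀' (by positivity), iteratedFDeriv_comp_sub]
      exact h₂ i hi _)
  rw [hfun]
  calc _ ≤ (1 + ‖t‖) ^ k * (2 ^ n * (C₁ / (1 + ‖t‖) ^ (k + M) * (C₂ / (1 + ‖t - x‖) ^ M))) := by
        gcongr
        linarith
    _ = 2 ^ n * (C₁ * C₂) / ((1 + ‖t‖) * (1 + ‖t - x‖)) ^ M := by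
        rw [pow_add, mul_pow]; field_simp
    _ ≤ _ := by gcongr

variable [FiniteDimensional ℝ V] [MeasurableSpace V] [BorelSpace V]

open FourierTransform

theorem exists_fourier_localize_le (M : ℕ) : ∃ C, 0 ≤ C ∧ ∀ z : V × V,
    (1 + ‖z‖) ^ M * ‖𝓕 (localize φ G z.1) z.2‖ ≤ C := by
  let q : Seminorm ℂ 𝓢(V, ℂ) :=
    ((Finset.Iic (M, 0)).sup fun m ↦ SchwartzMap.seminorm ℂ m.1 m.2).comp
      (fourierCLM ℂ 𝓢(V, ℂ)).toLinearMap
  have hq : Continuous q := by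
    have h1 := Seminorm.continuous_finsetSup (s := Finset.Iic (M, 0)) fun i _ ↦
      (schwartz_withSeminorms ℂ V ℂ).continuous_seminorm i
    exact h1.comp (fourierCLM ℂ 𝓢(V, ℂ)).continuous
  obtain ⟨s, C, -, hC⟩ := Seminorm.bound_of_continuous (schwartz_withSeminorms ℂ V ℂ) q hq
  choose B hB0 hB using fun i : ℕ × ℕ ↦ exists_seminorm_localize_le φ G M i.1 i.2
  refine ⟨2 ^ M * (C * ∑ i ∈ s, B i), by positivity [Finset.sum_nonneg fun i (_ : i ∈ s) ↦ hB0 i],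
    fun ⟨x, ξ⟩ ↦ ?_⟩
  have hS : 0 ≤ ∑ i ∈ s, B i := Finset.sum_nonneg fun i _ ↦ hB0 i
  have h1 : (s.sup (schwartzSeminormFamily ℂ V ℂ)) (localize φ G x) ≤
      (∑ i ∈ s, B i) / (1 + ‖x‖) ^ M := by
    refine Seminorm.finset_sup_apply_le (by positivity) fun i hi ↦ (hB i x).trans ?_
    gcongr
    exact Finset.single_le_sum (fun i _ ↦ hB0 i) hi
  have h2 : q (localize φ G x) ≤ C * ((∑ i ∈ s, B i) / (1 + ‖x‖) ^ M) := by
    refine (hC _).trans ?_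
    rw [_root_.smul_apply, NNReal.smul_def, smul_eq_mul]
    gcongr
  have h3 : (1 + ‖ξ‖) ^ M * ‖𝓕 (localize φ G x) ξ‖ ≤ 2 ^ M * q (localize φ G x) := by
    have := one_add_le_sup_seminorm_apply (𝕜 := ℂ) (m := (M, 0)) le_rfl le_rfl
      (𝓕 (localize φ G x)) ξ
    rw [norm_iteratedFDeriv_zero] at this
    exact this
  have h4 : 1 + ‖((x, ξ) : V × V)‖ ≤ (1 + ‖x‖) * (1 + ‖ξ‖) := by
    have : ‖((x, ξ) : V × V)‖ ≤ ‖x‖ + ‖ξ‖ := by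
      rw [Prod.norm_mk]
      exact max_le_add_of_nonneg (norm_nonneg _) (norm_nonneg _)
    nlinarith [mul_nonneg (norm_nonneg x) (norm_nonneg ξ)]
  calc _ ≤ ((1 + ‖x‖) * (1 + ‖ξ‖)) ^ M * ‖𝓕 (localize φ G x) ξ‖ := by gcongr
    _ = (1 + ‖x‖) ^ M * ((1 + ‖ξ‖) ^ M * ‖𝓕 (localize φ G x) ξ‖) := by rw [mul_pow]; ring
    _ ≤ (1 + ‖x‖) ^ M * (2 ^ M * (C * ((∑ i ∈ s, B i) / (1 + ‖x‖) ^ M))) := by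
        exact mul_le_mul_of_nonneg_left
          (h3.trans (mul_le_mul_of_nonneg_left h2 (by positivity))) (by positivity)
    _ = _ := by field_simp

theorem fourier_localize_eq (x ξ : V) : 𝓕 (localize φ G x) ξ =
    ∫ t, Complex.exp (-(((2 * π * ⟪ξ, t⟫ : ℝ) : ℂ) * Complex.I)) * φ t * G (t - x) := by
  rw [fourier_coe, Real.fourier_eq']
  refine integral_congr_ae (.of_forall fun t ↦ ?_)
  simp only [localize_apply, smul_eq_mul, mul_assoc, real_inner_comm t ξ]
  congr 2
  push_cast
  ring

theorem continuous_fourier_localize :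
    Continuous fun z : V × V ↦ 𝓕 (localize φ G z.1) z.2 := by
  let win : V × V → 𝓢(V, ℂ) := fun z ↦ smulLeftCLM ℂ
    (fun t ↦ Complex.exp (((-(2 * π) * ⟪z.2, t⟫ : ℝ) : ℂ) * Complex.I)) (compSubConstCLM ℂ z.1 G)
  have hwin (z : V × V) (t : V) : win z t =
      Complex.exp (((-(2 * π) * ⟪z.2, t⟫ : ℝ) : ℂ) * Complex.I) * G (t - z.1) := by
    have h : Function.HasTemperateGrowth fun t : V ↦ -(2 * π) * ⟪z.2, t⟫ :=
      (-(2 * π) • innerSL ℝ z.2).hasTemperateGrowth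
    refine (smulLeftCLM_apply_apply
      (Complex.hasTemperateGrowth_exp_ofReal_mul_I.comp h) _ t).trans ?_
    simp
  have hwin' : Continuous win :=
    (isSchwartzFamily_modulation_translation (-(2 * π)) G).continuous hwin
  have : Continuous fun z ↦ integralCLM ℂ volume (smulLeftCLM ℂ φ (win z)) :=
    ((integralCLM ℂ volume).comp (smulLeftCLM ℂ φ)).continuous.comp hwin'
  convert this using 2 with z
  rw [fourier_localize_eq, integralCLM_apply]
  refine integral_congr_ae (.of_forall fun t ↦ ?_)
  simp only [smulLeftCLM_apply_apply φ.hasTemperateGrowth, hwin, smul_eq_mul]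
  push_cast
  ring_nf

/-- Every continuous functional on Schwartz space can be evaluated through the inversion formula
of the short-time Fourier transform. -/
theorem integral_sq_mul_clm_apply
    {tf : V × V → 𝓢(V, ℂ)}
    (htf : ∀ z t, tf z t =
      Complex.exp (((2 * π * ⟪z.2, t⟫ : ℝ) : ℂ) * Complex.I) * G (t - z.1))
    (L : 𝓢(V, ℂ) →L[ℂ] ℂ) :
    (∫ t, G t ^ 2) * L φ = ∫ z, 𝓕 (localize φ G z.1) z.2 * L (tf z) := by
  have hfam := isSchwartzFamily_modulation_translation (2 * π) G
  have htf' : Continuous tf := hfam.continuous fun z t ↦ by simpa using htf z t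
  have hVc := continuous_fourier_localize φ G
  have hcont : Continuous fun z ↦ 𝓕 (localize φ G z.1) z.2 • tf z := hVc.smul htf'
  have hint (k l : ℕ) : Integrable fun z ↦
      SchwartzMap.seminorm ℂ k l (𝓕 (localize φ G z.1) z.2 • tf z) := by
    obtain ⟨N, C, hC, hN⟩ := hfam.exists_seminorm_le (f := tf)
      (fun z t ↦ by simpa using htf z t) k l
    obtain ⟨C', hC', hM⟩ := exists_fourier_localize_le φ G
      (N + (Module.finrank ℝ (V × V) + 1))
    refine Integrable.mono' (g := fun z ↦
      (C * C') * (1 + ‖z‖) ^ (-((Module.finrank ℝ (V × V) + 1 : ℕ) : ℝ)))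
      ((integrable_one_add_norm (by push_cast; linarith)).const_mul _)
      (((schwartz_withSeminorms ℂ V ℂ).continuous_seminorm (k, l)).comp
        hcont).aestronglyMeasurable (.of_forall fun z ↦ ?_)
    rw [Real.norm_of_nonneg (apply_nonneg _ _), map_smul_eq_mul, Real.rpow_neg (by positivity),
      Real.rpow_natCast, ← div_eq_mul_inv, le_div_iff₀ (by positivity)]
    calc _ ≤ ‖𝓕 (localize φ G z.1) z.2‖ * (C * (1 + ‖z‖) ^ N) *
          (1 + ‖z‖) ^ (Module.finrank ℝ (V × V) + 1) := by
          gcongr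
          exact hN z
      _ = C * ((1 + ‖z‖) ^ (N + (Module.finrank ℝ (V × V) + 1)) *
          ‖𝓕 (localize φ G z.1) z.2‖) := by rw [pow_add]; ring
      _ ≤ C * C' := by
          gcongr
          exact hM z
  have hφ (t : V) : ((∫ t, G t ^ 2) • φ) t =
      ∫ z, (𝓕 (localize φ G z.1) z.2 • tf z) t := by
    have hi : Integrable fun z ↦ (𝓕 (localize φ G z.1) z.2 • tf z) t :=
      (hint 0 0).mono' (((continuous_eval_const t).comp
        ((toBoundedContinuousFunctionCLM ℂ V ℂ).continuous.comp hcont)).aestronglyMeasurable)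
        (.of_forall fun z ↦ norm_le_seminorm ℂ _ t)
    rw [Measure.volume_eq_prod] at hi ⊢
    rw [integral_prod _ hi]
    have hinner (x : V) : ∫ ξ, (𝓕 (localize φ G x) ξ • tf (x, ξ)) t =
        φ t * G (t - x) ^ 2 := by
      have h1 : 𝓕⁻ (𝓕 (localize φ G x)) t = localize φ G x t := by
        rw [fourierInv_fourier_eq]
      rw [fourierInv_coe, Real.fourierInv_eq'] at h1
      calc _ = ∫ ξ, Complex.exp (↑(2 * π * ⟪ξ, t⟫) * Complex.I) • 𝓕 (localize φ G x) ξ *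
            G (t - x) := by
            refine integral_congr_ae (.of_forall fun ξ ↦ ?_)
            change 𝓕 (localize φ G x) ξ * tf (x, ξ) t = _
            simp only [htf, smul_eq_mul]
            ring
        _ = φ t * G (t - x) ^ 2 := by
            rw [integral_mul_const, h1, localize_apply]
            ring
    simp only [hinner]
    rw [integral_const_mul, integral_sub_left_eq_self (fun x ↦ G x ^ 2) volume t]
    change (∫ t, G t ^ 2) * φ t = _
    ring
  have := clm_apply_eq_integral hcont hint hφ L
  simpa only [map_smul, smul_eq_mul] using this

end GaborInversion

end SchwartzMap

end

section Symplectic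

/-- A linear map preserving a nondegenerate bilinear form has determinant `±1`. -/
theorem LinearMap.BilinForm.Nondegenerate.abs_det_eq_one {W : Type*} [AddCommGroup W] [Module ℝ W]
    [FiniteDimensional ℝ W] {B : LinearMap.BilinForm ℝ W} (hB : B.Nondegenerate) {A : W →ₗ[ℝ] W}
    (hA : ∀ u v, B (A u) (A v) = B u v) : |LinearMap.det A| = 1 := by
  let b := Module.finBasis ℝ W
  have h1 : B.comp A A = B := LinearMap.ext₂ hA
  have h2 := (LinearMap.BilinForm.nondegenerate_iff_det_ne_zero b).1 hB
  have h3 := congrArg Matrix.det (B.toMatrix_comp b b A A)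
  rw [h1, Matrix.det_mul, Matrix.det_mul, Matrix.det_transpose, LinearMap.det_toMatrix] at h3
  have h4 : LinearMap.det A * LinearMap.det A = 1 := by
    refine mul_right_cancel₀ h2 ?_
    linear_combination -h3
  rw [← abs_one, ← sq_eq_sq_iff_abs_eq_abs, sq, h4, one_pow]

variable {V : Type*} [NormedAddCommGroup V] [InnerProductSpace ℝ V]

variable (V) in
/-- The standard symplectic form on phase space `V × V`. -/
def symplecticForm : LinearMap.BilinForm ℝ (V × V) :=
  (innerₗ V).compl₁₂ (LinearMap.snd ℝ V V) (LinearMap.fst ℝ V V) -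
    (innerₗ V).compl₁₂ (LinearMap.fst ℝ V V) (LinearMap.snd ℝ V V)

theorem symplecticForm_apply (u v : V × V) :
    symplecticForm V u v = ⟪u.2, v.1⟫ - ⟪u.1, v.2⟫ := rfl

theorem nondegenerate_symplecticForm : (symplecticForm V).Nondegenerate := by
  constructor
  · intro u hu
    have h1 := hu (u.2, -u.1)
    rw [symplecticForm_apply, inner_neg_right, sub_neg_eq_add] at h1
    have h2 := (add_eq_zero_iff_of_nonneg real_inner_self_nonneg real_inner_self_nonneg).1 h1
    exact Prod.ext (inner_self_eq_zero.1 h2.2) (inner_self_eq_zero.1 h2.1)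
  · intro u hu
    have h1 := hu (-u.2, u.1)
    rw [symplecticForm_apply, inner_neg_left, sub_neg_eq_add] at h1
    have h2 := (add_eq_zero_iff_of_nonneg real_inner_self_nonneg real_inner_self_nonneg).1 h1
    exact Prod.ext (inner_self_eq_zero.1 h2.1) (inner_self_eq_zero.1 h2.2)

end Symplectic

section Schur

/-- Schur's test for a nonnegative kernel. -/
theorem eLpNorm_le_of_schur {α β : Type*} [MeasurableSpace α] [MeasurableSpace β] {μ : Measure α}
    {ν : Measure β} [SFinite μ] [SFinite ν] {K : β → α → ℝ≥0∞}
    (hK : Measurable (Function.uncurry K)) {B : ℝ≥0∞} (h₁ : ∀ w, ∫⁻ z, K w z ∂μ ≤ B)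
    (h₂ : ∀ z, ∫⁻ w, K w z ∂ν ≤ B) {f : α → ℂ} (hf : Measurable f) {F : β → ℂ}
    (hF : ∀ w, ‖F w‖ₑ ≤ ∫⁻ z, K w z * ‖f z‖ₑ ∂μ) {p : ℝ≥0∞} (hp : 1 ≤ p) :
    eLpNorm F p ν ≤ B * eLpNorm f p μ := by
  have hKw (w) : Measurable (K w) := hK.of_uncurry_left
  rcases eq_or_ne p ∞ with rfl | hp'
  · rw [eLpNorm_exponent_top, eLpNorm_exponent_top]
    refine eLpNormEssSup_le_of_ae_enorm_bound (.of_forall fun w ↦ (hF w).trans ?_)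
    calc _ ≤ ∫⁻ z, K w z * eLpNormEssSup f μ ∂μ := by
          refine lintegral_mono_ae ?_
          filter_upwards [enorm_ae_le_eLpNormEssSup f μ] with z hz
          gcongr
      _ = (∫⁻ z, K w z ∂μ) * eLpNormEssSup f μ := lintegral_mul_const _ (hKw w)
      _ ≤ _ := by gcongr; exact h₁ w
  have hp0 : p ≠ 0 := (zero_lt_one.trans_le hp).ne'
  set q := p.toReal with hq
  have hq1 : 1 ≤ q := by simpa using ENNReal.toReal_mono hp' hp
  have hq0 : 0 < q := by linarith
  have hpow (w) : ‖F w‖ₑ ^ q ≤ B ^ (q - 1) * ∫⁻ z, K w z * ‖f z‖ₑ ^ q ∂μ := by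
    have h3 := eLpNorm_le_eLpNorm_mul_rpow_measure_univ (μ := μ.withDensity (K w)) hp
      hf.aestronglyMeasurable
    rw [eLpNorm_one_eq_lintegral_enorm, eLpNorm_eq_lintegral_rpow_enorm_toReal hp0 hp',
      lintegral_withDensity_eq_lintegral_mul _ (hKw w) hf.enorm,
      lintegral_withDensity_eq_lintegral_mul _ (hKw w) (hf.enorm.pow_const _),
      withDensity_apply _ MeasurableSet.univ, Measure.restrict_univ, ← hq, ENNReal.toReal_one,
      div_one] at h3
    calc _ ≤ ((∫⁻ z, K w z * ‖f z‖ₑ ^ q ∂μ) ^ (1 / q) * B ^ (1 - 1 / q)) ^ q := by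
          refine ENNReal.rpow_le_rpow (((hF w).trans h3).trans ?_) hq0.le
          have : 0 ≤ 1 - 1 / q := by
            rw [sub_nonneg, div_le_one hq0]; exact hq1
          gcongr
          · exact le_rfl
          · exact h₁ w
      _ = _ := by
          rw [ENNReal.mul_rpow_of_nonneg _ _ hq0.le, ← ENNReal.rpow_mul, ← ENNReal.rpow_mul,
            mul_comm]
          congr 2
          · field_simp
          · rw [one_div_mul_cancel hq0.ne', ENNReal.rpow_one]
  have hmeas : Measurable (Function.uncurry fun w z ↦ K w z * ‖f z‖ₑ ^ q) :=
    hK.mul ((hf.enorm.comp measurable_snd).pow_const _)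
  rw [eLpNorm_eq_lintegral_rpow_enorm_toReal hp0 hp',
    eLpNorm_eq_lintegral_rpow_enorm_toReal hp0 hp']
  calc _ ≤ (B ^ q * ∫⁻ z, ‖f z‖ₑ ^ q ∂μ) ^ (1 / q) := by
        refine ENNReal.rpow_le_rpow ?_ (by positivity)
        calc _ ≤ ∫⁻ w, B ^ (q - 1) * ∫⁻ z, K w z * ‖f z‖ₑ ^ q ∂μ ∂ν := lintegral_mono hpow
          _ = B ^ (q - 1) * ∫⁻ z, ∫⁻ w, K w z * ‖f z‖ₑ ^ q ∂ν ∂μ := by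
              rw [lintegral_const_mul _ (Measurable.lintegral_prod_right hmeas),
                lintegral_lintegral_swap hmeas.aemeasurable]
          _ ≤ B ^ (q - 1) * ∫⁻ z, B * ‖f z‖ₑ ^ q ∂μ := by
              gcongr with z
              rw [lintegral_mul_const _ hK.of_uncurry_right]
              gcongr
              exact h₂ z
          _ = _ := by
              rw [lintegral_const_mul _ (hf.enorm.pow_const _), ← mul_assoc]
              congr 1
              nth_rw 2 [← ENNReal.rpow_one B]
              rw [← ENNReal.rpow_add_of_nonneg _ _ (by linarith) zero_le_one]
              simp
    _ = _ := by
        rw [ENNReal.mul_rpow_of_nonneg _ _ (by positivity), ← ENNReal.rpow_mul,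
          mul_one_div_cancel hq0.ne', ENNReal.rpow_one]

end Schur

section PhaseSpace

variable {d : ℕ}

local notation "E" => EuclideanSpace ℝ (Fin d)

theorem IsTameCanonical.lintegral_comp {χ : E × E → E × E} (hχ : IsTameCanonical χ)
    (k : E × E → ℝ≥0∞) : ∫⁻ z, k (χ z) = ∫⁻ y, k y := by
  obtain ⟨hs, hb, -, hω, -⟩ := hχ
  have hdet (z : E × E) : |(fderiv ℝ χ z).det| = 1 :=
    nondegenerate_symplecticForm.abs_det_eq_one fun u v ↦ hω z u v
  have h := lintegral_image_eq_lintegral_abs_det_fderiv_mul volume MeasurableSet.univ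
    (fun z _ ↦ ((hs.differentiable (by simp)) z).hasFDerivAt.hasFDerivWithinAt)
    hb.injective.injOn k
  simpa [hdet, hb.surjective.range_eq] using h.symm

theorem lintegral_one_add_sqNorm2_rpow_lt_top {s : ℝ} (hs : Module.finrank ℝ (E × E) < s) (C : ℝ) :
    ∫⁻ y : E × E, ENNReal.ofReal (C * (1 + sqNorm2 y) ^ (-s / 2)) < ∞ := by
  have hi := ((integrable_rpow_neg_one_add_norm_sq (μ := (volume : Measure (E × E))) hs).const_mul
    |C|)
  refine lt_of_le_of_lt (lintegral_mono fun y ↦ ENNReal.ofReal_le_ofReal ?_)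
    hi.lintegral_lt_top
  have h0 : (0 : ℝ) ≤ Module.finrank ℝ (E × E) := Nat.cast_nonneg _
  have h1 : ‖y‖ ^ 2 ≤ sqNorm2 y := by
    rw [Prod.norm_def, sqNorm2]
    rcases max_choice ‖y.1‖ ‖y.2‖ with h | h <;> rw [h] <;>
      nlinarith [sq_nonneg ‖y.1‖, sq_nonneg ‖y.2‖]
  have h2 : (1 + sqNorm2 y) ^ (-s / 2) ≤ (1 + ‖y‖ ^ 2) ^ (-s / 2) :=
    Real.rpow_le_rpow_of_nonpos (by positivity) (by linarith) (by linarith)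
  calc _ ≤ |C| * (1 + sqNorm2 y) ^ (-s / 2) := by
        gcongr
        · exact Real.rpow_nonneg (by linarith [sq_nonneg ‖y‖]) _
        · exact le_abs_self C
    _ ≤ _ := by gcongr

theorem integral_gaussWindow_sq_ne_zero : ∫ t : E, gaussWindow t ^ 2 ≠ 0 := by
  have h : ∀ t : E, gaussWindow t ^ 2 = ((Real.exp (-(2 * π) * ‖t‖ ^ 2) : ℝ) : ℂ) := fun t ↦ by
    rw [gaussWindow, ← Complex.ofReal_pow, ← Real.exp_nat_mul]
    congr 2
    push_cast
    ring
  simp only [h]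
  rw [integral_complex_ofReal, GaussianFourier.integral_rexp_neg_mul_sq_norm (by positivity)]
  exact_mod_cast (by positivity : (0 : ℝ) < _).ne'

end PhaseSpace

/-- **Boundedness of `FIO(χ)` operators on modulation spaces**: if a continuous linear
operator `T : 𝓢(ℝ^d) → 𝓢'(ℝ^d)` has a Gabor matrix `|⟨Tπ(z)g, π(w)g⟩| = |V_g(Tπ(z)g)(w)|`
decaying super-polynomially off the graph of a tame canonical transformation `χ`, then
`T` is bounded on `M^p(ℝ^d)` for every `1 ≤ p ≤ ∞` (in particular on `L² = M²`). Here
`tf z` packages the time-frequency shift `π(z)g` and `win w` the analysis window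
`t ↦ e^{-2πi w₂·t} g(t-w₁)`, so that `V_g u (w) = u(win w)` for distributions `u`. -/
theorem fio_bounded_on_modulation_spaces
    {d : ℕ} (hd : 1 ≤ d)
    (χ : EuclideanSpace ℝ (Fin d) × EuclideanSpace ℝ (Fin d) →
      EuclideanSpace ℝ (Fin d) × EuclideanSpace ℝ (Fin d))
    (hχ : IsTameCanonical χ)
    (T : SchwartzMap (EuclideanSpace ℝ (Fin d)) ℂ →L[ℂ]
      (SchwartzMap (EuclideanSpace ℝ (Fin d)) ℂ →L[ℂ] ℂ))
    (tf : EuclideanSpace ℝ (Fin d) × EuclideanSpace ℝ (Fin d) →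
      SchwartzMap (EuclideanSpace ℝ (Fin d)) ℂ)
    (htf : ∀ z t, tf z t =
      Complex.exp ((((2 * π * ⟪z.2, t⟫ : ℝ) : ℂ) * Complex.I)) * gaussWindow (t - z.1))
    (win : EuclideanSpace ℝ (Fin d) × EuclideanSpace ℝ (Fin d) →
      SchwartzMap (EuclideanSpace ℝ (Fin d)) ℂ)
    (hwin : ∀ w t, win w t =
      Complex.exp (-(((2 * π * ⟪w.2, t⟫ : ℝ) : ℂ) * Complex.I)) * gaussWindow (t - w.1))
    (hT : ∀ s : ℝ, 0 ≤ s → ∃ C : ℝ, 0 < C ∧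
      ∀ z w : EuclideanSpace ℝ (Fin d) × EuclideanSpace ℝ (Fin d),
        ‖(T (tf z)) (win w)‖ ≤ C * (1 + sqNorm2 (w - χ z)) ^ (-s / 2)) :
    ∀ p : ℝ≥0∞, 1 ≤ p → ∃ C : ℝ, 0 < C ∧
      ∀ φ : SchwartzMap (EuclideanSpace ℝ (Fin d)) ℂ,
        eLpNorm (fun w : EuclideanSpace ℝ (Fin d) × EuclideanSpace ℝ (Fin d) =>
            (T φ) (win w)) p volume ≤
          ENNReal.ofReal C *
            eLpNorm (fun w : EuclideanSpace ℝ (Fin d) × EuclideanSpace ℝ (Fin d) =>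
              STFT (fun x => φ x) w.1 w.2) p volume := by
  intro p hp
  have hG : ∀ t, tf 0 t = gaussWindow t := fun t ↦ by simp [htf]
  set G := tf 0
  set c : ℂ := ∫ t, gaussWindow (d := d) t ^ 2 with hc
  have hc0 : c ≠ 0 := integral_gaussWindow_sq_ne_zero
  let s : ℝ := Module.finrank ℝ (EuclideanSpace ℝ (Fin d) × EuclideanSpace ℝ (Fin d)) + 1
  have hs0 : 0 ≤ s := by positivity
  obtain ⟨C, hC, hTC⟩ := hT s hs0
  let k : EuclideanSpace ℝ (Fin d) × EuclideanSpace ℝ (Fin d) → ℝ≥0∞ := fun y ↦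
    ENNReal.ofReal (C / ‖c‖ * (1 + sqNorm2 y) ^ (-s / 2))
  have hk : Measurable k := by
    have : Measurable fun y : EuclideanSpace ℝ (Fin d) × EuclideanSpace ℝ (Fin d) ↦ sqNorm2 y := by
      unfold sqNorm2
      fun_prop
    exact (((this.const_add 1).pow_const _).const_mul _).ennreal_ofReal
  have hkfin : ∫⁻ y, k y < ∞ := lintegral_one_add_sqNorm2_rpow_lt_top (lt_add_one _) _
  have hStft (φ : SchwartzMap (EuclideanSpace ℝ (Fin d)) ℂ) (x ξ : EuclideanSpace ℝ (Fin d)) :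
      FourierTransform.fourier (SchwartzMap.localize φ G x) ξ = STFT (fun x ↦ φ x) x ξ := by
    simp only [SchwartzMap.fourier_localize_eq, STFT, hG]
  refine ⟨(∫⁻ y, k y).toReal + 1, by positivity, fun φ ↦ ?_⟩
  have hV : Continuous fun w : EuclideanSpace ℝ (Fin d) × EuclideanSpace ℝ (Fin d) ↦
      STFT (fun x ↦ φ x) w.1 w.2 := by
    simp only [← hStft]
    exact SchwartzMap.continuous_fourier_localize φ G
  refine (eLpNorm_le_of_schur (μ := volume) (ν := volume) (K := fun w z ↦ k (w - χ z))
    (B := ∫⁻ y, k y) ?_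
    (fun w ↦ ?_) (fun z ↦ ?_) hV.measurable (fun w ↦ ?_) hp).trans ?_
  · exact hk.comp (measurable_fst.sub (hχ.1.continuous.measurable.comp measurable_snd))
  · have := Measure.IsAddHaarMeasure.isNegInvariant_of_regular
      (volume : Measure (EuclideanSpace ℝ (Fin d) × EuclideanSpace ℝ (Fin d)))
    rw [hχ.lintegral_comp fun y ↦ k (w - y), lintegral_sub_left_eq_self k w]
  · rw [lintegral_sub_right_eq_self k (χ z)]
  · let L : SchwartzMap (EuclideanSpace ℝ (Fin d)) ℂ →L[ℂ] ℂ :=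
      { toFun := fun φ ↦ T φ (win w)
        map_add' := fun a b ↦ by simp
        map_smul' := fun a b ↦ by simp
        cont := (continuous_eval_const (win w)).comp T.continuous }
    have h1 : c * T φ (win w) = ∫ z, STFT (fun x ↦ φ x) z.1 z.2 * T (tf z) (win w) := by
      have := SchwartzMap.integral_sq_mul_clm_apply φ G (tf := tf)
        (fun z t ↦ by rw [htf, hG]) L
      simpa only [hG, hStft] using! this
    have h2 : T φ (win w) = ∫ z, c⁻¹ * (STFT (fun x ↦ φ x) z.1 z.2 * T (tf z) (win w)) := by
      rw [integral_const_mul, ← h1, inv_mul_cancel_left₀ hc0]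
    rw [h2]
    refine (enorm_integral_le_lintegral_enorm _).trans (lintegral_mono fun z ↦ ?_)
    rw [enorm_mul, enorm_mul, mul_comm ‖STFT _ _ _‖ₑ, ← mul_assoc, ← enorm_mul]
    gcongr
    rw [← ofReal_norm, norm_mul, norm_inv]
    refine ENNReal.ofReal_le_ofReal ?_
    rw [div_mul_eq_mul_div, div_eq_inv_mul]
    gcongr
    exact hTC z w
  · gcongr
    rw [ENNReal.le_ofReal_iff_toReal_le hkfin.ne (by positivity)]
    linarith
end
end

section
/- Let 1 < p < ∞. For t ∈ ℝ and φ ∈ 𝓢(ℝ^d) let U₀(t)φ = 𝓕^{−1}[ ξ ↦ e^{−2π² i t|ξ|²} (𝓕φ)(ξ) ] be the free Schrödinger propagator e^{itΔ/2}. Then there exist constants c, C > 0 such that for every t ∈ ℝ: (i) ‖U₀(t)φ‖_{M^p} ≤ C (1+|t|)^{d|1/2 − 1/p|} ‖φ‖_{M^p} for all φ ∈ 𝓢(ℝ^d), and (ii) there exists a nonzero φ ∈ 𝓢(ℝ^d) with ‖U₀(t)φ‖_{M^p} ≥ c (1+|t|)^{d|1/2 − 1/p|} ‖φ‖_{M^p}.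 That is, the operator norm of U₀(t) on M^p(ℝ^d) is comparable to (1+|t|)^{d|1/2 − 1/p|}. -/
open MeasureTheory Real Filter
open scoped RealInnerProductSpace ENNReal

noncomputable section

/-- The modulation space norm `‖f‖_{M^p} = (∫∫ |V_g f(x,ξ)|^p dx dξ)^{1/p}`. -/
def MpNorm {d : ℕ} (p : ℝ) (f : EuclideanSpace ℝ (Fin d) → ℂ) : ℝ≥0∞ :=
  eLpNorm (fun z : EuclideanSpace ℝ (Fin d) × EuclideanSpace ℝ (Fin d) =>
    STFT f z.1 z.2) (ENNReal.ofReal p) volume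

/-- The free Schrödinger propagator `U₀(t) = e^{itΔ/2}` on Schwartz functions, as the
Fourier multiplier with symbol `e^{-2π² i t|ξ|²}`:
`U₀(t)φ = 𝓕⁻¹[ξ ↦ e^{-2π² i t|ξ|²} 𝓕φ(ξ)]`. -/
def freeProp {d : ℕ} (t : ℝ) (φ : SchwartzMap (EuclideanSpace ℝ (Fin d)) ℂ)
    (x : EuclideanSpace ℝ (Fin d)) : ℂ :=
  ∫ (ξ : EuclideanSpace ℝ (Fin d)),
    Complex.exp ((((2 * π * ⟪x, ξ⟫ : ℝ) : ℂ) * Complex.I)) *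
      (Complex.exp (-(((2 * π ^ 2 * t * ‖ξ‖ ^ 2 : ℝ) : ℂ) * Complex.I)) *
        ∫ (y : EuclideanSpace ℝ (Fin d)),
          Complex.exp (-(((2 * π * ⟪ξ, y⟫ : ℝ) : ℂ) * Complex.I)) * φ y)

/-- Tonelli for the layer-cake integral of a weighted integral over level sets. -/
lemma lintegral_lintegral_sublevel_swap {α : Type*} [MeasurableSpace α] {μ : Measure α} [SFinite μ]
    {S : Set (ℝ × α)} (hS : MeasurableSet S) {F : α → ℝ≥0∞} (hF : Measurable F)
    {w : ℝ → ℝ≥0∞} (hw : Measurable w) :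
    ∫⁻ s in Set.Ioi (0 : ℝ), (∫⁻ x in {x | (s, x) ∈ S}, F x ∂μ) * w s =
      ∫⁻ x, F x * (∫⁻ s in {s | 0 < s ∧ (s, x) ∈ S}, w s) ∂μ := by
  have h1 : ∀ s, (∫⁻ x in {x | (s, x) ∈ S}, F x ∂μ) * w s =
      ∫⁻ x, S.indicator (fun z => F z.2 * w z.1) (s, x) ∂μ := by
    intro s
    have hm : MeasurableSet {x | (s, x) ∈ S} := measurable_prodMk_left hS
    rw [← lintegral_mul_const _ hF, ← lintegral_indicator hm]
    rfl
  have h2 : ∀ x, F x * ∫⁻ s in {s | 0 < s ∧ (s, x) ∈ S}, w s =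
      ∫⁻ s in Set.Ioi (0 : ℝ), S.indicator (fun z => F z.2 * w z.1) (s, x) := by
    intro x
    have hm : MeasurableSet {s | (s, x) ∈ S} := measurable_prodMk_right hS
    rw [← lintegral_const_mul _ hw]
    have : {s | 0 < s ∧ (s, x) ∈ S} = {s | (s, x) ∈ S} ∩ Set.Ioi 0 := by
      ext s; simp [and_comm]
    rw [this, ← Measure.restrict_restrict hm, ← lintegral_indicator hm]
    rfl
  simp_rw [h1, h2]
  rw [lintegral_lintegral_swap]
  exact (Measurable.indicator (by fun_prop) hS).aemeasurable

lemma lintegral_rpow_Ioo {r a : ℝ} (hr : -1 < r) (ha : 0 ≤ a) :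
    ∫⁻ s in Set.Ioo 0 a, ENNReal.ofReal (s ^ r) = ENNReal.ofReal (a ^ (r + 1) / (r + 1)) := by
  rw [setLIntegral_congr Ioo_ae_eq_Ioc, ← ofReal_integral_eq_lintegral_ofReal]
  · rw [← intervalIntegral.integral_of_le ha, integral_rpow (Or.inl hr),
      Real.zero_rpow (by linarith), sub_zero]
  · exact (intervalIntegrable_iff_integrableOn_Ioc_of_le ha).1
      (intervalIntegral.intervalIntegrable_rpow' hr)
  · filter_upwards [ae_restrict_mem measurableSet_Ioc] with s hs
    exact Real.rpow_nonneg hs.1.le _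

lemma lintegral_rpow_Ici {r a : ℝ} (hr : r < -1) (ha : 0 < a) :
    ∫⁻ s in Set.Ici a, ENNReal.ofReal (s ^ r) = ENNReal.ofReal (a ^ (r + 1) / (-(r + 1))) := by
  rw [setLIntegral_congr Ioi_ae_eq_Ici.symm, ← ofReal_integral_eq_lintegral_ofReal]
  · rw [integral_Ioi_rpow_of_lt hr ha, div_neg, neg_div]
  · exact integrableOn_Ioi_rpow_of_lt hr ha
  · filter_upwards [ae_restrict_mem measurableSet_Ioi] with s hs
    exact Real.rpow_nonneg (ha.trans hs).le _

lemma lintegral_rpow_le_of_weak_two_top {α : Type*} [MeasurableSpace α] {μ : Measure α} [SFinite μ]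
    {p K : ℝ} (hp : 2 < p) (hK : 0 < K) {f g : α → ℝ} (hf : Measurable f) (hg : Measurable g)
    (f0 : ∀ x, 0 ≤ f x) (g0 : ∀ x, 0 ≤ g x)
    (h : ∀ s, 0 < s → μ {x | s < g x} ≤
      ENNReal.ofReal (4 / s ^ 2) * ∫⁻ x in {x | s < K * f x}, ENNReal.ofReal (f x ^ 2) ∂μ) :
    ∫⁻ x, ENNReal.ofReal (g x ^ p) ∂μ ≤
      ENNReal.ofReal (4 * p / (p - 2) * K ^ (p - 2)) * ∫⁻ x, ENNReal.ofReal (f x ^ p) ∂μ := by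
  rw [lintegral_rpow_eq_lintegral_meas_lt_mul _ (ae_of_all _ g0) hg.aemeasurable (by linarith)]
  have hS : MeasurableSet {z : ℝ × α | z.1 < K * f z.2} :=
    measurableSet_lt measurable_fst (by fun_prop)
  calc _ ≤ ENNReal.ofReal p * ∫⁻ s in Set.Ioi (0 : ℝ),
        (∫⁻ x in {x | (s, x) ∈ {z : ℝ × α | z.1 < K * f z.2}}, ENNReal.ofReal (f x ^ 2) ∂μ) *
          ENNReal.ofReal (4 * s ^ (p - 3)) := by
        refine mul_le_mul_right (setLIntegral_mono' measurableSet_Ioi fun s hs => ?_) _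
        have hs : 0 < s := hs
        calc _ ≤ _ := mul_le_mul_left (h s hs) _
          _ = _ := by
            rw [mul_comm (ENNReal.ofReal (4 / s ^ 2)), mul_assoc,
              ← ENNReal.ofReal_mul (by positivity)]
            congr 2
            rw [show p - 1 = (p - 3) + (2 : ℕ) by push_cast; ring, Real.rpow_add_natCast hs.ne']
            field_simp
    _ = ENNReal.ofReal p * ∫⁻ x, ENNReal.ofReal (f x ^ 2) *
          (∫⁻ s in {s | 0 < s ∧ (s, x) ∈ {z : ℝ × α | z.1 < K * f z.2}},
            ENNReal.ofReal (4 * s ^ (p - 3))) ∂μ := by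
        rw [lintegral_lintegral_sublevel_swap hS (by fun_prop) (by fun_prop)]
    _ = ENNReal.ofReal p * ∫⁻ x, ENNReal.ofReal (4 / (p - 2) * K ^ (p - 2)) *
          ENNReal.ofReal (f x ^ p) ∂μ := by
        congr 2 with x
        have : {s | 0 < s ∧ (s, x) ∈ {z : ℝ × α | z.1 < K * f z.2}} = Set.Ioo 0 (K * f x) := rfl
        rw [this]
        simp_rw [ENNReal.ofReal_mul (zero_le_four (α := ℝ))]
        rw [lintegral_const_mul _ (by fun_prop),
          lintegral_rpow_Ioo (by linarith) (mul_nonneg hK.le (f0 x)),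
          ← ENNReal.ofReal_mul (by positivity), ← ENNReal.ofReal_mul (by positivity),
          ← ENNReal.ofReal_mul (mul_nonneg (div_nonneg (by norm_num) (by linarith))
            (by positivity))]
        congr 1
        rw [Real.mul_rpow hK.le (f0 x), show p - 3 + 1 = p - 2 by ring]
        have : f x ^ 2 * f x ^ (p - 2) = f x ^ p := by
          rw [← Real.rpow_natCast, ← Real.rpow_add_of_nonneg (f0 x) (by norm_num) (by linarith)]
          congr 1; push_cast; ring
        rw [← this]; ring
    _ = _ := by
        rw [lintegral_const_mul _ (by fun_prop), ← mul_assoc,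
          ← ENNReal.ofReal_mul (by linarith)]
        congr 2; ring

lemma lintegral_rpow_le_of_weak_one_two {α : Type*} [MeasurableSpace α] {μ : Measure α} [SFinite μ]
    {p M : ℝ} (hp1 : 1 < p) (hp : p < 2) (hM : 0 < M) {f g : α → ℝ} (hf : Measurable f)
    (hg : Measurable g) (f0 : ∀ x, 0 ≤ f x) (g0 : ∀ x, 0 ≤ g x)
    (h : ∀ s, 0 < s → μ {x | s < g x} ≤
      ENNReal.ofReal (2 * M / s) * ∫⁻ x in {x | s < M⁻¹ * f x}, ENNReal.ofReal (f x) ∂μ +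
      ENNReal.ofReal (4 / s ^ 2) * ∫⁻ x in {x | M⁻¹ * f x ≤ s}, ENNReal.ofReal (f x ^ 2) ∂μ) :
    ∫⁻ x, ENNReal.ofReal (g x ^ p) ∂μ ≤
      ENNReal.ofReal ((2 * p / (p - 1) + 4 * p / (2 - p)) * M ^ (2 - p)) *
        ∫⁻ x, ENNReal.ofReal (f x ^ p) ∂μ := by
  rw [lintegral_rpow_eq_lintegral_meas_lt_mul _ (ae_of_all _ g0) hg.aemeasurable (by linarith)]
  have hS : MeasurableSet {z : ℝ × α | z.1 < M⁻¹ * f z.2} :=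
    measurableSet_lt measurable_fst (by fun_prop)
  have hS' : MeasurableSet {z : ℝ × α | M⁻¹ * f z.2 ≤ z.1} :=
    measurableSet_le (by fun_prop) measurable_fst
  have hMi : 0 < M⁻¹ := inv_pos.2 hM
  have e1 : ∀ x, ENNReal.ofReal (f x) *
      ∫⁻ s in {s | 0 < s ∧ (s, x) ∈ {z : ℝ × α | z.1 < M⁻¹ * f z.2}},
        ENNReal.ofReal (2 * M * s ^ (p - 2)) =
      ENNReal.ofReal (2 / (p - 1) * M ^ (2 - p)) * ENNReal.ofReal (f x ^ p) := by
    intro x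
    have : {s | 0 < s ∧ (s, x) ∈ {z : ℝ × α | z.1 < M⁻¹ * f z.2}} = Set.Ioo 0 (M⁻¹ * f x) := rfl
    rw [this]
    simp_rw [ENNReal.ofReal_mul (mul_pos two_pos hM).le]
    rw [lintegral_const_mul _ (by fun_prop),
      lintegral_rpow_Ioo (by linarith) (mul_nonneg hMi.le (f0 x)),
      ← ENNReal.ofReal_mul (by positivity), ← ENNReal.ofReal_mul (f0 x),
      ← ENNReal.ofReal_mul (mul_nonneg (div_nonneg (by norm_num) (by linarith)) (by positivity))]
    congr 1
    rw [Real.mul_rpow hMi.le (f0 x), show p - 2 + 1 = p - 1 by ring, Real.inv_rpow hM.le,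
      ← Real.rpow_neg hM.le]
    have h1 : f x * f x ^ (p - 1) = f x ^ p := by
      conv_lhs => enter [1]; rw [← Real.rpow_one (f x)]
      rw [← Real.rpow_add_of_nonneg (f0 x) (by norm_num) (by linarith)]
      congr 1; ring
    have h2 : M * M ^ (-(p - 1)) = M ^ (2 - p) := by
      conv_lhs => enter [1]; rw [← Real.rpow_one M]
      rw [← Real.rpow_add hM]
      congr 1; ring
    rw [← h1, ← h2]; ring
  have e2 : ∀ x, ENNReal.ofReal (f x ^ 2) *
      ∫⁻ s in {s | 0 < s ∧ (s, x) ∈ {z : ℝ × α | M⁻¹ * f z.2 ≤ z.1}},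
        ENNReal.ofReal (4 * s ^ (p - 3)) ≤
      ENNReal.ofReal (4 / (2 - p) * M ^ (2 - p)) * ENNReal.ofReal (f x ^ p) := by
    intro x
    rcases (f0 x).eq_or_lt with h0 | h0
    · simp [← h0]
    have : {s | 0 < s ∧ (s, x) ∈ {z : ℝ × α | M⁻¹ * f z.2 ≤ z.1}} = Set.Ici (M⁻¹ * f x) := by
      ext s
      simp only [Set.mem_ofPred_eq, Set.mem_Ici, and_iff_right_iff_imp]
      exact fun hs => (mul_pos hMi h0).trans_le hs
    rw [this]
    simp_rw [ENNReal.ofReal_mul (zero_le_four (α := ℝ))]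
    rw [lintegral_const_mul _ (by fun_prop),
      lintegral_rpow_Ici (by linarith) (mul_pos hMi h0),
      ← ENNReal.ofReal_mul (by positivity), ← ENNReal.ofReal_mul (by positivity),
      ← ENNReal.ofReal_mul (mul_nonneg (div_nonneg (by norm_num) (by linarith)) (by positivity))]
    refine (congrArg ENNReal.ofReal ?_).le
    rw [Real.mul_rpow hMi.le (f0 x), show p - 3 + 1 = p - 2 by ring, Real.inv_rpow hM.le,
      ← Real.rpow_neg hM.le, neg_sub]
    have h1 : f x ^ 2 * f x ^ (p - 2) = f x ^ p := by
      rw [← Real.rpow_natCast, ← Real.rpow_add h0]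
      congr 1; push_cast; ring
    rw [← h1]; ring
  calc _ ≤ ENNReal.ofReal p * ∫⁻ s in Set.Ioi (0 : ℝ),
        ((∫⁻ x in {x | (s, x) ∈ {z : ℝ × α | z.1 < M⁻¹ * f z.2}}, ENNReal.ofReal (f x) ∂μ) *
          ENNReal.ofReal (2 * M * s ^ (p - 2)) +
        (∫⁻ x in {x | (s, x) ∈ {z : ℝ × α | M⁻¹ * f z.2 ≤ z.1}}, ENNReal.ofReal (f x ^ 2) ∂μ) *
          ENNReal.ofReal (4 * s ^ (p - 3))) := by
        refine mul_le_mul_right (setLIntegral_mono' measurableSet_Ioi fun s hs => ?_) _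
        have hs : 0 < s := hs
        calc _ ≤ _ := mul_le_mul_left (h s hs) _
          _ = _ := by
            rw [add_mul]
            congr 1
            · rw [mul_comm (ENNReal.ofReal (2 * M / s)), mul_assoc,
                ← ENNReal.ofReal_mul (by positivity)]
              congr 2
              rw [show p - 1 = (p - 2) + (1 : ℕ) by push_cast; ring, Real.rpow_add_natCast hs.ne']
              field_simp
            · rw [mul_comm (ENNReal.ofReal (4 / s ^ 2)), mul_assoc,
                ← ENNReal.ofReal_mul (by positivity)]
              congr 2
              rw [show p - 1 = (p - 3) + (2 : ℕ) by push_cast; ring, Real.rpow_add_natCast hs.ne']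
              field_simp
    _ = ENNReal.ofReal p * ((∫⁻ x, ENNReal.ofReal (f x) *
          (∫⁻ s in {s | 0 < s ∧ (s, x) ∈ {z : ℝ × α | z.1 < M⁻¹ * f z.2}},
            ENNReal.ofReal (2 * M * s ^ (p - 2))) ∂μ) + ∫⁻ x, ENNReal.ofReal (f x ^ 2) *
          (∫⁻ s in {s | 0 < s ∧ (s, x) ∈ {z : ℝ × α | M⁻¹ * f z.2 ≤ z.1}},
            ENNReal.ofReal (4 * s ^ (p - 3))) ∂μ) := by
        rw [← lintegral_lintegral_sublevel_swap hS (by fun_prop) (by fun_prop),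
          ← lintegral_lintegral_sublevel_swap hS' (by fun_prop) (by fun_prop),
          lintegral_add_left]
        refine Measurable.mul ?_ (by fun_prop)
        have : ∀ s : ℝ, ∫⁻ x in {x | (s, x) ∈ {z : ℝ × α | z.1 < M⁻¹ * f z.2}},
            ENNReal.ofReal (f x) ∂μ = ∫⁻ x, {z : ℝ × α | z.1 < M⁻¹ * f z.2}.indicator
              (fun z => ENNReal.ofReal (f z.2)) (s, x) ∂μ := by
          intro s
          have hm : MeasurableSet {x | (s, x) ∈ {z : ℝ × α | z.1 < M⁻¹ * f z.2}} :=
            measurable_prodMk_left hS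
          rw [← lintegral_indicator hm]
          rfl
        simp_rw [this]
        exact Measurable.lintegral_prod_right' (Measurable.indicator (by fun_prop) hS)
    _ ≤ ENNReal.ofReal p * ((∫⁻ x, ENNReal.ofReal (2 / (p - 1) * M ^ (2 - p)) *
          ENNReal.ofReal (f x ^ p) ∂μ) + ∫⁻ x, ENNReal.ofReal (4 / (2 - p) * M ^ (2 - p)) *
          ENNReal.ofReal (f x ^ p) ∂μ) := by
        simp_rw [e1]
        exact mul_le_mul_right (add_le_add le_rfl (lintegral_mono e2)) _
    _ = _ := by
        rw [lintegral_const_mul _ (by fun_prop), lintegral_const_mul _ (by fun_prop), ← add_mul,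
          ← ENNReal.ofReal_add (mul_nonneg (div_nonneg (by norm_num) (by linarith)) (by positivity))
            (mul_nonneg (div_nonneg (by norm_num) (by linarith)) (by positivity)),
          ← mul_assoc, ← ENNReal.ofReal_mul (by linarith)]
        congr 2; ring

section Convolution

open FourierTransform SchwartzMap

/-- Jensen's inequality against a weight `k`, in the form given by Hölder's inequality. -/
lemma lintegral_mul_rpow_le {α : Type*} [MeasurableSpace α] {μ : Measure α} {k a : α → ℝ≥0∞}
    (hk : Measurable k) (ha : Measurable a) {p : ℝ} (hp : 1 ≤ p) :
    (∫⁻ x, k x * a x ∂μ) ^ p ≤ (∫⁻ x, k x ∂μ) ^ (p - 1) * ∫⁻ x, k x * a x ^ p ∂μ := by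
  rcases hp.eq_or_lt with rfl | hp
  · simp
  have hpq := Real.HolderConjugate.conjExponent hp
  set q := p.conjExponent
  have h := ENNReal.lintegral_mul_le_Lp_mul_Lq μ hpq.symm (f := fun x => k x ^ (1 / q))
    (g := fun x => k x ^ (1 / p) * a x) (by fun_prop) (by fun_prop)
  have hp0 : 0 < p := by linarith
  have hq0 : 0 < q := hpq.symm.pos
  have e1 : ∀ x, ((fun x => k x ^ (1 / q)) * fun x => k x ^ (1 / p) * a x) x = k x * a x := by
    intro x
    simp only [Pi.mul_apply]
    rw [← mul_assoc, ← ENNReal.rpow_add_of_nonneg _ _ (by positivity) (by positivity)]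
    have : 1 / q + 1 / p = 1 := by
      have := hpq.symm.inv_add_inv_eq_one
      simpa using this
    rw [this, ENNReal.rpow_one]
  have e2 : ∀ x, (k x ^ (1 / q)) ^ q = k x := by
    intro x
    rw [← ENNReal.rpow_mul, one_div_mul_cancel hq0.ne', ENNReal.rpow_one]
  have e3 : ∀ x, (k x ^ (1 / p) * a x) ^ p = k x * a x ^ p := by
    intro x
    rw [ENNReal.mul_rpow_of_nonneg _ _ hp0.le, ← ENNReal.rpow_mul, one_div_mul_cancel hp0.ne',
      ENNReal.rpow_one]
  simp_rw [e1, e2, e3] at h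
  refine (ENNReal.rpow_le_rpow h hp0.le).trans (le_of_eq ?_)
  rw [ENNReal.mul_rpow_of_nonneg _ _ hp0.le, ← ENNReal.rpow_mul, ← ENNReal.rpow_mul,
    one_div_mul_cancel hp0.ne', ENNReal.rpow_one]
  congr 2
  have : 1 / q * p = p - 1 := by
    have := hpq.symm.inv_add_inv_eq_one
    field_simp at this ⊢
    linarith
  exact this

variable {E : Type*} [NormedAddCommGroup E] [InnerProductSpace ℝ E] [FiniteDimensional ℝ E]
  [MeasurableSpace E] [BorelSpace E]

/-- Young's inequality `L¹ * Lᵖ → Lᵖ`. -/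
lemma lintegral_convolution_rpow_le {k a : E → ℝ≥0∞} (hk : Measurable k) (ha : Measurable a)
    {p : ℝ} (hp : 1 ≤ p) :
    ∫⁻ ξ, (∫⁻ η, k η * a (ξ - η)) ^ p ≤ (∫⁻ η, k η) ^ p * ∫⁻ ξ, a ξ ^ p := by
  calc _ ≤ ∫⁻ ξ, (∫⁻ η, k η) ^ (p - 1) * ∫⁻ η, k η * a (ξ - η) ^ p :=
        lintegral_mono fun ξ => lintegral_mul_rpow_le (a := fun η => a (ξ - η)) hk (by fun_prop) hp
    _ = (∫⁻ η, k η) ^ (p - 1) * ∫⁻ ξ, ∫⁻ η, k η * a (ξ - η) ^ p :=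
        lintegral_const_mul _ (Measurable.lintegral_prod_right'
          (f := fun z : E × E => k z.2 * a (z.1 - z.2) ^ p) (by fun_prop))
    _ = (∫⁻ η, k η) ^ (p - 1) * ∫⁻ η, k η * ∫⁻ ξ, a ξ ^ p := by
        rw [lintegral_lintegral_swap (by fun_prop)]
        congr 2 with η
        rw [lintegral_const_mul _ (by fun_prop),
          lintegral_sub_right_eq_self (fun x => a x ^ p)]
    _ = _ := by
        rw [lintegral_mul_const _ hk, ← mul_assoc]
        congr 1
        conv_lhs => enter [2]; rw [← ENNReal.rpow_one (∫⁻ η, k η)]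
        rw [← ENNReal.rpow_add_of_nonneg _ _ (by linarith) zero_le_one]
        congr 1; ring

lemma measurable_convolution {κ F : E → ℂ} (hκ : Measurable κ) (hF : Measurable F) :
    Measurable fun ξ => ∫ η, κ η * F (ξ - η) := by
  have : StronglyMeasurable fun z : E × E => κ z.2 * F (z.1 - z.2) :=
    Measurable.stronglyMeasurable (by fun_prop)
  exact this.integral_prod_right'.measurable

lemma enorm_convolution_le (κ F : E → ℂ) (ξ : E) :
    ‖∫ η, κ η * F (ξ - η)‖ₑ ≤ ∫⁻ η, ‖κ η‖ₑ * ‖F (ξ - η)‖ₑ := by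
  refine (enorm_integral_le_lintegral_enorm _).trans (le_of_eq ?_)
  simp_rw [enorm_mul]

lemma integrable_convolution_of_bounded {κ F : E → ℂ} (hκ : Integrable κ) (hF : Measurable F)
    {B : ℝ} (hB : ∀ x, ‖F x‖ ≤ B) (ξ : E) : Integrable fun η => κ η * F (ξ - η) :=
  hκ.mul_bdd (c := B) (hF.comp (by fun_prop)).aestronglyMeasurable (ae_of_all _ fun _ => hB _)

lemma eLpNorm_two_fourier {H : Type*} [NormedAddCommGroup H] [InnerProductSpace ℂ H]
    [CompleteSpace H] (S : 𝓢(E, H)) :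
    eLpNorm (𝓕 S : 𝓢(E, H)) 2 volume = eLpNorm S 2 volume := by
  have h := norm_fourier_toL2_eq S
  rwa [norm_toLp, norm_toLp, ENNReal.toReal_eq_toReal_iff' (eLpNorm_lt_top _ _ _).ne
    (eLpNorm_lt_top _ _ _).ne] at h

lemma eLpNorm_two_convolution_schwartz_le {κ : 𝓢(E, ℂ)} (hκ : ∀ x, ‖𝓕 κ x‖ ≤ 1) (S : 𝓢(E, ℂ)) :
    eLpNorm (fun ξ => ∫ η, κ η * S (ξ - η)) 2 volume ≤ eLpNorm S 2 volume := by
  have h : (fun ξ => ∫ η, κ η * S (ξ - η)) = convolution (ContinuousLinearMap.mul ℂ ℂ) κ S := by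
    ext ξ
    rw [convolution_apply]
    rfl
  rw [h, ← eLpNorm_two_fourier, ← eLpNorm_two_fourier S, fourier_convolution]
  refine eLpNorm_mono fun x => ?_
  simp only [pairing_apply_apply, ContinuousLinearMap.mul_apply', norm_mul]
  exact mul_le_of_le_one_left (norm_nonneg _) (hκ x)

lemma eLpNorm_two_convolution_le_mul (κ : 𝓢(E, ℂ)) {F : E → ℂ} (hF : Measurable F) :
    eLpNorm (fun ξ => ∫ η, κ η * F (ξ - η)) 2 volume ≤
      (∫⁻ η, ‖κ η‖ₑ) * eLpNorm F 2 volume := by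
  rw [eLpNorm_eq_lintegral_rpow_enorm_toReal (by norm_num) (by norm_num),
    eLpNorm_eq_lintegral_rpow_enorm_toReal (by norm_num) (by norm_num)]
  rw [ENNReal.toReal_ofNat]
  have h := lintegral_convolution_rpow_le (k := fun η => ‖κ η‖ₑ) (a := fun η => ‖F η‖ₑ)
    (by fun_prop) (by fun_prop) (p := 2) (by norm_num)
  have h2 := ENNReal.rpow_le_rpow h (z := 1 / 2) (by norm_num)
  rw [ENNReal.mul_rpow_of_nonneg _ _ (by norm_num), ← ENNReal.rpow_mul] at h2
  norm_num at h2 ⊢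
  refine le_trans ?_ h2
  gcongr with ξ
  exact enorm_convolution_le _ _ _

/-- A bounded Fourier multiplier acts on bounded `L²` functions with norm at most one. -/
lemma eLpNorm_two_convolution_le {κ : 𝓢(E, ℂ)} (hκ : ∀ x, ‖𝓕 κ x‖ ≤ 1) {F : E → ℂ}
    (hF : Measurable F) {B : ℝ} (hB : ∀ x, ‖F x‖ ≤ B) :
    eLpNorm (fun ξ => ∫ η, κ η * F (ξ - η)) 2 volume ≤ eLpNorm F 2 volume := by
  by_cases htop : eLpNorm F 2 volume = ∞
  · simp [htop]
  have hmem : MemLp F 2 volume := ⟨hF.aestronglyMeasurable, lt_top_iff_ne_top.2 htop⟩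
  have hK : ∫⁻ η, ‖κ η‖ₑ ≠ ∞ := κ.integrable.2.ne
  set K := (∫⁻ η, ‖κ η‖ₑ).toReal with hKdef
  have key : ∀ ε : ℝ, 0 < ε → eLpNorm (fun ξ => ∫ η, κ η * F (ξ - η)) 2 volume ≤
      eLpNorm F 2 volume + ENNReal.ofReal ((K + 1) * ε) := by
    intro ε hε
    obtain ⟨g, hg1, hg2, hg3⟩ := hmem.exist_eLpNorm_sub_le (by norm_num) (by norm_num) hε
    set S : 𝓢(E, ℂ) := hg1.toSchwartzMap hg2
    have hS : ∀ x, S x = g x := fun x => rfl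
    have hSm : Measurable S := S.continuous.measurable
    obtain ⟨B', hB'⟩ : ∃ B', ∀ x, ‖S x‖ ≤ B' :=
      ⟨SchwartzMap.seminorm ℝ 0 0 S, norm_le_seminorm ℝ S⟩
    have hd : eLpNorm (fun x => F x - S x) 2 volume ≤ ENNReal.ofReal ε := hg3
    have hsplit : (fun ξ => ∫ η, κ η * F (ξ - η)) =
        (fun ξ => ∫ η, κ η * (F (ξ - η) - S (ξ - η))) + fun ξ => ∫ η, κ η * S (ξ - η) := by
      ext ξ
      simp only [Pi.add_apply]
      rw [← integral_add]
      · congr with η; ring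
      · exact integrable_convolution_of_bounded (F := fun x => F x - S x) κ.integrable
          (by fun_prop) (B := B + B')
          (fun x => (norm_sub_le _ _).trans (add_le_add (hB x) (hB' x))) ξ
      · exact integrable_convolution_of_bounded κ.integrable hSm hB' ξ
    have hSF : eLpNorm S 2 volume ≤ ENNReal.ofReal ε + eLpNorm F 2 volume := by
      have : (S : E → ℂ) = F - (fun x => F x - S x) := by ext x; simp
      calc eLpNorm S 2 volume = eLpNorm (F - (fun x => F x - S x)) 2 volume := by rw [← this]
        _ ≤ eLpNorm F 2 volume + eLpNorm (fun x => F x - S x) 2 volume :=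
            eLpNorm_sub_le (by fun_prop) (by fun_prop) (by norm_num)
        _ ≤ _ := by rw [add_comm]; gcongr
    calc _ ≤ eLpNorm (fun ξ => ∫ η, κ η * (F (ξ - η) - S (ξ - η))) 2 volume +
          eLpNorm (fun ξ => ∫ η, κ η * S (ξ - η)) 2 volume := by
          rw [hsplit]
          exact eLpNorm_add_le
            (measurable_convolution (F := fun x => F x - S x) (by fun_prop)
              (by fun_prop)).aestronglyMeasurable
            (measurable_convolution (by fun_prop) hSm).aestronglyMeasurable (by norm_num)
      _ ≤ ENNReal.ofReal K * ENNReal.ofReal ε + (ENNReal.ofReal ε + eLpNorm F 2 volume) := by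
          refine add_le_add ?_ ((eLpNorm_two_convolution_schwartz_le hκ S).trans hSF)
          refine (eLpNorm_two_convolution_le_mul κ (F := fun x => F x - S x) (by fun_prop)).trans ?_
          rw [hKdef, ENNReal.ofReal_toReal hK]
          gcongr
      _ = _ := by
          rw [← ENNReal.ofReal_mul ENNReal.toReal_nonneg, ← add_assoc,
            ← ENNReal.ofReal_add (mul_nonneg ENNReal.toReal_nonneg hε.le) hε.le, add_comm]
          congr 2; ring
  refine ENNReal.le_of_forall_pos_le_add fun δ hδ _ => ?_
  have hK0 : 0 < K + 1 := by have : 0 ≤ K := ENNReal.toReal_nonneg; linarith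
  have := key (δ / (K + 1)) (div_pos hδ hK0)
  rwa [mul_div_cancel₀ _ hK0.ne', ENNReal.ofReal_coe_nnreal] at this


lemma lintegral_convolution_rpow_two_le {κ : 𝓢(E, ℂ)} (hκ : ∀ x, ‖𝓕 κ x‖ ≤ 1) {F : E → ℂ}
    (hF : Measurable F) {B : ℝ} (hB : ∀ x, ‖F x‖ ≤ B) :
    ∫⁻ ξ, ‖∫ η, κ η * F (ξ - η)‖ₑ ^ (2 : ℝ) ≤ ∫⁻ ξ, ‖F ξ‖ₑ ^ (2 : ℝ) := by
  have h := eLpNorm_two_convolution_le hκ hF hB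
  rw [eLpNorm_eq_lintegral_rpow_enorm_toReal (by norm_num) (by norm_num),
    eLpNorm_eq_lintegral_rpow_enorm_toReal (by norm_num) (by norm_num),
    ENNReal.toReal_ofNat] at h
  exact (ENNReal.rpow_le_rpow_iff (by norm_num)).1 h

lemma convolution_eq_add_indicator {κ : 𝓢(E, ℂ)} {F : E → ℂ} (hF : Measurable F) {B : ℝ}
    (hB : ∀ x, ‖F x‖ ≤ B) {A : Set E} (hA : MeasurableSet A) (ξ : E) :
    ∫ η, κ η * F (ξ - η) = (∫ η, κ η * A.indicator F (ξ - η)) +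
      ∫ η, κ η * Aᶜ.indicator F (ξ - η) := by
  rw [← integral_add]
  · congr with η
    rw [← mul_add, ← Pi.add_apply, Set.indicator_self_add_compl]
  · exact integrable_convolution_of_bounded κ.integrable (hF.indicator hA)
      (fun x => (norm_indicator_le_norm_self F x).trans (hB x)) ξ
  · exact integrable_convolution_of_bounded κ.integrable (hF.indicator hA.compl)
      (fun x => (norm_indicator_le_norm_self F x).trans (hB x)) ξ

/-- The weak-type consequence of the `L²` bound for the part of `F` living on `A`. -/
lemma measure_le_norm_convolution_indicator_two {κ : 𝓢(E, ℂ)} (hκ : ∀ x, ‖𝓕 κ x‖ ≤ 1)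
    {F : E → ℂ} (hF : Measurable F) {B : ℝ} (hB : ∀ x, ‖F x‖ ≤ B) {A : Set E}
    (hA : MeasurableSet A) {s : ℝ} (hs : 0 < s) :
    volume {ξ | s / 2 ≤ ‖∫ η, κ η * A.indicator F (ξ - η)‖} ≤
      ENNReal.ofReal (4 / s ^ 2) * ∫⁻ x in A, ENNReal.ofReal (‖F x‖ ^ 2) := by
  have hm := measurable_convolution (κ := κ) κ.continuous.measurable (hF.indicator hA)
  have h1 := mul_meas_ge_le_lintegral (μ := volume) ((hm.enorm).pow_const (2 : ℝ))
    (ENNReal.ofReal ((s / 2) ^ 2))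
  have h2 := lintegral_convolution_rpow_two_le hκ (hF.indicator hA)
    (fun x => (norm_indicator_le_norm_self F x).trans (hB x))
  have h3 : ∫⁻ ξ, ‖A.indicator F ξ‖ₑ ^ (2 : ℝ) = ∫⁻ x in A, ENNReal.ofReal (‖F x‖ ^ 2) := by
    rw [← lintegral_indicator hA]
    congr with x
    by_cases hx : x ∈ A <;> simp [hx, ENNReal.ofReal_pow]
  have h4 : {ξ | s / 2 ≤ ‖∫ η, κ η * A.indicator F (ξ - η)‖} ⊆
      {ξ | ENNReal.ofReal ((s / 2) ^ 2) ≤ ‖∫ η, κ η * A.indicator F (ξ - η)‖ₑ ^ (2 : ℝ)} := by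
    intro ξ hξ
    have hξ' : s / 2 ≤ ‖∫ η, κ η * A.indicator F (ξ - η)‖ := hξ
    change ENNReal.ofReal ((s / 2) ^ 2) ≤ ‖∫ η, κ η * A.indicator F (ξ - η)‖ₑ ^ (2 : ℝ)
    rw [← ofReal_norm, ENNReal.ofReal_rpow_of_nonneg (norm_nonneg _) (by norm_num)]
    refine ENNReal.ofReal_le_ofReal ?_
    rw [Real.rpow_two]
    gcongr
  calc _ = ENNReal.ofReal (4 / s ^ 2) * (ENNReal.ofReal ((s / 2) ^ 2) *
        volume {ξ | s / 2 ≤ ‖∫ η, κ η * A.indicator F (ξ - η)‖}) := by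
        rw [← mul_assoc, ← ENNReal.ofReal_mul (by positivity)]
        have : 4 / s ^ 2 * (s / 2) ^ 2 = 1 := by field_simp; norm_num
        simp [this]
    _ ≤ _ := by
        gcongr
        exact ((mul_le_mul_right (measure_mono h4) _).trans h1).trans (h2.trans h3.le)

/-- The weak-type consequence of the `L¹` bound for the part of `F` living on `A`. -/
lemma measure_le_norm_convolution_indicator_one {κ : 𝓢(E, ℂ)} {M : ℝ}
    (hκM : ∫⁻ η, ‖κ η‖ₑ ≤ ENNReal.ofReal M) {F : E → ℂ} (hF : Measurable F) {A : Set E}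
    (hA : MeasurableSet A) {s : ℝ} (hs : 0 < s) :
    volume {ξ | s / 2 ≤ ‖∫ η, κ η * A.indicator F (ξ - η)‖} ≤
      ENNReal.ofReal (2 * M / s) * ∫⁻ x in A, ENNReal.ofReal ‖F x‖ := by
  have hm := measurable_convolution (κ := κ) κ.continuous.measurable (hF.indicator hA)
  have h1 := mul_meas_ge_le_lintegral (μ := volume) hm.enorm (ENNReal.ofReal (s / 2))
  have h2 : ∫⁻ ξ, ‖∫ η, κ η * A.indicator F (ξ - η)‖ₑ ≤
      ENNReal.ofReal M * ∫⁻ ξ, ‖A.indicator F ξ‖ₑ := by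
    have := lintegral_convolution_rpow_le (k := fun η => ‖κ η‖ₑ)
      (a := fun η => ‖A.indicator F η‖ₑ) κ.continuous.measurable.enorm (hF.indicator hA).enorm
      (p := 1) le_rfl
    simp only [ENNReal.rpow_one] at this
    exact (lintegral_mono fun ξ => enorm_convolution_le _ _ _).trans
      (this.trans (mul_le_mul_left hκM _))
  have h3 : ∫⁻ ξ, ‖A.indicator F ξ‖ₑ = ∫⁻ x in A, ENNReal.ofReal ‖F x‖ := by
    rw [← lintegral_indicator hA]
    congr with x
    by_cases hx : x ∈ A <;> simp [hx]
  have h4 : {ξ | s / 2 ≤ ‖∫ η, κ η * A.indicator F (ξ - η)‖} ⊆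
      {ξ | ENNReal.ofReal (s / 2) ≤ ‖∫ η, κ η * A.indicator F (ξ - η)‖ₑ} := by
    intro ξ hξ
    have hξ' : s / 2 ≤ ‖∫ η, κ η * A.indicator F (ξ - η)‖ := hξ
    change ENNReal.ofReal (s / 2) ≤ ‖∫ η, κ η * A.indicator F (ξ - η)‖ₑ
    rw [← ofReal_norm]
    exact ENNReal.ofReal_le_ofReal hξ'
  calc _ = ENNReal.ofReal (2 / s) * (ENNReal.ofReal (s / 2) *
        volume {ξ | s / 2 ≤ ‖∫ η, κ η * A.indicator F (ξ - η)‖}) := by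
        rw [← mul_assoc, ← ENNReal.ofReal_mul (by positivity)]
        have : 2 / s * (s / 2) = 1 := by field_simp
        simp [this]
    _ ≤ ENNReal.ofReal (2 / s) * (ENNReal.ofReal M * ∫⁻ x in A, ENNReal.ofReal ‖F x‖) := by
        refine mul_le_mul_right ?_ _
        rw [← h3]
        exact ((mul_le_mul_right (measure_mono h4) _).trans h1).trans h2
    _ = _ := by
        rw [← mul_assoc, ← ENNReal.ofReal_mul (by positivity)]
        congr 2; ring

lemma norm_convolution_le_of_bounded {κ : 𝓢(E, ℂ)} {M : ℝ} (hM : 0 < M)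
    (hκM : ∫⁻ η, ‖κ η‖ₑ ≤ ENNReal.ofReal M) {F : E → ℂ} {b : ℝ} (hb0 : 0 ≤ b)
    (hb : ∀ x, ‖F x‖ ≤ b) (ξ : E) : ‖∫ η, κ η * F (ξ - η)‖ ≤ M * b := by
  have : ‖∫ η, κ η * F (ξ - η)‖ₑ ≤ ENNReal.ofReal (M * b) := by
    refine (enorm_convolution_le _ _ _).trans ?_
    calc _ ≤ ∫⁻ η, ‖κ η‖ₑ * ENNReal.ofReal b := by
          gcongr with η
          rw [← ofReal_norm]
          exact ENNReal.ofReal_le_ofReal (hb _)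
      _ = (∫⁻ η, ‖κ η‖ₑ) * ENNReal.ofReal b :=
          lintegral_mul_const _ κ.continuous.measurable.enorm
      _ ≤ _ := by rw [ENNReal.ofReal_mul hM.le]; gcongr
  rwa [← ofReal_norm, ENNReal.ofReal_le_ofReal_iff (by positivity)] at this

/-- Interpolation between `L¹ → L¹`, `L² → L²` and `L^∞ → L^∞` bounds for a convolution operator,
with explicit dependence on the `L¹` norm of the kernel. -/
lemma exists_lintegral_convolution_rpow_le {p : ℝ} (hp : 1 < p) :
    ∃ C : ℝ, 0 < C ∧ ∀ (κ : 𝓢(E, ℂ)) (M : ℝ), 0 < M → (∫⁻ η, ‖κ η‖ₑ ≤ ENNReal.ofReal M) →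
      (∀ x, ‖𝓕 κ x‖ ≤ 1) → ∀ F : E → ℂ, Measurable F → (∃ B, ∀ x, ‖F x‖ ≤ B) →
      ∫⁻ ξ, ‖∫ η, κ η * F (ξ - η)‖ₑ ^ p ≤
        ENNReal.ofReal (C * M ^ |p - 2|) * ∫⁻ ξ, ‖F ξ‖ₑ ^ p := by
  have hp0 : 0 < p := by linarith
  have conv : ∀ G : E → ℂ, ∫⁻ ξ, ‖G ξ‖ₑ ^ p = ∫⁻ ξ, ENNReal.ofReal (‖G ξ‖ ^ p) := by
    intro G
    simp_rw [← ofReal_norm, ENNReal.ofReal_rpow_of_nonneg (norm_nonneg _) hp0.le]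
  rcases lt_trichotomy p 2 with h2 | rfl | h2
  · have hC : 0 < 2 * p / (p - 1) + 4 * p / (2 - p) :=
      add_pos (div_pos (by linarith) (by linarith)) (div_pos (by linarith) (by linarith))
    refine ⟨_, hC, fun κ M hM hκM hκ F hF ⟨B, hB⟩ => ?_⟩
    rw [conv, conv, abs_of_neg (by linarith), neg_sub]
    refine lintegral_rpow_le_of_weak_one_two hp h2 hM (by fun_prop)
      (measurable_convolution κ.continuous.measurable hF).norm (fun _ => norm_nonneg _)
      (fun _ => norm_nonneg _) fun s hs => ?_
    set A : Set E := {x | s < M⁻¹ * ‖F x‖} with hAdef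
    have hA : MeasurableSet A := measurableSet_lt measurable_const (by fun_prop)
    have hAc : {x | M⁻¹ * ‖F x‖ ≤ s} = Aᶜ := by ext x; simp [hAdef]
    rw [hAc]
    refine le_trans (measure_mono ?_) ((measure_union_le _ _).trans (add_le_add
      (measure_le_norm_convolution_indicator_one hκM hF hA hs)
      (measure_le_norm_convolution_indicator_two hκ hF hB hA.compl hs)))
    intro ξ hξ
    have hξ' : s < ‖∫ η, κ η * F (ξ - η)‖ := hξ
    rw [convolution_eq_add_indicator hF hB hA] at hξ'
    have := hξ'.trans_le (norm_add_le _ _)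
    by_contra! hcon
    simp only [Set.mem_union, Set.mem_ofPred_eq, not_or, not_le] at hcon
    linarith
  · refine ⟨1, one_pos, fun κ M hM hκM hκ F hF ⟨B, hB⟩ => ?_⟩
    simpa using lintegral_convolution_rpow_two_le hκ hF hB
  · have hC : 0 < 4 * p / (p - 2) * 2 ^ (p - 2) :=
      mul_pos (div_pos (by linarith) (by linarith)) (by positivity)
    refine ⟨_, hC, fun κ M hM hκM hκ F hF ⟨B, hB⟩ => ?_⟩
    rw [conv, conv, abs_of_pos (by linarith), mul_assoc, ← Real.mul_rpow (by norm_num) hM.le]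
    refine lintegral_rpow_le_of_weak_two_top h2 (by positivity) (by fun_prop)
      (measurable_convolution κ.continuous.measurable hF).norm (fun _ => norm_nonneg _)
      (fun _ => norm_nonneg _) fun s hs => ?_
    set A : Set E := {x | s < 2 * M * ‖F x‖} with hAdef
    have hA : MeasurableSet A := measurableSet_lt measurable_const (by fun_prop)
    refine le_trans (measure_mono ?_) (measure_le_norm_convolution_indicator_two hκ hF hB hA hs)
    intro ξ hξ
    have hξ' : s < ‖∫ η, κ η * F (ξ - η)‖ := hξ
    rw [convolution_eq_add_indicator hF hB hA] at hξ'
    have h3 := hξ'.trans_le (norm_add_le _ _)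
    have h4 : ‖∫ η, κ η * Aᶜ.indicator F (ξ - η)‖ ≤ M * (s / (2 * M)) := by
      refine norm_convolution_le_of_bounded hM hκM (by positivity) (fun x => ?_) ξ
      by_cases hx : x ∈ A
      · simp only [Set.mem_compl_iff, hx, not_true_eq_false, not_false_eq_true,
          Set.indicator_of_notMem, norm_zero]
        positivity
      · rw [Set.indicator_of_mem (Set.mem_compl hx), le_div_iff₀ (by positivity)]
        have : ¬ s < 2 * M * ‖F x‖ := hx
        linarith
    have h5 : M * (s / (2 * M)) = s / 2 := by field_simp
    change s / 2 ≤ _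
    linarith

end Convolution

section Gaussian

open FourierTransform SchwartzMap

lemma norm_iteratedFDeriv_cexp_le (n : ℕ) (z : ℂ) :
    ‖iteratedFDeriv ℝ n Complex.exp z‖ ≤ ‖Complex.exp z‖ := by
  induction n generalizing z with
  | zero => simp
  | succ n ih =>
    have h : fderiv ℝ Complex.exp = fun z => (ContinuousLinearMap.mul ℝ ℂ) (Complex.exp z) := by
      ext1 z
      have := (Complex.hasDerivAt_exp z).hasFDerivAt.restrictScalars ℝ
      rw [this.fderiv]
      ext : 1
      simp [mul_comm]
    have hc : ContDiffAt ℝ n Complex.exp z := Complex.contDiff_exp.contDiffAt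
    rw [← norm_iteratedFDeriv_fderiv, h]
    refine ((ContinuousLinearMap.mul ℝ ℂ).norm_iteratedFDeriv_comp_left hc le_rfl).trans ?_
    exact (mul_le_of_le_one_left (norm_nonneg _) (ContinuousLinearMap.opNorm_mul_le ℝ ℂ)).trans
      (ih z)

lemma one_add_pow_mul_exp_neg_le {a : ℝ} (ha : 0 < a) (m : ℕ) {r : ℝ} (hr : 0 ≤ r) :
    (1 + r) ^ m * Real.exp (-a * r ^ 2) ≤ m.factorial * Real.exp (1 + 1 / (4 * a)) := by
  have h1 := Real.pow_div_factorial_le_exp (1 + r) (by linarith) m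
  rw [div_le_iff₀ (by positivity)] at h1
  have h2 : 1 + r + -a * r ^ 2 ≤ 1 + 1 / (4 * a) := by
    have : 0 ≤ a * (r - 1 / (2 * a)) ^ 2 := by positivity
    have e : a * (r - 1 / (2 * a)) ^ 2 = a * r ^ 2 - r + 1 / (4 * a) := by field_simp; ring
    linarith
  calc _ ≤ Real.exp (1 + r) * m.factorial * Real.exp (-a * r ^ 2) := by gcongr
    _ = m.factorial * Real.exp (1 + r + -a * r ^ 2) := by rw [Real.exp_add (1 + r)]; ring
    _ ≤ _ := by gcongr

variable {E : Type*} [NormedAddCommGroup E] [InnerProductSpace ℝ E]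

lemma hasTemperateGrowth_neg_mul_norm_sq (b : ℂ) :
    Function.HasTemperateGrowth fun x : E => -b * ((‖x‖ ^ 2 : ℝ) : ℂ) := by
  have h : Function.HasTemperateGrowth fun x : E => ‖x‖ ^ 2 := by fun_prop
  have hc : Function.HasTemperateGrowth fun x : E => Complex.ofRealCLM (‖x‖ ^ 2) :=
    Complex.ofRealCLM.hasTemperateGrowth.comp h
  exact (Function.HasTemperateGrowth.const (-b)).mul hc

/-- The Gaussian `x ↦ e^{-b|x|²}` with complex parameter `b`, as a Schwartz function. -/
def gaussianSchwartz (E : Type*) [NormedAddCommGroup E] [InnerProductSpace ℝ E] (b : ℂ)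
    (hb : 0 < b.re) : 𝓢(E, ℂ) where
  toFun x := Complex.exp (-b * ((‖x‖ ^ 2 : ℝ) : ℂ))
  smooth' := (Complex.contDiff_exp (𝕜 := ℝ)).comp (hasTemperateGrowth_neg_mul_norm_sq b).1
  decay' k n := by
    obtain ⟨l, C, hC, h⟩ := (hasTemperateGrowth_neg_mul_norm_sq (E := E)
      b).norm_iteratedFDeriv_le_uniform n
    refine ⟨n.factorial * (1 + C) ^ n * ((k + l * n).factorial *
      Real.exp (1 + 1 / (4 * b.re))), fun x => ?_⟩
    have hx : 0 ≤ ‖x‖ := norm_nonneg x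
    have h1 : 1 ≤ (1 + C) * (1 + ‖x‖) ^ l := 
      one_le_mul_of_one_le_of_one_le (by linarith) (one_le_pow₀ (by linarith))
    have key := norm_iteratedFDeriv_comp_le (𝕜 := ℝ) (N := ((⊤ : ℕ∞) : WithTop ℕ∞)) (n := n)
      (g := Complex.exp)
      (f := fun x : E => -b * ((‖x‖ ^ 2 : ℝ) : ℂ)) (Complex.contDiff_exp (𝕜 := ℝ))
      (hasTemperateGrowth_neg_mul_norm_sq b).1 (by exact_mod_cast le_top) x
      (C := Real.exp (-b.re * ‖x‖ ^ 2)) (D := (1 + C) * (1 + ‖x‖) ^ l)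
      (fun i _ => (norm_iteratedFDeriv_cexp_le i _).trans (le_of_eq (by
        rw [Complex.norm_exp, Complex.re_mul_ofReal, Complex.neg_re])))
      (fun i hi hin => (h i hin x).trans ((mul_le_mul_of_nonneg_right (by linarith)
        (by positivity)).trans (le_self_pow₀ h1 (by omega))))
    have h2 : ‖x‖ ^ k ≤ (1 + ‖x‖) ^ k := by gcongr; linarith
    calc _ ≤ (1 + ‖x‖) ^ k * (n.factorial * Real.exp (-b.re * ‖x‖ ^ 2) *
          ((1 + C) * (1 + ‖x‖) ^ l) ^ n) := by gcongr; exact key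
      _ = n.factorial * (1 + C) ^ n * ((1 + ‖x‖) ^ (k + l * n) *
          Real.exp (-b.re * ‖x‖ ^ 2)) := by rw [mul_pow, pow_add, pow_mul]; ring
      _ ≤ _ := by
        refine mul_le_mul_of_nonneg_left ?_ (by positivity)
        exact one_add_pow_mul_exp_neg_le hb _ hx

@[simp]
lemma gaussianSchwartz_apply {b : ℂ} (hb : 0 < b.re) (x : E) :
    gaussianSchwartz E b hb x = Complex.exp (-b * (‖x‖ : ℂ) ^ 2) := by
  rw [← Complex.ofReal_pow]
  rfl

lemma norm_gaussianSchwartz_apply {b : ℂ} (hb : 0 < b.re) (x : E) :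
    ‖gaussianSchwartz E b hb x‖ = Real.exp (-b.re * ‖x‖ ^ 2) := by
  rw [gaussianSchwartz_apply, ← Complex.ofReal_pow, Complex.norm_exp, Complex.re_mul_ofReal,
    Complex.neg_re]

variable [FiniteDimensional ℝ E] [MeasurableSpace E] [BorelSpace E]

lemma lintegral_exp_neg_mul_norm_sq {a : ℝ} (ha : 0 < a) :
    ∫⁻ x : E, ENNReal.ofReal (Real.exp (-a * ‖x‖ ^ 2)) =
      ENNReal.ofReal ((π / a) ^ (Module.finrank ℝ E / 2 : ℝ)) := by
  have h : Integrable fun x : E => Real.exp (-a * ‖x‖ ^ 2) := by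
    have := (gaussianSchwartz E (a : ℂ) (by simpa using ha)).integrable (μ := volume) |>.norm
    simpa only [norm_gaussianSchwartz_apply, Complex.ofReal_re] using this
  rw [← ofReal_integral_eq_lintegral_ofReal h (ae_of_all _ fun _ => (Real.exp_pos _).le),
    GaussianFourier.integral_rexp_neg_mul_sq_norm ha]

lemma norm_fourier_gaussianSchwartz {b : ℂ} (hb : 0 < b.re) (w : E) :
    ‖𝓕 (gaussianSchwartz E b hb) w‖ = (π / ‖b‖) ^ (Module.finrank ℝ E / 2 : ℝ) *
      Real.exp (-(π ^ 2 * b.re / ‖b‖ ^ 2) * ‖w‖ ^ 2) := by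
  have h1 : (gaussianSchwartz E b hb : E → ℂ) = fun v => Complex.exp (-b * (‖v‖ : ℂ) ^ 2) := by
    ext v; simp
  rw [fourier_coe, h1, fourier_gaussian_innerProductSpace hb, norm_mul]
  congr 1
  · have : (Module.finrank ℝ E / 2 : ℂ) = ((Module.finrank ℝ E / 2 : ℝ) : ℂ) := by push_cast; rfl
    rw [this, Complex.norm_cpow_real, norm_div, Complex.norm_real, Real.norm_eq_abs,
      abs_of_pos Real.pi_pos]
  · rw [Complex.norm_exp]
    congr 1
    have : (-(π : ℂ) ^ 2 * (‖w‖ : ℂ) ^ 2 / b) = ((-π ^ 2 * ‖w‖ ^ 2 : ℝ) : ℂ) * b⁻¹ := by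
      push_cast; rw [div_eq_mul_inv]
    rw [this, Complex.re_ofReal_mul, Complex.inv_re, Complex.normSq_eq_norm_sq]
    ring

lemma lintegral_enorm_fourier_gaussianSchwartz {b : ℂ} (hb : 0 < b.re) :
    ∫⁻ w, ‖𝓕 (gaussianSchwartz E b hb) w‖ₑ =
      ENNReal.ofReal ((‖b‖ / b.re) ^ (Module.finrank ℝ E / 2 : ℝ)) := by
  have hb0 : 0 < ‖b‖ := hb.trans_le (Complex.re_le_norm b)
  simp_rw [← ofReal_norm, norm_fourier_gaussianSchwartz, ENNReal.ofReal_mul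
    (show 0 ≤ (π / ‖b‖) ^ (Module.finrank ℝ E / 2 : ℝ) by positivity)]
  rw [lintegral_const_mul' _ _ ENNReal.ofReal_ne_top, lintegral_exp_neg_mul_norm_sq (by positivity),
    ← ENNReal.ofReal_mul (by positivity), ← Real.mul_rpow (by positivity) (by positivity)]
  congr 2
  field_simp

lemma fourier_fourier_apply (f : 𝓢(E, ℂ)) (x : E) : 𝓕 (𝓕 f) x = f (-x) := by
  have h : (𝓕⁻ (𝓕 f) : 𝓢(E, ℂ)) (-x) = f (-x) := by rw [fourierInv_fourier_eq]
  rwa [fourierInv_coe, Real.fourierInv_eq_fourier_neg, neg_neg, ← fourier_coe] at h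

lemma norm_fourier_le_integral_norm (v : E → ℂ) (ξ : E) : ‖𝓕 v ξ‖ ≤ ∫ s, ‖v s‖ := by
  rw [Real.fourier_eq]
  exact (norm_integral_le_integral_norm _).trans (le_of_eq (by simp))

lemma integral_fourier_mul_eq {f g : E → ℂ} (hf : Integrable f) (hg : Integrable g) :
    ∫ ξ, 𝓕 f ξ * g ξ = ∫ x, f x * 𝓕 g x := by
  have := VectorFourier.integral_fourierIntegral_smul_eq_flip (L := innerₗ E)
    Real.continuous_fourierChar continuous_inner hf hg
  rwa [flip_innerₗ] at this

/-- The Fourier transform turns multiplication by a Schwartz function into convolution. -/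
lemma fourier_schwartz_mul (m : 𝓢(E, ℂ)) {v : E → ℂ} (hv : Integrable v) (ξ : E) :
    𝓕 (fun s => m s * v s) ξ = ∫ η, 𝓕 m η * 𝓕 v (ξ - η) := by
  set w : E → ℂ := fun s => Real.fourierChar (inner ℝ s ξ) • v (-s) with hw
  have hwi : Integrable w := by
    have h1 : Integrable fun s => v (-s) := hv.comp_neg
    refine (integrable_norm_iff ?_).1 ?_
    · exact ((by fun_prop : Continuous fun s : E =>
        Real.fourierChar (inner ℝ s ξ)).aestronglyMeasurable).smul h1.aestronglyMeasurable
    · simpa [hw] using h1.norm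
  have hfw : ∀ η, 𝓕 w η = 𝓕 v (ξ - η) := by
    intro η
    rw [Real.fourier_eq, Real.fourier_eq, ← integral_neg_eq_self]
    congr with s
    rw [hw]
    simp only [neg_neg, smul_smul, ← AddChar.map_add_eq_mul]
    congr 2
    simp only [inner_neg_left, inner_sub_right]
    ring
  calc 𝓕 (fun s => m s * v s) ξ
      = ∫ s, Real.fourierChar (-inner ℝ s ξ) • (m s * v s) := Real.fourier_eq _ _
    _ = ∫ s, 𝓕 (𝓕 m) s * w s := by
        rw [← integral_neg_eq_self]
        congr with s
        simp only [hw, fourier_fourier_apply, inner_neg_left, neg_neg, mul_smul_comm]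
    _ = ∫ η, 𝓕 m η * 𝓕 w η := integral_fourier_mul_eq (𝓕 m).integrable hwi
    _ = _ := by simp_rw [hfw]

end Gaussian

section WindowedFourier

open FourierTransform SchwartzMap

variable {E : Type*} [NormedAddCommGroup E]

/-- The real Gaussian `s ↦ e^{-a|s|²}`, as a complex-valued function. -/
def gaussianFun (a : ℝ) (s : E) : ℂ := (Real.exp (-a * ‖s‖ ^ 2) : ℝ)

/-- The chirp `s ↦ e^{-2π² i t|s|²}`, the symbol of the free Schrödinger propagator. -/
def chirp (t : ℝ) (s : E) : ℂ :=
  Complex.exp (-(((2 * π ^ 2 * t * ‖s‖ ^ 2 : ℝ) : ℂ) * Complex.I))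

@[fun_prop]
lemma continuous_gaussianFun (a : ℝ) : Continuous (gaussianFun a : E → ℂ) := by
  unfold gaussianFun; fun_prop

@[fun_prop]
lemma continuous_chirp (t : ℝ) : Continuous (chirp t : E → ℂ) := by
  unfold chirp; fun_prop

@[simp]
lemma norm_chirp (t : ℝ) (s : E) : ‖chirp t s‖ = 1 := by
  rw [chirp, ← neg_mul, ← Complex.ofReal_neg, Complex.norm_exp_ofReal_mul_I]

lemma norm_gaussianFun (a : ℝ) (s : E) : ‖gaussianFun a s‖ = Real.exp (-a * ‖s‖ ^ 2) := by
  rw [gaussianFun, Complex.norm_real, Real.norm_eq_abs, abs_of_pos (Real.exp_pos _)]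

lemma norm_gaussianFun_le_one {a : ℝ} (ha : 0 ≤ a) (s : E) : ‖gaussianFun a s‖ ≤ 1 := by
  rw [norm_gaussianFun, Real.exp_le_one_iff, neg_mul]
  exact neg_nonpos.2 (by positivity)

variable [InnerProductSpace ℝ E]

lemma gaussianFun_eq_gaussianSchwartz {a : ℝ} (ha : 0 < a) :
    (gaussianFun a : E → ℂ) = gaussianSchwartz E (a : ℂ) (by simpa using ha) := by
  ext s
  rw [gaussianFun, gaussianSchwartz_apply]
  push_cast
  rfl

variable [FiniteDimensional ℝ E] [MeasurableSpace E] [BorelSpace E]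

lemma integrable_gaussianFun {a : ℝ} (ha : 0 < a) : Integrable (gaussianFun a : E → ℂ) := by
  rw [gaussianFun_eq_gaussianSchwartz ha]
  exact SchwartzMap.integrable _

/-- The short-time Fourier transform of `f` with window `g`. -/
def windowedFourier (g f : E → ℂ) (x ξ : E) : ℂ := 𝓕 (fun s => f s * g (s - x)) ξ

lemma measurable_windowedFourier {g f : E → ℂ} (hg : Measurable g) (hf : Measurable f) :
    Measurable fun z : E × E => windowedFourier g f z.1 z.2 := by
  have : StronglyMeasurable fun w : (E × E) × E =>
      Complex.exp ((-2 * π * ⟪w.2, w.1.2⟫ : ℝ) * Complex.I) • (f w.2 * g (w.2 - w.1.1)) := by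
    have hc : Continuous fun w : (E × E) × E =>
        Complex.exp ((-2 * π * ⟪w.2, w.1.2⟫ : ℝ) * Complex.I) := by fun_prop
    exact (hc.measurable.smul (by fun_prop :
      Measurable fun w : (E × E) × E => f w.2 * g (w.2 - w.1.1))).stronglyMeasurable
  simp_rw [windowedFourier, Real.fourier_eq']
  exact this.integral_prod_right'.measurable

lemma norm_windowedFourier_chirp_mul (t : ℝ) (ψ : E → ℂ) (x ξ : E)
    (hb : 0 < ((π / 2 : ℝ) + (2 * π ^ 2 * t : ℝ) * Complex.I : ℂ).re) :
    ‖windowedFourier (gaussianFun π) (fun s => chirp t s * ψ s) x ξ‖ =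
      ‖𝓕 (fun s => gaussianSchwartz E _ hb s * (ψ (s + x) * gaussianFun (π / 2) s))
        (ξ + (2 * π * t) • x)‖ := by
  have h : windowedFourier (gaussianFun π) (fun s => chirp t s * ψ s) x ξ =
      Complex.exp ((-2 * π * ⟪x, ξ⟫ - 2 * π ^ 2 * t * ‖x‖ ^ 2 : ℝ) * Complex.I) *
      𝓕 (fun s => gaussianSchwartz E _ hb s * (ψ (s + x) * gaussianFun (π / 2) s))
        (ξ + (2 * π * t) • x) := by
    rw [windowedFourier, Real.fourier_eq', Real.fourier_eq', ← integral_const_mul,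
      ← integral_add_right_eq_self _ x]
    congr with s
    simp only [smul_eq_mul, chirp, gaussianFun, gaussianSchwartz_apply, add_sub_cancel_right,
      Complex.ofReal_exp]
    rw [show ∀ a b c d : ℂ, a * (b * c * d) = (a * b * d) * c by intros; ring,
      show ∀ a b c d e : ℂ, a * (b * (c * (d * e))) = (a * b * c * e) * d by intros; ring]
    simp only [← Complex.exp_add]
    congr 2
    rw [norm_add_sq_real, inner_add_left, inner_add_right, inner_smul_right]
    push_cast
    ring
  rw [h, norm_mul, Complex.norm_exp_ofReal_mul_I, one_mul]

lemma norm_windowedFourier_eq_translate (g ψ : E → ℂ) (x ξ : E) :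
    ‖windowedFourier g ψ x ξ‖ = ‖𝓕 (fun s => ψ (s + x) * g s) ξ‖ := by
  have h : windowedFourier g ψ x ξ =
      Complex.exp ((-2 * π * ⟪x, ξ⟫ : ℝ) * Complex.I) * 𝓕 (fun s => ψ (s + x) * g s) ξ := by
    rw [windowedFourier, Real.fourier_eq', Real.fourier_eq', ← integral_const_mul,
      ← integral_add_right_eq_self _ x]
    congr with s
    simp only [smul_eq_mul, add_sub_cancel_right]
    rw [← mul_assoc (Complex.exp _) (Complex.exp _), ← Complex.exp_add]
    congr 2
    rw [inner_add_left]
    push_cast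
    ring
  rw [h, norm_mul, Complex.norm_exp_ofReal_mul_I, one_mul]

lemma norm_windowedFourier_chirp_mul_gaussianFun (t : ℝ) (x ξ : E)
    (hb : 0 < ((2 * π : ℝ) + (2 * π ^ 2 * t : ℝ) * Complex.I : ℂ).re) :
    ‖windowedFourier (gaussianFun π) (fun s => chirp t s * gaussianFun π s) x ξ‖ =
      Real.exp (-(π / 2) * ‖x‖ ^ 2) * ‖𝓕 (gaussianSchwartz E _ hb) (ξ + (π * t) • x)‖ := by
  have h : windowedFourier (gaussianFun π) (fun s => chirp t s * gaussianFun π s) x ξ =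
      Complex.exp ((-π * ⟪x, ξ⟫ - π ^ 2 * t / 2 * ‖x‖ ^ 2 : ℝ) * Complex.I) *
      (gaussianFun (π / 2) x * 𝓕 (gaussianSchwartz E _ hb) (ξ + (π * t) • x)) := by
    rw [windowedFourier, fourier_coe, Real.fourier_eq', Real.fourier_eq', ← integral_const_mul,
      ← integral_const_mul, ← integral_add_right_eq_self _ ((1 / 2 : ℝ) • x)]
    congr with s
    simp only [smul_eq_mul, chirp, gaussianFun, gaussianSchwartz_apply, Complex.ofReal_exp]
    simp only [← Complex.exp_add]
    congr 1
    have e : s + (1 / 2 : ℝ) • x - x = s - (1 / 2 : ℝ) • x := by module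
    rw [e, norm_sub_sq_real, norm_add_sq_real, inner_add_left, inner_add_right, inner_smul_right,
      inner_smul_left, inner_smul_right, norm_smul]
    simp
    ring
  rw [h, norm_mul, norm_mul, Complex.norm_exp_ofReal_mul_I, one_mul, norm_gaussianFun]

end WindowedFourier

section UpperBound

open FourierTransform SchwartzMap

variable {E : Type*} [NormedAddCommGroup E] [InnerProductSpace ℝ E] [FiniteDimensional ℝ E]
  [MeasurableSpace E] [BorelSpace E]

lemma integral_gaussianFun {a : ℝ} (ha : 0 < a) :
    ∫ s : E, gaussianFun a s = ((π / a) ^ (Module.finrank ℝ E / 2 : ℝ) : ℝ) := by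
  simp only [gaussianFun]
  rw [integral_complex_ofReal, GaussianFourier.integral_rexp_neg_mul_sq_norm ha]

lemma lintegral_enorm_gaussianFun {a : ℝ} (ha : 0 < a) :
    ∫⁻ s : E, ‖gaussianFun a s‖ₑ = ENNReal.ofReal ((π / a) ^ (Module.finrank ℝ E / 2 : ℝ)) := by
  simp_rw [← ofReal_norm, norm_gaussianFun]
  exact lintegral_exp_neg_mul_norm_sq ha

lemma integral_gaussianFun_mul_gaussianFun (s : E) :
    ∫ u, gaussianFun π u * gaussianFun π (s - u) =
      (∫ u : E, gaussianFun (2 * π) u) * gaussianFun (π / 2) s := by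
  rw [← integral_mul_const, ← integral_add_right_eq_self _ ((1 / 2 : ℝ) • s)]
  congr with u
  simp only [gaussianFun, ← Complex.ofReal_mul, ← Real.exp_add]
  congr 2
  have e : s - (u + (1 / 2 : ℝ) • s) = (1 / 2 : ℝ) • s - u := by module
  rw [e, norm_sub_sq_real, norm_add_sq_real, inner_smul_left, inner_smul_right, norm_smul,
    real_inner_comm]
  simp
  ring

lemma integral_gaussianFun_mul_windowedFourier {ψ : E → ℂ} (hψ : Integrable ψ) (x ξ : E) :
    ∫ u, gaussianFun π u * windowedFourier (gaussianFun π) ψ (x + u) ξ =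
      (∫ u : E, gaussianFun (2 * π) u) * windowedFourier (gaussianFun (π / 2)) ψ x ξ := by
  have hint : Integrable (Function.uncurry fun u s : E =>
      gaussianFun π u * (Complex.exp ((-2 * π * ⟪s, ξ⟫ : ℝ) * Complex.I) •
        (ψ s * gaussianFun π (s - (x + u))))) (volume.prod volume) := by
    have h1 := ((integrable_gaussianFun (E := E) Real.pi_pos).mul_prod hψ).bdd_mul
      (f := fun z : E × E => Complex.exp ((-2 * π * ⟪z.2, ξ⟫ : ℝ) * Complex.I) *
        gaussianFun π (z.2 - (x + z.1))) (c := 1)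
      (Continuous.aestronglyMeasurable (by fun_prop)) (ae_of_all _ fun z => by
        rw [norm_mul, Complex.norm_exp_ofReal_mul_I, one_mul]
        exact norm_gaussianFun_le_one Real.pi_pos.le _)
    refine h1.congr (ae_of_all _ fun z => ?_)
    simp only [Function.uncurry, smul_eq_mul]
    ring
  simp_rw [windowedFourier, Real.fourier_eq', ← integral_const_mul]
  rw [integral_integral_swap hint]
  congr with s
  have : ∀ u, gaussianFun π u * (Complex.exp ((-2 * π * ⟪s, ξ⟫ : ℝ) * Complex.I) •
      (ψ s * gaussianFun π (s - (x + u)))) = (Complex.exp ((-2 * π * ⟪s, ξ⟫ : ℝ) * Complex.I) *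
      ψ s) * (gaussianFun π u * gaussianFun π (s - x - u)) := by
    intro u; rw [sub_sub, smul_eq_mul]; ring
  simp_rw [this]
  rw [integral_const_mul, integral_gaussianFun_mul_gaussianFun, smul_eq_mul]
  ring

/-- Changing the window from `e^{-π|s|²}` to `e^{-π|s|²/2}` is bounded on `Lᵖ`. -/
lemma lintegral_windowedFourier_half_le {ψ : E → ℂ} (hψ : Integrable ψ) (hψm : Measurable ψ)
    {p : ℝ} (hp : 1 ≤ p) :
    ‖∫ u : E, gaussianFun (2 * π) u‖ₑ ^ p *
        ∫⁻ z : E × E, ‖windowedFourier (gaussianFun (π / 2)) ψ z.1 z.2‖ₑ ^ p ≤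
      ∫⁻ z : E × E, ‖windowedFourier (gaussianFun π) ψ z.1 z.2‖ₑ ^ p := by
  have hp0 : 0 ≤ p := by linarith
  have hm : ∀ a : ℝ, Measurable fun z : E × E =>
      ‖windowedFourier (gaussianFun a) ψ z.1 z.2‖ₑ :=
    fun a => (measurable_windowedFourier (continuous_gaussianFun a).measurable hψm).enorm
  have key (ξ : E) : ∫⁻ x, ‖∫ u : E, gaussianFun (2 * π) u‖ₑ ^ p *
      ‖windowedFourier (gaussianFun (π / 2)) ψ x ξ‖ₑ ^ p ≤
      ∫⁻ x, ‖windowedFourier (gaussianFun π) ψ x ξ‖ₑ ^ p := by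
    have hmξ : Measurable fun x : E => ‖windowedFourier (gaussianFun π) ψ x ξ‖ₑ := by
      have h := (hm π).comp (measurable_prodMk_right : Measurable fun x : E => (x, ξ))
      exact h
    have hY := lintegral_convolution_rpow_le (continuous_gaussianFun π).measurable.enorm hmξ hp
    rw [lintegral_enorm_gaussianFun Real.pi_pos, div_self Real.pi_ne_zero, Real.one_rpow,
      ENNReal.ofReal_one, ENNReal.one_rpow, one_mul] at hY
    refine (lintegral_mono fun x => ?_).trans hY
    rw [← ENNReal.mul_rpow_of_nonneg _ _ hp0, ← enorm_mul,
      ← integral_gaussianFun_mul_windowedFourier hψ]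
    refine ENNReal.rpow_le_rpow ((enorm_integral_le_lintegral_enorm _).trans (le_of_eq ?_)) hp0
    rw [← lintegral_neg_eq_self]
    simp_rw [enorm_mul, ← sub_eq_add_neg]
    congr with u
    simp [gaussianFun]
  rw [← lintegral_const_mul _ ((hm _).pow_const p)]
  rw [Measure.volume_eq_prod, lintegral_prod_symm _ (((hm _).pow_const p).const_mul _).aemeasurable,
    lintegral_prod_symm _ ((hm _).pow_const p).aemeasurable]
  exact lintegral_mono key

/-- Multiplication by a chirp is bounded on the windowed Fourier side, with a constant governed
by the `L¹` norm of the Fourier transform of a complex Gaussian. -/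
lemma exists_lintegral_windowedFourier_chirp_mul_le {p : ℝ} (hp : 1 < p) :
    ∃ C : ℝ, 0 < C ∧ ∀ (t : ℝ) (ψ : E → ℂ), Integrable ψ → Measurable ψ →
      ∫⁻ z : E × E, ‖windowedFourier (gaussianFun π) (fun s => chirp t s * ψ s) z.1 z.2‖ₑ ^ p ≤
        ENNReal.ofReal (C * (√(1 + (4 * π * t) ^ 2) ^ (Module.finrank ℝ E / 2 : ℝ)) ^ |p - 2|) *
          ∫⁻ z : E × E, ‖windowedFourier (gaussianFun π) ψ z.1 z.2‖ₑ ^ p := by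
  obtain ⟨C, hC, H⟩ := exists_lintegral_convolution_rpow_le (E := E) hp
  have hp0 : 0 < p := by linarith
  set c : ℝ := (π / (2 * π)) ^ (Module.finrank ℝ E / 2 : ℝ)
  have hc0 : 0 < c := by positivity
  have hcE : ‖∫ u : E, gaussianFun (2 * π) u‖ₑ ^ p = ENNReal.ofReal (c ^ p) := by
    rw [integral_gaussianFun (by positivity), ← ofReal_norm, Complex.norm_real,
      Real.norm_of_nonneg hc0.le, ENNReal.ofReal_rpow_of_nonneg hc0.le hp0.le]
  refine ⟨C * (c ^ p)⁻¹, by positivity, fun t ψ hψ hψm => ?_⟩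
  set b : ℂ := (π / 2 : ℝ) + (2 * π ^ 2 * t : ℝ) * Complex.I with hbdef
  have hbre : b.re = π / 2 := by
    rw [hbdef, Complex.add_re, Complex.ofReal_re, Complex.re_ofReal_mul, Complex.I_re, mul_zero,
      add_zero]
  have hb : 0 < b.re := by rw [hbre]; positivity
  have hbn : ‖b‖ / b.re = √(1 + (4 * π * t) ^ 2) := by
    rw [hbre, div_eq_iff (by positivity), hbdef, Complex.norm_add_mul_I, ← Real.sqrt_sq
      (show 0 ≤ π / 2 by positivity), ← Real.sqrt_mul (by positivity)]
    congr 1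
    rw [Real.sqrt_sq (by positivity)]
    ring
  set M : ℝ := √(1 + (4 * π * t) ^ 2) ^ (Module.finrank ℝ E / 2 : ℝ)
  have hM0 : 0 < M := by positivity
  have hm : ∀ a : ℝ, Measurable fun z : E × E =>
      ‖windowedFourier (gaussianFun a) ψ z.1 z.2‖ₑ :=
    fun a => (measurable_windowedFourier (continuous_gaussianFun a).measurable hψm).enorm
  have key : ∫⁻ z : E × E,
      ‖windowedFourier (gaussianFun π) (fun s => chirp t s * ψ s) z.1 z.2‖ₑ ^ p ≤
        ENNReal.ofReal (C * M ^ |p - 2|) *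
          ∫⁻ z : E × E, ‖windowedFourier (gaussianFun (π / 2)) ψ z.1 z.2‖ₑ ^ p := by
    rw [← lintegral_const_mul _ ((hm _).pow_const p), Measure.volume_eq_prod, lintegral_prod _
      ((measurable_windowedFourier (continuous_gaussianFun π).measurable
        (f := fun s => chirp t s * ψ s) ((continuous_chirp t).measurable.mul hψm)).enorm.pow_const
          p).aemeasurable,
      lintegral_prod _ (((hm _).pow_const p).const_mul _).aemeasurable]
    refine lintegral_mono fun x => ?_
    set v : E → ℂ := fun s => ψ (s + x) * gaussianFun (π / 2) s
    have hvi : Integrable v :=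
      (hψ.comp_add_right x).mul_bdd (c := 1) (continuous_gaussianFun _).aestronglyMeasurable
        (ae_of_all _ fun s => norm_gaussianFun_le_one (by positivity) s)
    have hvm : Measurable (𝓕 v) :=
      (VectorFourier.fourierIntegral_continuous Real.continuous_fourierChar
        (L := innerₗ E) continuous_inner hvi).measurable
    have h := H (𝓕 (gaussianSchwartz E b hb)) M hM0
      (by rw [lintegral_enorm_fourier_gaussianSchwartz, hbn])
      (fun y => by
        rw [fourier_fourier_apply, norm_gaussianSchwartz_apply, Real.exp_le_one_iff, neg_mul]
        exact neg_nonpos.2 (by positivity))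
      (𝓕 v) hvm ⟨_, norm_fourier_le_integral_norm v⟩
    rw [lintegral_const_mul' _ _ ENNReal.ofReal_ne_top]
    calc _ = ∫⁻ ξ, ‖∫ η, 𝓕 (gaussianSchwartz E b hb) η * 𝓕 v (ξ + (2 * π * t) • x - η)‖ₑ ^ p := by
          congr with ξ
          rw [← fourier_schwartz_mul _ hvi, ← ofReal_norm, ← ofReal_norm,
            norm_windowedFourier_chirp_mul]
      _ = ∫⁻ ξ, ‖∫ η, 𝓕 (gaussianSchwartz E b hb) η * 𝓕 v (ξ - η)‖ₑ ^ p :=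
          lintegral_add_right_eq_self (fun ξ => ‖∫ η, 𝓕 (gaussianSchwartz E b hb) η *
            𝓕 v (ξ - η)‖ₑ ^ p) _
      _ ≤ _ := h
      _ = _ := by
          congr with ξ
          rw [← ofReal_norm, ← ofReal_norm, norm_windowedFourier_eq_translate]
  have hw := lintegral_windowedFourier_half_le hψ hψm hp.le
  rw [hcE] at hw
  calc _ ≤ _ := key
    _ = ENNReal.ofReal (C * (c ^ p)⁻¹ * M ^ |p - 2|) * (ENNReal.ofReal (c ^ p) *
          ∫⁻ z : E × E, ‖windowedFourier (gaussianFun (π / 2)) ψ z.1 z.2‖ₑ ^ p) := by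
        rw [← mul_assoc, ← ENNReal.ofReal_mul (by positivity)]
        congr 2
        field_simp
    _ ≤ _ := mul_le_mul_right hw _

end UpperBound

section TimeFrequency

open FourierTransform SchwartzMap

variable {E : Type*} [NormedAddCommGroup E] [InnerProductSpace ℝ E] [FiniteDimensional ℝ E]
  [MeasurableSpace E] [BorelSpace E]

lemma fourier_gaussianFun_pi (w : E) : 𝓕 (gaussianFun π : E → ℂ) w = gaussianFun π w := by
  have h1 : (gaussianFun π : E → ℂ) = fun v => Complex.exp (-(π : ℂ) * (‖v‖ : ℂ) ^ 2) := by
    ext v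
    simp [gaussianFun]
  have hπ : (π : ℂ) ≠ 0 := by exact_mod_cast Real.pi_ne_zero
  conv_lhs => rw [h1]
  rw [fourier_gaussian_innerProductSpace (by simpa using Real.pi_pos), div_self hπ,
    Complex.one_cpow, one_mul, h1]
  congr 1
  field_simp

lemma norm_windowedFourier_fourierInv {ψ : E → ℂ} (hψ : Integrable ψ) (x ξ : E) :
    ‖windowedFourier (gaussianFun π) (𝓕⁻ ψ) x ξ‖ =
      ‖windowedFourier (gaussianFun π) ψ ξ (-x)‖ := by
  set w : E → ℂ := fun y => Complex.exp ((2 * π * ⟪y, ξ⟫ : ℝ) * Complex.I) *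
    gaussianFun π (y + x) with hw
  have hwi : Integrable w :=
    ((integrable_gaussianFun Real.pi_pos).comp_add_right x).bdd_mul (c := 1)
      (Continuous.aestronglyMeasurable (by fun_prop))
      (ae_of_all _ fun y => (Complex.norm_exp_ofReal_mul_I _).le)
  have hfw (s : E) : 𝓕 w s = Complex.exp ((2 * π * ⟪x, s - ξ⟫ : ℝ) * Complex.I) *
      gaussianFun π (s - ξ) := by
    rw [← fourier_gaussianFun_pi (s - ξ), Real.fourier_eq', Real.fourier_eq',
      ← integral_const_mul, ← integral_sub_right_eq_self _ x]
    congr with y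
    simp only [hw, smul_eq_mul, sub_add_cancel]
    rw [← mul_assoc, ← mul_assoc, ← Complex.exp_add, ← Complex.exp_add]
    congr 2
    simp only [inner_sub_left, inner_sub_right]
    push_cast
    ring
  have h : windowedFourier (gaussianFun π) (𝓕⁻ ψ) x ξ =
      Complex.exp ((-2 * π * ⟪x, ξ⟫ : ℝ) * Complex.I) *
        windowedFourier (gaussianFun π) ψ ξ (-x) := by
    calc _ = ∫ y, 𝓕 ψ y * w y := by
          rw [windowedFourier, Real.fourier_eq', ← integral_neg_eq_self]
          congr with y
          rw [Real.fourierInv_eq_fourier_neg, neg_neg, hw]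
          have : gaussianFun π (-y - x) = gaussianFun π (y + x) := by
            rw [gaussianFun, gaussianFun, ← norm_neg (y + x), neg_add']
          simp only [smul_eq_mul, this, inner_neg_left]
          rw [mul_left_comm]
          congr 4
          push_cast
          ring
      _ = ∫ s, ψ s * 𝓕 w s := integral_fourier_mul_eq hψ hwi
      _ = _ := by
          rw [windowedFourier, Real.fourier_eq', ← integral_const_mul]
          congr with s
          rw [hfw, smul_eq_mul, ← mul_assoc (Complex.exp _) (Complex.exp _), ← Complex.exp_add,
            mul_left_comm]
          congr 2
          rw [inner_neg_right, inner_sub_right, real_inner_comm]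
          push_cast
          ring
  rw [h, norm_mul, Complex.norm_exp_ofReal_mul_I, one_mul]

lemma lintegral_windowedFourier_fourierInv {ψ : E → ℂ} (hψ : Integrable ψ) (hψm : Measurable ψ)
    (p : ℝ) :
    ∫⁻ z : E × E, ‖windowedFourier (gaussianFun π) (𝓕⁻ ψ) z.1 z.2‖ₑ ^ p =
      ∫⁻ z : E × E, ‖windowedFourier (gaussianFun π) ψ z.1 z.2‖ₑ ^ p := by
  have hm : Measurable fun z : E × E => ‖windowedFourier (gaussianFun π) ψ z.1 z.2‖ₑ ^ p :=
    (measurable_windowedFourier (continuous_gaussianFun π).measurable hψm).enorm.pow_const p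
  have hm' := hm.comp (measurable_snd.prodMk measurable_fst.neg : Measurable
    fun z : E × E => (z.2, -z.1))
  simp only [Function.comp_def] at hm'
  simp_rw [← ofReal_norm, norm_windowedFourier_fourierInv hψ, ofReal_norm]
  rw [Measure.volume_eq_prod, lintegral_prod _ hm'.aemeasurable,
    lintegral_prod_symm _ hm.aemeasurable, ← lintegral_neg_eq_self]
  simp only [neg_neg]

/-- The windowed Fourier transform of a chirped Gaussian, in `Lᵖ`. -/
lemma exists_lintegral_windowedFourier_chirp_mul_gaussianFun {p : ℝ} (hp : 0 < p) :
    ∃ K : ℝ, 0 < K ∧ ∀ t : ℝ, ∫⁻ z : E × E,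
        ‖windowedFourier (gaussianFun π) (fun s => chirp t s * gaussianFun π s) z.1 z.2‖ₑ ^ p =
      ENNReal.ofReal (K * √(1 + (π * t) ^ 2) ^ (Module.finrank ℝ E * (1 - p / 2) : ℝ)) := by
  set n : ℝ := Nat.cast (Module.finrank ℝ E)
  refine ⟨(2 / p) ^ (n / 2) * ((1 / 2) ^ (n / 2 * p) * (2 / p) ^ (n / 2)), by positivity,
    fun t => ?_⟩
  set r := √(1 + (π * t) ^ 2) with hr
  have hr0 : 0 < r := by positivity
  set b : ℂ := (2 * π : ℝ) + (2 * π ^ 2 * t : ℝ) * Complex.I with hbdef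
  have hbre : b.re = 2 * π := by
    rw [hbdef, Complex.add_re, Complex.ofReal_re, Complex.re_ofReal_mul, Complex.I_re, mul_zero,
      add_zero]
  have hb : 0 < b.re := by rw [hbre]; positivity
  have hbn : ‖b‖ = 2 * π * r := by
    rw [hbdef, Complex.norm_add_mul_I, hr, ← Real.sqrt_sq (show 0 ≤ 2 * π by positivity),
      ← Real.sqrt_mul (by positivity)]
    congr 1
    rw [Real.sqrt_sq (by positivity)]
    ring
  have hpt (x ξ : E) :
      ‖windowedFourier (gaussianFun π) (fun s => chirp t s * gaussianFun π s) x ξ‖ₑ ^ p =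
        ENNReal.ofReal (Real.exp (-(p * π / 2) * ‖x‖ ^ 2)) *
          (ENNReal.ofReal ((1 / (2 * r)) ^ (n / 2 * p)) *
            ENNReal.ofReal (Real.exp (-(p * π / (2 * r ^ 2)) * ‖ξ + (π * t) • x‖ ^ 2))) := by
    have e1 : π / (2 * π * r) = 1 / (2 * r) := by field_simp
    have e2 : -(π / 2) * ‖x‖ ^ 2 * p = -(p * π / 2) * ‖x‖ ^ 2 := by ring
    have e3 : -(π ^ 2 * (2 * π) / (2 * π * r) ^ 2) * ‖ξ + (π * t) • x‖ ^ 2 * p =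
        -(p * π / (2 * r ^ 2)) * ‖ξ + (π * t) • x‖ ^ 2 := by field_simp
    rw [← ofReal_norm, ENNReal.ofReal_rpow_of_nonneg (norm_nonneg _) hp.le,
      norm_windowedFourier_chirp_mul_gaussianFun t x ξ hb, norm_fourier_gaussianSchwartz,
      Real.mul_rpow (by positivity) (by positivity), Real.mul_rpow (by positivity) (by positivity),
      ENNReal.ofReal_mul (by positivity), ENNReal.ofReal_mul (by positivity), ← Real.exp_mul,
      ← Real.exp_mul, ← Real.rpow_mul (by positivity), hbn, hbre, e1, e2, e3]
  have hm : Measurable fun z : E × E =>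
      ‖windowedFourier (gaussianFun π) (fun s => chirp t s * gaussianFun π s) z.1 z.2‖ₑ ^ p :=
    (measurable_windowedFourier (continuous_gaussianFun π).measurable (f := fun s =>
      chirp t s * gaussianFun π s) (Continuous.measurable (by fun_prop))).enorm.pow_const p
  rw [Measure.volume_eq_prod, lintegral_prod _ hm.aemeasurable]
  simp only [hpt]
  have hin (x : E) : ∫⁻ ξ : E, ENNReal.ofReal (Real.exp (-(p * π / 2) * ‖x‖ ^ 2)) *
          (ENNReal.ofReal ((1 / (2 * r)) ^ (n / 2 * p)) *
            ENNReal.ofReal (Real.exp (-(p * π / (2 * r ^ 2)) * ‖ξ + (π * t) • x‖ ^ 2))) =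
      ENNReal.ofReal (Real.exp (-(p * π / 2) * ‖x‖ ^ 2)) *
        (ENNReal.ofReal ((1 / (2 * r)) ^ (n / 2 * p)) *
          ENNReal.ofReal ((π / (p * π / (2 * r ^ 2))) ^ (n / 2))) := by
    rw [lintegral_const_mul' _ _ ENNReal.ofReal_ne_top,
      lintegral_const_mul' _ _ ENNReal.ofReal_ne_top, lintegral_add_right_eq_self (fun ξ : E =>
        ENNReal.ofReal (Real.exp (-(p * π / (2 * r ^ 2)) * ‖ξ‖ ^ 2))),
      lintegral_exp_neg_mul_norm_sq (by positivity)]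
  simp_rw [hin]
  rw [lintegral_mul_const' _ _ (by finiteness), lintegral_exp_neg_mul_norm_sq (by positivity),
    ← ENNReal.ofReal_mul (by positivity), ← ENNReal.ofReal_mul (by positivity)]
  have e1 : π / (p * π / 2) = 2 / p := by field_simp
  have e2 : π / (p * π / (2 * r ^ 2)) = 2 / p * r ^ 2 := by field_simp
  have e3 : 1 / (2 * r) = 1 / 2 * r⁻¹ := by field_simp
  rw [e1, e2, e3, Real.mul_rpow (by positivity) (by positivity),
    Real.mul_rpow (by positivity) (by positivity), ← Real.rpow_natCast r 2,
    ← Real.rpow_mul hr0.le, ← Real.rpow_neg_one, ← Real.rpow_mul hr0.le,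
    show n * (1 - p / 2) = -1 * (n / 2 * p) + (2 : ℕ) * (n / 2) by push_cast; ring,
    Real.rpow_add hr0]
  congr 1
  ring

end TimeFrequency

section FreePropagator

open FourierTransform SchwartzMap

variable {d : ℕ}

lemma STFT_eq_windowedFourier (f : EuclideanSpace ℝ (Fin d) → ℂ)
    (x ξ : EuclideanSpace ℝ (Fin d)) :
    STFT f x ξ = windowedFourier (gaussianFun π) f x ξ := by
  rw [STFT, windowedFourier, Real.fourier_eq']
  congr with s
  rw [smul_eq_mul, ← mul_assoc, real_inner_comm]
  congr 3
  push_cast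
  ring

lemma MpNorm_fourierInv {p : ℝ} (hp : 0 < p) {ψ : EuclideanSpace ℝ (Fin d) → ℂ}
    (hψ : Integrable ψ) (hψm : Measurable ψ) :
    MpNorm p (𝓕⁻ ψ) = (∫⁻ z : EuclideanSpace ℝ (Fin d) × EuclideanSpace ℝ (Fin d),
      ‖windowedFourier (gaussianFun π) ψ z.1 z.2‖ₑ ^ p) ^ (1 / p) := by
  rw [MpNorm, eLpNorm_eq_lintegral_rpow_enorm_toReal (by simpa using hp) ENNReal.ofReal_ne_top,
    ENNReal.toReal_ofReal hp.le]
  simp_rw [STFT_eq_windowedFourier]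
  rw [lintegral_windowedFourier_fourierInv hψ hψm]

lemma freeProp_eq_fourierInv (t : ℝ) (φ : 𝓢(EuclideanSpace ℝ (Fin d), ℂ)) :
    freeProp t φ = 𝓕⁻ (fun ξ => chirp t ξ * 𝓕 φ ξ) := by
  ext x
  rw [freeProp, Real.fourierInv_eq']
  congr with ξ
  rw [fourier_coe, Real.fourier_eq', smul_eq_mul, real_inner_comm, chirp]
  congr 3
  ext y
  rw [smul_eq_mul, real_inner_comm]
  congr 2
  push_cast
  ring

lemma MpNorm_freeProp {p : ℝ} (hp : 0 < p) (t : ℝ) (φ : 𝓢(EuclideanSpace ℝ (Fin d), ℂ)) :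
    MpNorm p (freeProp t φ) = (∫⁻ z : EuclideanSpace ℝ (Fin d) × EuclideanSpace ℝ (Fin d),
      ‖windowedFourier (gaussianFun π) (fun s => chirp t s * 𝓕 φ s) z.1 z.2‖ₑ ^ p) ^ (1 / p) := by
  rw [freeProp_eq_fourierInv]
  refine MpNorm_fourierInv hp ?_ ?_
  · exact (𝓕 φ).integrable.bdd_mul (c := 1) (continuous_chirp t).aestronglyMeasurable
      (ae_of_all _ fun s => (norm_chirp t s).le)
  · exact (continuous_chirp t).measurable.mul (𝓕 φ).continuous.measurable

lemma MpNorm_schwartz {p : ℝ} (hp : 0 < p) (φ : 𝓢(EuclideanSpace ℝ (Fin d), ℂ)) :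
    MpNorm p (fun x => φ x) = (∫⁻ z : EuclideanSpace ℝ (Fin d) × EuclideanSpace ℝ (Fin d),
      ‖windowedFourier (gaussianFun π) (𝓕 φ : 𝓢(EuclideanSpace ℝ (Fin d), ℂ)) z.1 z.2‖ₑ ^ p) ^
        (1 / p) := by
  have h : (𝓕⁻ (𝓕 φ) : 𝓢(EuclideanSpace ℝ (Fin d), ℂ)) = 𝓕⁻ (fun ξ => 𝓕 φ ξ) := fourierInv_coe _
  rw [fourierInv_fourier_eq] at h
  rw [h, MpNorm_fourierInv hp (𝓕 φ).integrable (𝓕 φ).continuous.measurable]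

lemma exists_MpNorm_freeProp_le {p : ℝ} (hp : 1 < p) :
    ∃ C : ℝ, 0 < C ∧ ∀ (t : ℝ) (φ : 𝓢(EuclideanSpace ℝ (Fin d), ℂ)),
      MpNorm p (freeProp t φ) ≤
        ENNReal.ofReal (C * (1 + |t|) ^ ((d : ℝ) * |1 / 2 - 1 / p|)) * MpNorm p (fun x => φ x) := by
  have hp0 : 0 < p := by linarith
  obtain ⟨C, hC, H⟩ :=
    exists_lintegral_windowedFourier_chirp_mul_le (E := EuclideanSpace ℝ (Fin d)) hp
  set α : ℝ := (d : ℝ) * |1 / 2 - 1 / p|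
  refine ⟨C ^ (1 / p) * (4 * π) ^ α, by positivity, fun t φ => ?_⟩
  have h := ENNReal.rpow_le_rpow (H t (𝓕 φ : 𝓢(EuclideanSpace ℝ (Fin d), ℂ))
    (𝓕 φ).integrable (𝓕 φ).continuous.measurable)
    (show 0 ≤ 1 / p by positivity)
  rw [MpNorm_freeProp hp0, MpNorm_schwartz hp0]
  refine h.trans ?_
  rw [ENNReal.mul_rpow_of_nonneg _ _ (by positivity),
    ENNReal.ofReal_rpow_of_nonneg (by positivity) (by positivity)]
  gcongr
  have hα : (d / 2 : ℝ) * |p - 2| * (1 / p) = α := by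
    have : |1 / 2 - 1 / p| = |p - 2| / (2 * p) := by
      rw [show 1 / 2 - 1 / p = (p - 2) / (2 * p) by field_simp, abs_div,
        abs_of_pos (show 0 < 2 * p by positivity)]
    simp only [α, this]
    field_simp
  rw [Real.mul_rpow (by positivity) (by positivity), finrank_euclideanSpace_fin,
    ← Real.rpow_mul (by positivity), ← Real.rpow_mul (by positivity), ← mul_assoc, hα,
    mul_assoc (C ^ (1 / p)),
    ← Real.mul_rpow (by positivity) (by positivity)]
  gcongr
  rw [Real.sqrt_le_left (by positivity), ← sq_abs (4 * π * t), abs_mul,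
    abs_of_pos (show 0 < 4 * π by positivity)]
  nlinarith [mul_nonneg (sq_nonneg (4 * π)) (abs_nonneg t), Real.pi_gt_three]

/-- The inverse Fourier transforms of the chirped Gaussians are extremal for the growth of the
free propagator. -/
lemma exists_le_MpNorm_freeProp {p : ℝ} (hp : 1 < p) :
    ∃ c : ℝ, 0 < c ∧ ∀ t : ℝ, ∃ φ : 𝓢(EuclideanSpace ℝ (Fin d), ℂ), φ ≠ 0 ∧
      ENNReal.ofReal (c * (1 + |t|) ^ ((d : ℝ) * |1 / 2 - 1 / p|)) * MpNorm p (fun x => φ x) ≤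
        MpNorm p (freeProp t φ) := by
  have hp0 : 0 < p := by linarith
  obtain ⟨K, hK, hJ⟩ := exists_lintegral_windowedFourier_chirp_mul_gaussianFun
    (E := EuclideanSpace ℝ (Fin d)) hp0
  rw [finrank_euclideanSpace_fin] at hJ
  have hb (u : ℝ) : 0 < (π + (2 * π ^ 2 * u : ℝ) * Complex.I : ℂ).re := by
    rw [Complex.add_re, Complex.ofReal_re, Complex.re_ofReal_mul, Complex.I_re, mul_zero,
      add_zero]
    exact Real.pi_pos
  let Φ (u : ℝ) : 𝓢(EuclideanSpace ℝ (Fin d), ℂ) :=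
    𝓕⁻ (gaussianSchwartz (EuclideanSpace ℝ (Fin d)) _ (hb u))
  have hΦ (u : ℝ) : 𝓕 (Φ u) = gaussianSchwartz (EuclideanSpace ℝ (Fin d)) _ (hb u) :=
    fourier_fourierInv_eq _
  have hchirp (t u : ℝ) : (fun s : EuclideanSpace ℝ (Fin d) => chirp t s * 𝓕 (Φ u) s) =
      fun s => chirp (t + u) s * gaussianFun π s := by
    ext s
    rw [hΦ, gaussianSchwartz_apply, chirp, chirp, gaussianFun, Complex.ofReal_exp,
      ← Complex.exp_add, ← Complex.exp_add]
    congr 1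
    push_cast
    ring
  have hchirp' (u : ℝ) :
      ((𝓕 (Φ u) : 𝓢(EuclideanSpace ℝ (Fin d), ℂ)) : EuclideanSpace ℝ (Fin d) → ℂ) =
        fun s => chirp u s * gaussianFun π s := by
    have := hchirp 0 u
    simpa [chirp] using this
  have hΦ0 (u : ℝ) : Φ u ≠ 0 := by
    intro h
    have h0 := congrFun (hchirp' u) 0
    rw [h, FourierTransform.fourier_zero] at h0
    simp [chirp, gaussianFun] at h0
  set J : ℝ → ℝ := fun t => K * √(1 + (π * t) ^ 2) ^ (d * (1 - p / 2) : ℝ) with hJdef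
  have hJ0 (t : ℝ) : 0 ≤ J t := by positivity
  have hnorm (u : ℝ) : MpNorm p (fun x => Φ u x) = ENNReal.ofReal (J u ^ (1 / p)) := by
    rw [MpNorm_schwartz hp0, hchirp', hJ, ENNReal.ofReal_rpow_of_nonneg (hJ0 u) (by positivity)]
  have hprop (t u : ℝ) : MpNorm p (freeProp t (Φ u)) = ENNReal.ofReal (J (t + u) ^ (1 / p)) := by
    rw [MpNorm_freeProp hp0, hchirp, hJ, ENNReal.ofReal_rpow_of_nonneg (hJ0 _) (by positivity)]
  have hJp (t : ℝ) : J t ^ (1 / p) =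
      K ^ (1 / p) * √(1 + (π * t) ^ 2) ^ (d * (1 / p - 1 / 2) : ℝ) := by
    rw [hJdef, Real.mul_rpow hK.le (by positivity), ← Real.rpow_mul (by positivity)]
    congr 2
    field_simp
  set α : ℝ := (d : ℝ) * |1 / 2 - 1 / p| with hα
  have hle (t : ℝ) : (1 / 2) ^ α * (1 + |t|) ^ α ≤ √(1 + (π * t) ^ 2) ^ α := by
    rw [← Real.mul_rpow (by positivity) (by positivity)]
    gcongr
    refine Real.le_sqrt_of_sq_le ?_
    have h1 : t ^ 2 ≤ (π * t) ^ 2 := by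
      rw [mul_pow]
      exact le_mul_of_one_le_left (sq_nonneg t) (one_le_pow₀ (by linarith [Real.pi_gt_three]))
    nlinarith [sq_abs t, sq_nonneg (|t| - 1)]
  refine ⟨(1 / 2) ^ α, by positivity, fun t => ?_⟩
  rcases le_total p 2 with h2 | h2
  · refine ⟨Φ 0, hΦ0 0, ?_⟩
    rw [hnorm, hprop, ← ENNReal.ofReal_mul (by positivity), hJp, hJp]
    refine ENNReal.ofReal_le_ofReal ?_
    have hα' : (d * (1 / p - 1 / 2) : ℝ) = α := by
      rw [hα, abs_of_nonpos (sub_nonpos.2 (one_div_le_one_div_of_le hp0 h2)), neg_sub]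
    rw [hα']
    simp only [mul_zero, add_zero, ne_eq, OfNat.ofNat_ne_zero, not_false_eq_true, zero_pow,
      Real.sqrt_one, Real.one_rpow, mul_one]
    rw [mul_comm]
    gcongr
    exact hle t
  · refine ⟨Φ (-t), hΦ0 _, ?_⟩
    rw [hnorm, hprop, ← ENNReal.ofReal_mul (by positivity), hJp, hJp]
    refine ENNReal.ofReal_le_ofReal ?_
    have hα' : (d * (1 / p - 1 / 2) : ℝ) = -α := by
      rw [hα, abs_of_nonneg (sub_nonneg.2 (one_div_le_one_div_of_le two_pos h2))]
      ring
    rw [hα', Real.rpow_neg (by positivity), ← div_eq_mul_inv, ← mul_div_assoc,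
      div_le_iff₀ (by positivity)]
    simp only [mul_zero, add_neg_cancel, ne_eq, OfNat.ofNat_ne_zero, not_false_eq_true, zero_pow,
      add_zero, Real.sqrt_one, Real.one_rpow, mul_one, mul_neg, even_two, Even.neg_pow]
    rw [mul_comm]
    gcongr
    exact hle t

end FreePropagator

/-- **Sharp bounds for the free Schrödinger propagator on modulation spaces**: for
`1 < p < ∞`, the operator norm of `U₀(t) = e^{itΔ/2}` on `M^p(ℝ^d)` is comparable to
`(1+|t|)^{d|1/2-1/p|}`, uniformly in `t ∈ ℝ`. -/
theorem free_propagator_modulation_norm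
    {d : ℕ} (hd : 1 ≤ d) (p : ℝ) (hp : 1 < p) :
    ∃ c C : ℝ, 0 < c ∧ 0 < C ∧ ∀ t : ℝ,
      (∀ φ : SchwartzMap (EuclideanSpace ℝ (Fin d)) ℂ,
        MpNorm p (freeProp t φ) ≤
          ENNReal.ofReal (C * (1 + |t|) ^ ((d : ℝ) * |1 / 2 - 1 / p|)) *
            MpNorm p (fun x => φ x)) ∧
      (∃ φ : SchwartzMap (EuclideanSpace ℝ (Fin d)) ℂ, φ ≠ 0 ∧
        ENNReal.ofReal (c * (1 + |t|) ^ ((d : ℝ) * |1 / 2 - 1 / p|)) *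
            MpNorm p (fun x => φ x) ≤ MpNorm p (freeProp t φ)) := by
  obtain ⟨C, hC, hupper⟩ := exists_MpNorm_freeProp_le (d := d) hp
  obtain ⟨c, hc, hlower⟩ := exists_le_MpNorm_freeProp (d := d) hp
  exact ⟨c, C, hc, hC, fun t => ⟨hupper t, hlower t⟩⟩
end
end

section
/- Let V : ℝ^d → ℝ be a bounded measurable real-valued function. For t ∈ ℝ and n ≥ 1 define the Trotter approximation E_n(t) = ( U₀(t/n) ∘ M_{t/n} )^n, a unitary operator on L²(ℝ^d). Then for every t ∈ ℝ and every φ ∈ L²(ℝ^d), the sequence ( E_n(t)φ )_{n ≥ 1} converges in L²(ℝ^d) as n → ∞. (Trotter product formula for the Schrödinger propagator e^{−it(−Δ/2 + V)} with a bounded potential.) -/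
open MeasureTheory Real Filter Topology
open scoped RealInnerProductSpace ENNReal

noncomputable section

section StronglyContinuousLinearODE

variable {X : Type*} [NormedAddCommGroup X] [NormedSpace ℝ X]

theorem continuous_apply_of_strong {G : ℝ → X →L[ℝ] X} {K : ℝ}
    (hG : ∀ x, Continuous fun s => G s x) (hK : ∀ s, ‖G s‖ ≤ K) {y : ℝ → X} (hy : Continuous y) :
    Continuous fun s => G s (y s) := by
  refine continuous_iff_continuousAt.2 fun s₀ => ?_
  have h₁ : Tendsto (fun s => G s (y s - y s₀)) (𝓝 s₀) (𝓝 0) := by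
    refine squeeze_zero_norm (fun s => (G s).le_of_opNorm_le (hK s) _) ?_
    have : Continuous fun s => K * ‖y s - y s₀‖ := by fun_prop
    simpa using this.tendsto s₀
  simpa [ContinuousAt] using h₁.add ((hG (y s₀)).tendsto s₀)

/-- The terms of the Dyson series of the linear equation `y' = G s y`, `y 0 = x`. -/
def dysonTerm (G : ℝ → X →L[ℝ] X) (x : X) : ℕ → ℝ → X
  | 0, _ => x
  | n + 1, s => ∫ r in (0 : ℝ)..s, G r (dysonTerm G x n r)

variable {G : ℝ → X →L[ℝ] X} {K : ℝ}

theorem norm_dysonTerm_le (hK : ∀ s, ‖G s‖ ≤ K) (x : X) (n : ℕ) (s : ℝ) :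
    ‖dysonTerm G x n s‖ ≤ (K * |s|) ^ n / n.factorial * ‖x‖ := by
  have hK₀ : 0 ≤ K := (norm_nonneg _).trans (hK 0)
  induction n generalizing s with
  | zero => simp [dysonTerm]
  | succ n ih =>
    calc ‖dysonTerm G x (n + 1) s‖
        ≤ ∫ r in Set.uIoc 0 s, ‖G r (dysonTerm G x n r)‖ :=
          intervalIntegral.norm_integral_le_integral_norm_uIoc
      _ ≤ ∫ r in Set.uIoc 0 s, (K ^ (n + 1) / n.factorial * ‖x‖) * |r - 0| ^ n := by
          refine integral_mono_of_nonneg (Eventually.of_forall fun _ => norm_nonneg _) ?_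
            (Eventually.of_forall fun r => ?_)
          · refine Continuous.integrableOn_uIoc ?_
            fun_prop
          · refine ((G r).le_of_opNorm_le_of_le (hK r) (ih r)).trans_eq ?_
            simp only [sub_zero]
            ring
      _ = (K * |s|) ^ (n + 1) / (n + 1).factorial * ‖x‖ := by
          rw [integral_const_mul, integral_pow_abs_sub_uIoc, Nat.factorial_succ]
          push_cast
          have : (n.factorial : ℝ) ≠ 0 := by positivity
          have : (n + 1 : ℝ) ≠ 0 := by positivity
          simp only [sub_zero, mul_pow]
          field_simp

theorem hasDerivAt_dysonTerm_succ [CompleteSpace X] (hG : ∀ x, Continuous fun s => G s x)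
    (hK : ∀ s, ‖G s‖ ≤ K) (x : X) (n : ℕ) (s : ℝ) :
    HasDerivAt (dysonTerm G x (n + 1)) (G s (dysonTerm G x n s)) s := by
  have key : ∀ n, Continuous (dysonTerm G x n) → ∀ s,
      HasDerivAt (dysonTerm G x (n + 1)) (G s (dysonTerm G x n s)) s := fun n hn s =>
    have hc := continuous_apply_of_strong hG hK hn
    intervalIntegral.integral_hasDerivAt_right (hc.intervalIntegrable _ _)
      (hc.stronglyMeasurableAtFilter _ _) hc.continuousAt
  refine key n ?_ s
  induction n with
  | zero => exact continuous_const
  | succ n ih => exact continuous_iff_continuousAt.2 fun s => (key n ih s).continuousAt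

/-- Global solvability of `y' = G s y` for a bounded, strongly continuous family `G`. -/
theorem exists_hasDerivAt_linear [CompleteSpace X] (hG : ∀ x, Continuous fun s => G s x)
    (hK : ∀ s, ‖G s‖ ≤ K) (x : X) :
    ∃ y : ℝ → X, y 0 = x ∧ ∀ s, HasDerivAt y (G s (y s)) s := by
  have hK₀ : 0 ≤ K := (norm_nonneg _).trans (hK 0)
  have hsum (s : ℝ) : Summable fun n => dysonTerm G x n s :=
    .of_norm_bounded ((Real.summable_pow_div_factorial (K * |s|)).mul_right ‖x‖)
      fun n => norm_dysonTerm_le hK x n s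
  refine ⟨fun s => x + ∑' n, dysonTerm G x (n + 1) s, ?_, fun s => ?_⟩
  · simp [dysonTerm]
  · have hy : x + ∑' n, dysonTerm G x (n + 1) s = ∑' n, dysonTerm G x n s :=
      ((hsum s).tsum_eq_zero_add).symm
    beta_reduce
    rw [hy, (G s).map_tsum (hsum s)]
    refine HasDerivAt.const_add x ?_
    have hs : s ∈ Metric.ball (0 : ℝ) (|s| + 1) := by simp
    have hu : Summable fun n : ℕ => K * ((K * (|s| + 1)) ^ n / n.factorial * ‖x‖) :=
      ((Real.summable_pow_div_factorial (K * (|s| + 1))).mul_right ‖x‖).mul_left K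
    refine hasDerivAt_tsum_of_isPreconnected hu Metric.isOpen_ball
      (convex_ball _ _).isPreconnected
      (g := fun n => dysonTerm G x (n + 1)) (g' := fun n r => G r (dysonTerm G x n r)) (y₀ := s)
      (fun n r _ => hasDerivAt_dysonTerm_succ hG hK x n r) (fun n r hr => ?_) hs
      ((summable_nat_add_iff 1).2 (hsum s)) hs
    refine (G r).le_of_opNorm_le_of_le (hK r) ((norm_dysonTerm_le hK x n r).trans ?_)
    have : |r| ≤ |s| + 1 := by simpa using (Metric.mem_ball.1 hr).le
    gcongr

/-- One-step estimate for the explicit Euler scheme, uniform on `[0, 1]`. -/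
theorem exists_forall_norm_sub_sub_smul_le {y y' : ℝ → X} (hy : ∀ s, HasDerivAt y (y' s) s)
    (hy' : Continuous y') {ε : ℝ} (hε : 0 < ε) :
    ∃ δ > 0, ∀ s h, 0 ≤ s → 0 ≤ h → h < δ → s + h ≤ 1 →
      ‖y (s + h) - y s - h • y' s‖ ≤ ε * h := by
  have huc : UniformContinuousOn y' (Set.Icc 0 1) :=
    isCompact_Icc.uniformContinuousOn_of_continuous hy'.continuousOn
  obtain ⟨δ, hδ, H⟩ := Metric.uniformContinuousOn_iff.1 huc ε hε
  refine ⟨δ, hδ, fun s h hs hh hhδ hsh => ?_⟩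
  have := norm_image_sub_le_of_norm_deriv_le_segment' (a := s) (b := s + h) (C := ε)
    (f := fun r => y r - r • y' s) (f' := fun r => y' r - (1 : ℝ) • y' s)
    (fun r _ => ((hy r).sub ((hasDerivAt_id r).smul_const (y' s))).hasDerivWithinAt)
    (fun r hr => ?_) (s + h) (Set.right_mem_Icc.2 (by linarith))
  · calc _ = ‖y (s + h) - (s + h) • y' s - (y s - s • y' s)‖ := by congr 1; module
      _ ≤ _ := this
      _ = ε * h := by ring
  · rw [one_smul, ← dist_eq_norm]
    refine (H r ⟨by linarith [hr.1], by linarith [hr.2]⟩ s ⟨hs, by linarith⟩ ?_).le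
    rw [Real.dist_eq, abs_of_nonneg (by linarith [hr.1])]
    linarith [hr.2]

/-- Convergence of a stable and consistent one-step scheme for `y' = G s y` on `[0, 1]`. -/
theorem tendsto_one_step_scheme (hG : ∀ x, Continuous fun s => G s x) (hK : ∀ s, ‖G s‖ ≤ K)
    {y : ℝ → X} (hy : ∀ s, HasDerivAt y (G s (y s)) s)
    {P : ℝ → ℝ → X → X} {C : ℝ} (hC : 0 ≤ C)
    (hP : ∀ h s x x', ‖P h s x - P h s x'‖ ≤ ‖x - x'‖)
    (hPG : ∀ h s x, ‖P h s x - x - h • G s x‖ ≤ C * h ^ 2 * ‖x‖)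
    {z : ℕ → ℕ → X} (hz₀ : ∀ n, z n 0 = y 0)
    (hz : ∀ n k, z n (k + 1) = P (1 / n) (k / n) (z n k)) :
    Tendsto (fun n => z n n) atTop (𝓝 (y 1)) := by
  have hyc : Continuous y := continuous_iff_continuousAt.2 fun s => (hy s).continuousAt
  obtain ⟨D, hD⟩ := (isCompact_Icc (a := (0 : ℝ)) (b := 1)).exists_bound_of_continuousOn
    hyc.continuousOn
  have hD₀ : 0 ≤ D := (norm_nonneg _).trans (hD 0 (by simp))
  refine Metric.tendsto_atTop'.2 fun ε hε => ?_
  obtain ⟨δ, hδ, H⟩ := exists_forall_norm_sub_sub_smul_le hy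
    (continuous_apply_of_strong hG hK hyc) (half_pos hε)
  have hlim (c : ℝ) : Tendsto (fun n : ℕ => c * (1 / (n : ℝ))) atTop (𝓝 0) := by
    simpa using tendsto_one_div_atTop_nhds_zero_nat.const_mul c
  obtain ⟨N, hN⟩ := eventually_atTop.1 (((hlim 1).eventually_lt_const hδ).and
    (((hlim (C * D)).eventually_lt_const (half_pos hε)).and (eventually_gt_atTop 0)))
  refine ⟨N, fun n hn => ?_⟩
  obtain ⟨hnδ, hnε, hn₀⟩ := hN n hn.le
  have hn' : (0 : ℝ) < n := by exact_mod_cast hn₀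
  rw [one_mul] at hnδ
  set h : ℝ := 1 / n with hh
  have hh₀ : 0 < h := by positivity
  have hnh : n * h = 1 := by rw [hh]; field_simp
  have err (k : ℕ) (hk : k ≤ n) :
      ‖z n k - y (k / n)‖ ≤ k * (ε / 2 * h + C * h ^ 2 * D) := by
    induction k with
    | zero => simp [hz₀]
    | succ k ih =>
      have hk' : (k : ℝ) + 1 ≤ n := by exact_mod_cast hk
      have hs₀ : 0 ≤ (k : ℝ) / n := by positivity
      have hstep : (k : ℝ) / n + h = ((k + 1 : ℕ) : ℝ) / n := by rw [hh]; push_cast; ring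
      have hs₁ : (k : ℝ) / n + h ≤ 1 := by
        rw [hstep, div_le_one hn']
        exact_mod_cast hk
      set s : ℝ := (k : ℝ) / n
      have h₁ := (hP h s (z n k) (y s)).trans (ih (by omega))
      have h₂ : ‖P h s (y s) - y s - h • G s (y s)‖ ≤ C * h ^ 2 * D :=
        (hPG h s (y s)).trans (by gcongr; exact hD s ⟨hs₀, by linarith⟩)
      have h₃ := H s h hs₀ hh₀.le hnδ hs₁
      rw [hz, ← hstep]
      calc ‖P h s (z n k) - y (s + h)‖
          = ‖(P h s (z n k) - P h s (y s)) + (P h s (y s) - y s - h • G s (y s))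
              - (y (s + h) - y s - h • G s (y s))‖ := by congr 1; abel
        _ ≤ k * (ε / 2 * h + C * h ^ 2 * D) + C * h ^ 2 * D + ε / 2 * h :=
            (norm_sub_le _ _).trans (add_le_add ((norm_add_le _ _).trans (add_le_add h₁ h₂)) h₃)
        _ = _ := by push_cast; ring
  have := err n le_rfl
  rw [div_self hn'.ne'] at this
  rw [dist_eq_norm]
  calc ‖z n n - y 1‖ ≤ n * (ε / 2 * h + C * h ^ 2 * D) := this
    _ = (n * h) * (ε / 2 + C * D * h) := by ring
    _ < ε := by rw [hnh]; linarith

/-- **Trotter product formula** for a strongly continuous group of isometries `U` and a family of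
isometries `M` that is differentiable at `0` in operator norm with derivative `B`. -/
theorem exists_tendsto_trotter [CompleteSpace X] {U M : ℝ → X →L[ℝ] X} {B : X →L[ℝ] X} {C : ℝ}
    (hC : 0 ≤ C) (hU₀ : ∀ x, U 0 x = x) (hU : ∀ a b x, U (a + b) x = U a (U b x))
    (hUnorm : ∀ a x, ‖U a x‖ = ‖x‖) (hUc : ∀ x, Continuous fun a => U a x)
    (hMnorm : ∀ a x, ‖M a x‖ = ‖x‖)
    (hMB : ∀ a x, ‖M a x - x - a • B x‖ ≤ C * a ^ 2 * ‖x‖) (t : ℝ) (x : X) :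
    ∃ y, Tendsto (fun n : ℕ => (fun v => U (t / n) (M (t / n) v))^[n] x) atTop (𝓝 y) := by
  have hUn (a : ℝ) : ‖U a‖ ≤ 1 := (U a).opNorm_le_bound zero_le_one (by simp [hUnorm])
  have hinv (a : ℝ) (v : X) : U (-a) (U a v) = v := by rw [← hU, neg_add_cancel, hU₀]
  let G : ℝ → X →L[ℝ] X := fun s => t • (U (-(t * s))).comp (B.comp (U (t * s)))
  have hGapp (s : ℝ) (v : X) : G s v = t • U (-(t * s)) (B (U (t * s) v)) := rfl
  have hGc (v : X) : Continuous fun s => G s v := by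
    have h₁ : Continuous fun s => B (U (t * s) v) :=
      B.continuous.comp ((hUc v).comp (continuous_const.mul continuous_id))
    have h₂ (w : X) : Continuous fun s => U (-(t * s)) w :=
      (hUc w).comp (continuous_const.mul continuous_id).neg
    exact (continuous_apply_of_strong h₂ (fun s => hUn _) h₁).const_smul t
  have hGK (s : ℝ) : ‖G s‖ ≤ |t| * ‖B‖ := by
    refine ContinuousLinearMap.opNorm_le_bound _ (by positivity) fun v => ?_
    rw [hGapp, norm_smul, hUnorm, Real.norm_eq_abs, mul_assoc]
    gcongr
    exact (B.le_opNorm _).trans_eq (by rw [hUnorm])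
  obtain ⟨y, hy₀, hy⟩ := exists_hasDerivAt_linear hGc hGK x
  let P : ℝ → ℝ → X → X := fun h s v => U (-(t * s)) (M (t * h) (U (t * s) v))
  let z : ℕ → ℕ → X := fun n k =>
    U (-(t * (k / n))) ((fun v => U (t / n) (M (t / n) v))^[k] x)
  have hlim : Tendsto (fun n => z n n) atTop (𝓝 (y 1)) := by
    refine tendsto_one_step_scheme (P := P) (C := C * t ^ 2) hGc hGK hy (by positivity)
      (fun h s v w => ?_) (fun h s v => ?_) (fun n => ?_) (fun n k => ?_)
    · simp only [P]
      rw [← map_sub, ← map_sub, ← map_sub, hUnorm, hMnorm, hUnorm]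
    · have : P h s v - v - h • G s v = U (-(t * s))
          (M (t * h) (U (t * s) v) - U (t * s) v - (t * h) • B (U (t * s) v)) := by
        simp only [P, hGapp, map_sub, map_smul, hinv, smul_smul, mul_comm h t]
      rw [this, hUnorm]
      refine (hMB _ _).trans_eq ?_
      rw [hUnorm]
      ring
    · simp [z, hU₀, hy₀]
    · simp only [P, z, Function.iterate_succ_apply']
      have h₁ (w : X) : U (t * (k / n)) (U (-(t * (k / n))) w) = w := by
        simpa using hinv (-(t * (k / n))) w
      rw [h₁, ← hU, mul_one_div]
      congr 3
      push_cast
      ring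
  refine ⟨U t (y 1), (((U t).continuous.tendsto _).comp hlim).congr' ?_⟩
  filter_upwards [eventually_gt_atTop 0] with n hn
  have : (n : ℝ) ≠ 0 := by positivity
  simp only [Function.comp_apply, z, div_self this, mul_one]
  simpa using hinv (-t) _

end StronglyContinuousLinearODE

section Multiplication

theorem norm_exp_neg_ofReal_mul_I_sub_le (a : ℝ) :
    ‖Complex.exp (-((a : ℂ) * Complex.I)) - 1 + a * Complex.I‖ ≤ 3 * a ^ 2 := by
  rcases le_total |a| 1 with h | h
  · have := Complex.norm_exp_sub_one_sub_id_le (x := -((a : ℂ) * Complex.I)) (by simpa using h)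
    rw [sub_neg_eq_add] at this
    refine this.trans ?_
    simp only [norm_neg, norm_mul, Complex.norm_real, Complex.norm_I, mul_one, Real.norm_eq_abs,
      sq_abs]
    nlinarith [sq_nonneg a]
  · have h₁ : ‖Complex.exp (-((a : ℂ) * Complex.I))‖ = 1 := by
      simpa using Complex.norm_exp_ofReal_mul_I (-a)
    calc _ ≤ 1 + 1 + |a| := (norm_add_le _ _).trans
            (add_le_add ((norm_sub_le _ _).trans (by rw [h₁, norm_one])) (by simp))
      _ ≤ 3 * a ^ 2 := by rw [← sq_abs a]; nlinarith

variable {α : Type*} [MeasurableSpace α] {μ : Measure α}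

/-- Multiplication by a bounded measurable function is a bounded operator on `L²`. -/
theorem exists_clm_coeFn_ae_eq_mul {w : α → ℂ} (hw : AEStronglyMeasurable w μ) {K : ℝ}
    (hK : ∀ x, ‖w x‖ ≤ K) :
    ∃ B : Lp ℂ 2 μ →L[ℂ] Lp ℂ 2 μ, ∀ f : Lp ℂ 2 μ, B f =ᵐ[μ] fun x => w x * f x := by
  have hmem : MemLp w ∞ μ := memLp_top_of_bound hw K (Eventually.of_forall hK)
  refine ⟨(ContinuousLinearMap.mul ℂ ℂ).holderL μ ∞ 2 2 hmem.toLp, fun f => ?_⟩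
  refine ((ContinuousLinearMap.mul ℂ ℂ).coeFn_holder hmem.toLp f).trans ?_
  filter_upwards [hmem.coeFn_toLp] with x hx
  simp [hx]

variable {w : α → ℝ} {T : ℝ → Lp ℂ 2 μ →L[ℂ] Lp ℂ 2 μ}

theorem norm_phase_apply
    (hT : ∀ τ f, T τ f =ᵐ[μ] fun x => Complex.exp (-(((τ * w x : ℝ) : ℂ) * Complex.I)) * f x)
    (τ : ℝ) (f : Lp ℂ 2 μ) : ‖T τ f‖ = ‖f‖ := by
  rw [Lp.norm_def, Lp.norm_def]
  congr 1
  refine eLpNorm_congr_norm_ae ?_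
  filter_upwards [hT τ f] with x hx
  have : ‖Complex.exp (-(((τ * w x : ℝ) : ℂ) * Complex.I))‖ = 1 := by
    simpa using Complex.norm_exp_ofReal_mul_I (-(τ * w x))
  rw [hx, norm_mul, this, one_mul]

theorem phase_zero_apply
    (hT : ∀ τ f, T τ f =ᵐ[μ] fun x => Complex.exp (-(((τ * w x : ℝ) : ℂ) * Complex.I)) * f x)
    (f : Lp ℂ 2 μ) : T 0 f = f := by
  refine Lp.ext ?_
  filter_upwards [hT 0 f] with x hx
  simp [hx]

theorem phase_add_apply
    (hT : ∀ τ f, T τ f =ᵐ[μ] fun x => Complex.exp (-(((τ * w x : ℝ) : ℂ) * Complex.I)) * f x)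
    (a b : ℝ) (f : Lp ℂ 2 μ) : T (a + b) f = T a (T b f) := by
  refine Lp.ext ?_
  filter_upwards [hT (a + b) f, hT a (T b f), hT b f] with x h₁ h₂ h₃
  rw [h₁, h₂, h₃, ← mul_assoc, ← Complex.exp_add]
  congr 2
  push_cast
  ring

theorem continuous_phase_apply
    (hT : ∀ τ f, T τ f =ᵐ[μ] fun x => Complex.exp (-(((τ * w x : ℝ) : ℂ) * Complex.I)) * f x)
    (f : Lp ℂ 2 μ) : Continuous fun τ => T τ f := by
  refine continuous_iff_continuousAt.2 fun a => tendsto_iff_norm_sub_tendsto_zero.2 ?_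
  let e : ℝ → α → ℂ := fun τ x => Complex.exp (-(((τ * w x : ℝ) : ℂ) * Complex.I))
  have he (τ : ℝ) (x : α) : ‖e τ x‖ = 1 := by
    simpa [e] using Complex.norm_exp_ofReal_mul_I (-(τ * w x))
  have hae (τ : ℝ) : (fun x => ‖(T τ f - T a f : Lp ℂ 2 μ) x‖ ^ 2) =ᵐ[μ]
      fun x => ‖e τ x * f x - e a x * f x‖ ^ 2 := by
    filter_upwards [Lp.coeFn_sub (T τ f) (T a f), hT τ f, hT a f] with x h₁ h₂ h₃
    rw [h₁, Pi.sub_apply, h₂, h₃]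
  have hnorm (τ : ℝ) : ‖T τ f - T a f‖ ^ 2 = ∫ x, ‖e τ x * f x - e a x * f x‖ ^ 2 ∂μ := by
    rw [← integral_congr_ae (hae τ), ← @inner_self_eq_norm_sq ℂ, L2.inner_def]
    simp_rw [inner_self_eq_norm_sq_to_K]
    norm_cast
  have hint := (memLp_two_iff_integrable_sq_norm (Lp.aestronglyMeasurable f)).1 (Lp.memLp f)
  have hc : ContinuousAt (fun τ => ∫ x, ‖e τ x * f x - e a x * f x‖ ^ 2 ∂μ) a := by
    refine continuousAt_of_dominated (bound := fun x => 4 * ‖f x‖ ^ 2)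
      (Eventually.of_forall fun τ => ?_)
      (Eventually.of_forall fun τ => Eventually.of_forall fun x => ?_) (hint.const_mul 4)
      (Eventually.of_forall fun x => ?_)
    · exact ((Lp.aestronglyMeasurable (T τ f - T a f)).norm.pow 2).congr (hae τ)
    · have : ‖e τ x * f x - e a x * f x‖ ≤ 2 * ‖f x‖ :=
        (norm_sub_le _ _).trans_eq (by rw [norm_mul, norm_mul, he, he]; ring)
      rw [Real.norm_eq_abs, abs_of_nonneg (by positivity)]
      exact (pow_le_pow_left₀ (norm_nonneg _) this 2).trans_eq (by ring)
    · simp only [e]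
      fun_prop
  have h₀ : Tendsto (fun τ => ‖T τ f - T a f‖ ^ 2) (𝓝 a) (𝓝 0) := by
    simpa [← hnorm, ContinuousAt] using hc
  simpa using h₀.sqrt

/-- The group of multiplications by `exp (-iτw)` is generated, in operator norm, by the
multiplication by `-iw`. -/
theorem norm_phase_sub_sub_smul_le
    (hT : ∀ τ f, T τ f =ᵐ[μ] fun x => Complex.exp (-(((τ * w x : ℝ) : ℂ) * Complex.I)) * f x)
    {K : ℝ} (hK : ∀ x, |w x| ≤ K) {B : Lp ℂ 2 μ →L[ℂ] Lp ℂ 2 μ}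
    (hB : ∀ f, B f =ᵐ[μ] fun x => -(w x * Complex.I) * f x) (τ : ℝ) (f : Lp ℂ 2 μ) :
    ‖T τ f - f - τ • B f‖ ≤ 3 * K ^ 2 * τ ^ 2 * ‖f‖ := by
  refine Lp.norm_le_mul_norm_of_ae_le_mul ?_
  filter_upwards [Lp.coeFn_sub (T τ f - f) (τ • B f), Lp.coeFn_sub (T τ f) f,
    Lp.coeFn_smul τ (B f), hT τ f, hB f] with x h₁ h₂ h₃ h₄ h₅
  rw [h₁, Pi.sub_apply, h₂, Pi.sub_apply, h₃, Pi.smul_apply, h₄, h₅, Complex.real_smul]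
  have : Complex.exp (-(((τ * w x : ℝ) : ℂ) * Complex.I)) * f x - f x
      - τ * (-(w x * Complex.I) * f x)
      = (Complex.exp (-(((τ * w x : ℝ) : ℂ) * Complex.I)) - 1
        + ((τ * w x : ℝ) : ℂ) * Complex.I) * f x := by
    push_cast
    ring
  rw [this, norm_mul]
  gcongr
  refine (norm_exp_neg_ofReal_mul_I_sub_le _).trans ?_
  have : w x ^ 2 ≤ K ^ 2 := sq_le_sq' (neg_le_of_abs_le (hK x)) (le_of_abs_le (hK x))
  nlinarith [mul_le_mul_of_nonneg_left this (sq_nonneg τ)]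

end Multiplication

/-- **Trotter product formula for the Schrödinger propagator with a bounded potential**:
for a bounded measurable real potential `V`, the Trotter approximations
`E_n(t) = (U₀(t/n) ∘ M_{t/n})^n` converge strongly on `L²(ℝ^d)` as `n → ∞`. Here `F` is
the unitary Fourier–Plancherel transform (characterized by the usual integral formula on
`L¹ ∩ L²`), `U₀(τ) = e^{iτΔ/2} = F⁻¹ ∘ (mult. by e^{-2π²iτ|ξ|²}) ∘ F` is the free
propagator (characterized by `F(U₀(τ)f) = e^{-2π²iτ|ξ|²} F f` a.e.), and `M_τ` is
multiplication by `e^{-iτV}`. -/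
theorem trotter_product_formula
    {d : ℕ} (hd : 1 ≤ d)
    (V : EuclideanSpace ℝ (Fin d) → ℝ) (hVmeas : Measurable V)
    (hVbdd : ∃ M : ℝ, ∀ x, |V x| ≤ M)
    (F : Lp ℂ 2 (volume : Measure (EuclideanSpace ℝ (Fin d))) ≃ₗᵢ[ℂ]
      Lp ℂ 2 (volume : Measure (EuclideanSpace ℝ (Fin d))))
    (hF : ∀ f : Lp ℂ 2 (volume : Measure (EuclideanSpace ℝ (Fin d))),
      Integrable (f : EuclideanSpace ℝ (Fin d) → ℂ) →
      (F f : EuclideanSpace ℝ (Fin d) → ℂ) =ᵐ[volume] fun ξ =>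
        ∫ x, Complex.exp (-(((2 * π * ⟪ξ, x⟫ : ℝ) : ℂ) * Complex.I)) * f x)
    (U₀ : ℝ → Lp ℂ 2 (volume : Measure (EuclideanSpace ℝ (Fin d))) →L[ℂ]
      Lp ℂ 2 (volume : Measure (EuclideanSpace ℝ (Fin d))))
    (hU₀ : ∀ (τ : ℝ) (f : Lp ℂ 2 (volume : Measure (EuclideanSpace ℝ (Fin d)))),
      (F (U₀ τ f) : EuclideanSpace ℝ (Fin d) → ℂ) =ᵐ[volume] fun ξ =>
        Complex.exp (-(((2 * π ^ 2 * τ * ‖ξ‖ ^ 2 : ℝ) : ℂ) * Complex.I)) *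
          (F f : EuclideanSpace ℝ (Fin d) → ℂ) ξ)
    (Mul : ℝ → Lp ℂ 2 (volume : Measure (EuclideanSpace ℝ (Fin d))) →L[ℂ]
      Lp ℂ 2 (volume : Measure (EuclideanSpace ℝ (Fin d))))
    (hMul : ∀ (τ : ℝ) (f : Lp ℂ 2 (volume : Measure (EuclideanSpace ℝ (Fin d)))),
      (Mul τ f : EuclideanSpace ℝ (Fin d) → ℂ) =ᵐ[volume] fun x =>
        Complex.exp (-(((τ * V x : ℝ) : ℂ) * Complex.I)) * f x) :
    ∀ (t : ℝ) (φ : Lp ℂ 2 (volume : Measure (EuclideanSpace ℝ (Fin d)))),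
      ∃ ψ : Lp ℂ 2 (volume : Measure (EuclideanSpace ℝ (Fin d))),
        Tendsto (fun n : ℕ => (((U₀ (t / n)).comp (Mul (t / n))) ^ n) φ)
          atTop (𝓝 ψ) := by
  obtain ⟨K, hK⟩ := hVbdd
  intro t φ
  obtain ⟨B, hB⟩ := exists_clm_coeFn_ae_eq_mul (w := fun x => -(V x * Complex.I)) (K := K)
    (μ := (volume : Measure (EuclideanSpace ℝ (Fin d))))
    (by fun_prop) (fun x => by simpa using hK x)
  let T : ℝ → Lp ℂ 2 (volume : Measure (EuclideanSpace ℝ (Fin d))) →L[ℂ]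
      Lp ℂ 2 (volume : Measure (EuclideanSpace ℝ (Fin d))) := fun τ =>
    (F.toContinuousLinearEquiv : _ →L[ℂ] _).comp
      ((U₀ τ).comp (F.symm.toContinuousLinearEquiv : _ →L[ℂ] _))
  have hTapp (τ f) : T τ f = F (U₀ τ (F.symm f)) := rfl
  have hU₀T (τ f) : U₀ τ f = F.symm (T τ (F f)) := by simp [hTapp]
  have hT (τ f) : T τ f =ᵐ[volume] fun ξ => Complex.exp (-(((τ * (2 * π ^ 2 * ‖ξ‖ ^ 2) : ℝ) : ℂ) *
      Complex.I)) * f ξ := by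
    refine (hU₀ τ (F.symm f)).trans (Eventually.of_forall fun ξ => ?_)
    simp only [LinearIsometryEquiv.apply_symm_apply]
    congr 5
    ring
  have hU₀c (f) : Continuous fun τ => U₀ τ f := by
    simpa only [hU₀T, Function.comp_def] using F.symm.continuous.comp (continuous_phase_apply hT (F f))
  obtain ⟨ψ, hψ⟩ := exists_tendsto_trotter (U := fun τ => (U₀ τ).restrictScalars ℝ)
    (M := fun τ => (Mul τ).restrictScalars ℝ) (B := B.restrictScalars ℝ) (C := 3 * K ^ 2)
    (by positivity) (fun f => by simp [hU₀T, phase_zero_apply hT])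
    (fun a b f => by simp [hU₀T, phase_add_apply hT])
    (fun a f => by simp [hU₀T, norm_phase_apply hT]) hU₀c
    (fun a f => norm_phase_apply hMul a f)
    (fun a f => norm_phase_sub_sub_smul_le hMul hK hB a f) t φ
  refine ⟨ψ, hψ.congr fun n => ?_⟩
  rw [FunLike.coe_pow_eq_iterate]
  rfl
end
end
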